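/- Let p > 3 be a prime and let t be an integer with t² < 4p such that t² − 4p is squarefree. Then the number of pairs (a,b) ∈ 𝔽_p² with 4a³+27b² ≠ 0 such that a_p(E(a,b)) = t equals (p−1) · h(t²−4p)/w(t²−4p), where h(t²−4p) is the class number of the imaginary quadratic field ℚ(√(t²−4p)) and w(t²−4p) is the number of roots of unity in ℚ(√(t²−4p)). -/

import Mathlib

noncomputable section

/-- Number of affine points of `y² = x³ + ax + b` over `ZMod p`. -/
def affPts (p : ℕ) (a b : ZMod p) : ℕ :=
  Nat.card {xy : ZMod p × ZMod p // xy.2 ^ 2 = xy.1 ^ 3 + a * xy.1 + b}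

/-- Trace of Frobenius `a_p = p + 1 - #E(𝔽_p)`, the projective count being
the affine count plus the point at infinity. -/
def apE (p : ℕ) (a b : ZMod p) : ℤ := (p : ℤ) + 1 - ((affPts p a b : ℤ) + 1)

/-- `Δ(r,h)`: squarefree integers congruent to `r` modulo `h`. -/
def DeltaSet (r : ℤ) (h : ℕ) : Set ℤ := {n : ℤ | Squarefree n ∧ n ≡ r [ZMOD (h : ℤ)]}

noncomputable section

/-- The coefficient of `X ^ (p - 1)` in `(X ^ 3 + a X + b) ^ ((p - 1) / 2)`. -/
def hasseCoeff (p : ℕ) {R : Type*} [CommRing R] (a b : R) : R :=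
  ((Polynomial.X ^ 3 + Polynomial.C a * Polynomial.X + Polynomial.C b) ^ ((p - 1) / 2)).coeff
    (p - 1)

theorem map_hasseCoeff (p : ℕ) {R S : Type*} [CommRing R] [CommRing S] (φ : R →+* S) (a b : R) :
    φ (hasseCoeff p a b) = hasseCoeff p (φ a) (φ b) := by
  unfold hasseCoeff
  rw [← Polynomial.coeff_map]
  simp

section PointCount

variable (p : ℕ) [Fact p.Prime]

theorem apE_eq_neg_sum (hp : p ≠ 2) (a b : ZMod p) :
    apE p a b = -∑ x : ZMod p, quadraticChar (ZMod p) (x ^ 3 + a * x + b) := by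
  have hr : ringChar (ZMod p) ≠ 2 := by rwa [ZMod.ringChar_zmod_n]
  have h1 : (affPts p a b : ℤ) =
      ∑ x : ZMod p, (quadraticChar (ZMod p) (x ^ 3 + a * x + b) + 1) := by
    unfold affPts
    rw [Nat.card_eq_fintype_card, Fintype.card_subtype]
    rw [Finset.card_filter, ← Finset.univ_product_univ, Finset.sum_product]
    push_cast
    refine Finset.sum_congr rfl fun x _ => ?_
    rw [← quadraticChar_card_sqrts hr]
    rw [Set.toFinset_card, Fintype.card_ofFinset]
    simp only [Set.mem_ofPred_eq]
    rw [Finset.card_filter]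
    push_cast
    rfl
  unfold apE
  rw [h1, Finset.sum_add_distrib]
  simp

theorem quadraticChar_cast_eq_pow (hp : p ≠ 2) (x : ZMod p) :
    ((quadraticChar (ZMod p) x : ℤ) : ZMod p) = x ^ ((p - 1) / 2) := by
  have hr : ringChar (ZMod p) ≠ 2 := by rwa [ZMod.ringChar_zmod_n]
  rw [quadraticChar_eq_pow_of_char_ne_two' hr, ZMod.card]
  congr 1
  have := (Fact.out : p.Prime).eq_two_or_odd
  omega

theorem sum_eval_eq_neg_coeff (P : Polynomial (ZMod p)) (hP : P.natDegree < 2 * (p - 1))  :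
    ∑ x : ZMod p, P.eval x = -P.coeff (p - 1) := by
  have hp := (Fact.out : p.Prime).two_le
  simp_rw [Polynomial.eval_eq_sum_range' hP]
  rw [Finset.sum_comm]
  simp_rw [← Finset.mul_sum]
  rw [Finset.sum_eq_single (p - 1)]
  · have : ∑ x : ZMod p, x ^ (p - 1) = -1 := by
      simp_rw [ZMod.pow_card_sub_one]
      rw [Finset.sum_ite]
      simp [Finset.filter_ne', Finset.card_erase_of_mem]
      rw [Nat.cast_sub (by omega)]
      simp
    rw [this]; ring
  · intro i hi hne
    have hi := Finset.mem_range.1 hi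
    rcases Nat.lt_or_gt_of_ne hne with h | h
    · rw [FiniteField.sum_pow_lt_card_sub_one _ i (by rwa [ZMod.card]), mul_zero]
    · have : ∀ x : ZMod p, x ^ i = x ^ (i - (p - 1)) := by
        intro x
        by_cases hx : x = 0
        · subst hx; rw [zero_pow (by omega), zero_pow (by omega)]
        · conv_lhs => rw [show i = (p - 1) + (i - (p - 1)) by omega, pow_add,
            ZMod.pow_card_sub_one_eq_one hx, one_mul]
      simp_rw [this]
      rw [FiniteField.sum_pow_lt_card_sub_one _ _ (by rw [ZMod.card]; omega), mul_zero]
  · intro h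
    simp only [Finset.mem_range, not_lt] at h
    omega

theorem natDegree_cubic {R : Type*} [CommRing R] [Nontrivial R] (a b : R) :
    (Polynomial.X ^ 3 + Polynomial.C a * Polynomial.X + Polynomial.C b).natDegree = 3 := by
  compute_degree!

theorem monic_cubic {R : Type*} [CommRing R] [Nontrivial R] (a b : R) :
    (Polynomial.X ^ 3 + Polynomial.C a * Polynomial.X + Polynomial.C b).Monic := by
  monicity!

theorem apE_cast (hp : 3 < p) (a b : ZMod p) : (apE p a b : ZMod p) = hasseCoeff p a b := by
  have hodd := (Fact.out : p.Prime).eq_two_or_odd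
  rw [apE_eq_neg_sum p (by omega)]
  push_cast
  simp_rw [quadraticChar_cast_eq_pow p (by omega)]
  have h := sum_eval_eq_neg_coeff p
    ((Polynomial.X ^ 3 + Polynomial.C a * Polynomial.X + Polynomial.C b) ^ ((p - 1) / 2)) (by
      rw [Polynomial.natDegree_pow, natDegree_cubic]; omega)
  simp only [Polynomial.eval_pow, Polynomial.eval_add, Polynomial.eval_mul, Polynomial.eval_X,
    Polynomial.eval_C] at h
  rw [h, neg_neg, hasseCoeff]

theorem apE_twist (hp : 3 < p) (a b d : ZMod p) (hd : d ≠ 0) :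
    apE p (d ^ 2 * a) (d ^ 3 * b) = quadraticChar (ZMod p) d * apE p a b := by
  rw [apE_eq_neg_sum p (by omega), apE_eq_neg_sum p (by omega), mul_neg, Finset.mul_sum]
  congr 1
  rw [← Equiv.sum_comp (Equiv.mulLeft₀ d hd)]
  refine Finset.sum_congr rfl fun x _ => ?_
  change quadraticChar (ZMod p) ((d * x) ^ 3 + d ^ 2 * a * (d * x) + d ^ 3 * b) = _
  rw [show (d * x) ^ 3 + d ^ 2 * a * (d * x) + d ^ 3 * b = (d ^ 2) * (d * (x ^ 3 + a * x + b)) by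
    ring, map_mul, map_mul, quadraticChar_sq_one' hd, one_mul]

theorem stepanov_aux (hp : 3 < p) (a b e : ZMod p) (he : e ^ 2 = 1) :
    2 * (Finset.univ.filter fun x : ZMod p => (x ^ 3 + a * x + b) ^ ((p - 1) / 2) = e).card +
      (Finset.univ.filter fun x : ZMod p => x ^ 3 + a * x + b = 0).card ≤ 3 * ((p + 1) / 2) := by
  have hodd := (Fact.out : p.Prime).eq_two_or_odd
  have he0 : e ≠ 0 := by rintro rfl; simp at he
  set m := (p - 1) / 2 with hm
  have hm0 : m ≠ 0 := by omega
  set f : Polynomial (ZMod p) :=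
    Polynomial.X ^ 3 + Polynomial.C a * Polynomial.X + Polynomial.C b with hf
  have hfe : ∀ x, f.eval x = x ^ 3 + a * x + b := fun x => by simp [hf]
  set L : Polynomial (ZMod p) :=
    2 * f + f.derivative * (Polynomial.X ^ p - Polynomial.X) with hL
  set G : Polynomial (ZMod p) := Polynomial.C (-2 * e) * f ^ (m + 1) + L with hG
  have hfd : f.derivative = 3 * Polynomial.X ^ 2 + Polynomial.C a := by
    rw [hf]
    simp only [Polynomial.derivative_add, Polynomial.derivative_X_pow, Polynomial.derivative_C_mul,
      Polynomial.derivative_C, Polynomial.derivative_X]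
    push_cast
    simp only [map_ofNat]
    ring
  have h2 : (2 : ZMod p) ≠ 0 := by
    have : ((2 : ℕ) : ZMod p) ≠ 0 := by
      rw [Ne, ZMod.natCast_eq_zero_iff]
      intro h
      have := Nat.le_of_dvd (by norm_num) h
      omega
    exact_mod_cast this
  have hLd : L.natDegree ≤ p + 2 := by
    rw [hL, hfd, hf]
    refine Polynomial.natDegree_add_le_of_degree_le ?_ ?_
    · refine le_trans (b := 3) ?_ (by omega)
      compute_degree
    · have : (3 * Polynomial.X ^ 2 + Polynomial.C a : Polynomial (ZMod p)).natDegree ≤ 2 := by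
        compute_degree
      have h' : (Polynomial.X ^ p - Polynomial.X : Polynomial (ZMod p)).natDegree ≤ p := by
        refine (Polynomial.natDegree_sub_le _ _).trans ?_
        simp; omega
      exact Polynomial.natDegree_mul_le.trans (by omega)
  have hfm : (f ^ (m + 1)).Monic := (monic_cubic a b).pow _
  have hfmd : (f ^ (m + 1)).natDegree = 3 * (m + 1) := by
    rw [Polynomial.natDegree_pow, natDegree_cubic, mul_comm]
  have hne : -2 * e ≠ 0 := mul_ne_zero (neg_ne_zero.2 h2) he0
  have hGd : G.natDegree = 3 * (m + 1) := by
    rw [hG, Polynomial.natDegree_add_eq_left_of_natDegree_lt]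
    · rw [Polynomial.natDegree_C_mul hne, hfmd]
    · rw [Polynomial.natDegree_C_mul hne, hfmd]; omega
  have hG0 : G ≠ 0 := by
    intro h
    rw [h] at hGd; simp at hGd
  have key1 : ∀ x, (f.eval x) = 0 → 1 ≤ G.rootMultiplicity x := by
    intro x hx
    rw [Nat.one_le_iff_ne_zero, ← Nat.pos_iff_ne_zero, Polynomial.rootMultiplicity_pos hG0]
    simp [hG, hL, Polynomial.IsRoot, hx, ZMod.pow_card]
  have key2 : ∀ x, (f.eval x) ^ m = e → 2 ≤ G.rootMultiplicity x := by
    intro x hx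
    refine Nat.succ_le_of_lt ?_
    rw [Polynomial.one_lt_rootMultiplicity_iff_isRoot hG0]
    have hmc : ((m : ZMod p)) * 2 = -1 := by
      have : ((m * 2 + 1 : ℕ) : ZMod p) = 0 := by
        rw [show m * 2 + 1 = p by omega]; simp
      push_cast at this
      linear_combination this
    constructor
    · simp only [hG, hL, Polynomial.IsRoot, Polynomial.eval_add, Polynomial.eval_mul,
        Polynomial.eval_C, Polynomial.eval_pow, Polynomial.eval_sub, Polynomial.eval_X,
        ZMod.pow_card, pow_succ, hx, Polynomial.eval_ofNat]
      linear_combination -2 * (f.eval x) * he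
    · simp only [hG, hL, Polynomial.IsRoot, Polynomial.eval_add, Polynomial.eval_mul,
        Polynomial.eval_C, Polynomial.eval_pow, Polynomial.eval_sub, Polynomial.eval_X,
        Polynomial.derivative_add, Polynomial.derivative_mul, Polynomial.derivative_C,
        Polynomial.derivative_pow, Polynomial.derivative_sub, Polynomial.derivative_X,
        Polynomial.derivative_ofNat, Polynomial.eval_zero, Polynomial.eval_one,
        ZMod.pow_card, hx, Polynomial.eval_ofNat, Nat.add_sub_cancel]
      push_cast
      simp only [CharP.cast_eq_zero]
      linear_combination (-2 * (m + 1) * (Polynomial.derivative f).eval x) * he -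
        (Polynomial.derivative f).eval x * hmc
  calc _ = ∑ x : ZMod p, ((if (x ^ 3 + a * x + b) ^ m = e then 2 else 0) +
        (if x ^ 3 + a * x + b = 0 then 1 else 0)) := by
        rw [Finset.sum_add_distrib, Finset.card_filter, Finset.card_filter, Finset.mul_sum]
        simp
    _ ≤ ∑ x : ZMod p, G.rootMultiplicity x := by
        refine Finset.sum_le_sum fun x _ => ?_
        rw [← hfe]
        by_cases h0 : f.eval x = 0
        · have : ¬ (f.eval x) ^ m = e := by
            rw [h0, zero_pow hm0]; exact fun h => he0 h.symm
          rw [if_neg this, if_pos h0]; exact key1 x h0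
        · by_cases h1 : (f.eval x) ^ m = e
          · rw [if_neg h0, if_pos h1]; exact key2 x h1
          · simp [h0, h1]
    _ = Multiset.card G.roots := by
        simp_rw [← Polynomial.count_roots]
        rw [Multiset.sum_count_eq_card]
        simp
    _ ≤ G.natDegree := Polynomial.card_roots' G
    _ = _ := by rw [hGd]; omega

/-- An elementary bound for the trace of Frobenius, weaker than that of Hasse. -/
theorem abs_apE_le (hp : 3 < p) (a b : ZMod p) : 2 * |apE p a b| ≤ p + 3 := by
  have hodd := (Fact.out : p.Prime).eq_two_or_odd
  have h1 := stepanov_aux p hp a b 1 (by norm_num)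
  have h2 := stepanov_aux p hp a b (-1) (by norm_num)
  have hne : (1 : ZMod p) ≠ -1 := by
    intro h
    have : ((2 : ℕ) : ZMod p) = 0 := by push_cast; linear_combination h
    rw [ZMod.natCast_eq_zero_iff] at this
    have := Nat.le_of_dvd (by norm_num) this
    omega
  have hval : ∀ x : ZMod p, quadraticChar (ZMod p) x =
      (if x ^ ((p - 1) / 2) = 1 then 1 else 0) - (if x ^ ((p - 1) / 2) = -1 then 1 else 0) ∧
      (1 : ℤ) = (if x ^ ((p - 1) / 2) = 1 then 1 else 0) +
        (if x ^ ((p - 1) / 2) = -1 then 1 else 0) + (if x = 0 then 1 else 0) := by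
    intro x
    have hc := quadraticChar_cast_eq_pow p (by omega) x
    by_cases hx : x = 0
    · subst hx
      have : (0 : ZMod p) ^ ((p - 1) / 2) = 0 := zero_pow (by omega)
      rw [this]
      simp
    · rcases quadraticChar_dichotomy hx with h | h
      · rw [h] at hc; push_cast at hc; rw [← hc, h]; simp [hne, hx]
      · rw [h] at hc; push_cast at hc; rw [← hc, h]; simp [hne.symm, hx]
  set N1 := (Finset.univ.filter fun x : ZMod p => (x ^ 3 + a * x + b) ^ ((p - 1) / 2) = 1).card
  set N2 := (Finset.univ.filter fun x : ZMod p => (x ^ 3 + a * x + b) ^ ((p - 1) / 2) = -1).card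
  set N0 := (Finset.univ.filter fun x : ZMod p => x ^ 3 + a * x + b = 0).card
  have e1 : apE p a b = N2 - N1 := by
    rw [apE_eq_neg_sum p (by omega)]
    simp_rw [fun x : ZMod p => (hval (x ^ 3 + a * x + b)).1]
    rw [Finset.sum_sub_distrib]
    simp [N1, N2]
  have e2 : (p : ℤ) = N1 + N2 + N0 := by
    have : ∑ x : ZMod p, (1 : ℤ) = p := by simp
    rw [← this, Finset.sum_congr rfl fun x _ => (hval (x ^ 3 + a * x + b)).2]
    rw [Finset.sum_add_distrib, Finset.sum_add_distrib]
    simp [N1, N2, N0]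
  have : |apE p a b| ≤ (p + 3) / 2 := by
    rw [abs_le]; omega
  omega

theorem apE_even_of_b_zero (hp : 3 < p) (a : ZMod p) : Even (apE p a 0) := by
  have hodd := (Fact.out : p.Prime).eq_two_or_odd
  rw [apE_eq_neg_sum p (by omega), even_neg]
  rw [← Finset.add_sum_erase _ _ (Finset.mem_univ (0 : ZMod p))]
  simp only [ne_eq, OfNat.ofNat_ne_zero, not_false_eq_true, zero_pow, mul_zero, add_zero,
    quadraticChar_zero, zero_add]
  rw [← (ZMod.intCast_zmod_eq_zero_iff_dvd _ 2 |>.trans even_iff_two_dvd.symm)]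
  push_cast
  refine Finset.sum_involution (fun x _ => -x) ?_ ?_ ?_ ?_
  · intro x hx
    have : (-x) ^ 3 + a * (-x) = (-1) * (x ^ 3 + a * x) := by ring
    rw [this, map_mul]
    rcases quadraticChar_dichotomy (show (-1 : ZMod p) ≠ 0 by simp) with h | h <;> rw [h]
    · push_cast; rw [one_mul]; exact CharTwo.add_self_eq_zero _
    · push_cast; rw [neg_one_mul]; exact add_neg_cancel _
  · intro x hx _ h
    have hx0 := Finset.ne_of_mem_erase hx
    have h2 : (2 : ZMod p) * x = 0 := by linear_combination -h
    rcases mul_eq_zero.1 h2 with h | h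
    · have : ((2 : ℕ) : ZMod p) = 0 := by exact_mod_cast h
      rw [ZMod.natCast_eq_zero_iff] at this
      have := Nat.le_of_dvd (by norm_num) this
      omega
    · exact hx0 h
  · intro x hx
    simpa using hx
  · simp

end PointCount

theorem hasseCoeff_homog (p : ℕ) {R : Type*} [CommRing R] [IsDomain R] (a b d : R) (hd : d ≠ 0)
    (hodd : p % 2 = 1) :
    hasseCoeff p (d ^ 2 * a) (d ^ 3 * b) = d ^ ((p - 1) / 2) * hasseCoeff p a b := by
  unfold hasseCoeff
  set f := (Polynomial.X ^ 3 + Polynomial.C a * Polynomial.X + Polynomial.C b)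
  set g := (Polynomial.X ^ 3 + Polynomial.C (d ^ 2 * a) * Polynomial.X + Polynomial.C (d ^ 3 * b))
  have h : g.comp (Polynomial.C d * Polynomial.X) = Polynomial.C (d ^ 3) * f := by
    simp [f, g]; ring
  have h2 : (g ^ ((p - 1) / 2)).comp (Polynomial.C d * Polynomial.X) =
      Polynomial.C (d ^ (3 * ((p - 1) / 2))) * f ^ ((p - 1) / 2) := by
    rw [Polynomial.pow_comp, h, mul_pow, ← Polynomial.C_pow, ← pow_mul]
  have h3 := congrArg (fun q => Polynomial.coeff q (p - 1)) h2
  simp only [Polynomial.comp_C_mul_X_coeff, Polynomial.coeff_C_mul] at h3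
  have hpow : d ^ (3 * ((p - 1) / 2)) = d ^ ((p - 1) / 2) * d ^ (p - 1) := by
    rw [← pow_add]; congr 1; omega
  rw [hpow] at h3
  refine mul_right_cancel₀ (pow_ne_zero (p - 1) hd) ?_
  rw [h3]; ring

theorem hasseCoeff_zero_left (p : ℕ) {R : Type*} [CommRing R] (b : R) (h : p % 6 = 1) :
    hasseCoeff p 0 b = hasseCoeff p 0 1 * b ^ ((p - 1) / 6) := by
  have key : ∀ b : R, hasseCoeff p 0 b =
      b ^ ((p - 1) / 6) * (((p - 1) / 2).choose ((p - 1) / 3) : R) := by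
    intro b
    unfold hasseCoeff
    have e : ((Polynomial.X ^ 3 + Polynomial.C 0 * Polynomial.X + Polynomial.C b) ^ ((p - 1) / 2)) =
        Polynomial.expand R 3 ((Polynomial.X + Polynomial.C b) ^ ((p - 1) / 2)) := by simp
    have hc := Polynomial.coeff_expand_mul (R := R) (p := 3) (by norm_num)
      ((Polynomial.X + Polynomial.C b) ^ ((p - 1) / 2)) ((p - 1) / 3)
    rw [show (p - 1) / 3 * 3 = p - 1 by omega] at hc
    rw [e, hc, Polynomial.coeff_X_add_C_pow, show (p - 1) / 2 - (p - 1) / 3 = (p - 1) / 6 by omega]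
  rw [key b, key 1]; ring

theorem hasseCoeff_zero_left_of_mod (p : ℕ) {R : Type*} [CommRing R] (b : R) (h : p % 3 = 2) :
    hasseCoeff p 0 b = 0 := by
  unfold hasseCoeff
  have e : ((Polynomial.X ^ 3 + Polynomial.C 0 * Polynomial.X + Polynomial.C b) ^ ((p - 1) / 2)) =
      Polynomial.expand R 3 ((Polynomial.X + Polynomial.C b) ^ ((p - 1) / 2)) := by simp
  rw [e, Polynomial.coeff_expand (by norm_num), if_neg]
  omega

theorem hasseCoeff_zero_right_of_mod (p : ℕ) {R : Type*} [CommRing R] (a : R) (h : p % 4 = 3) :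
    hasseCoeff p a 0 = 0 := by
  unfold hasseCoeff
  have e : ((Polynomial.X ^ 3 + Polynomial.C a * Polynomial.X + Polynomial.C 0) ^ ((p - 1) / 2)) =
      Polynomial.expand R 2 ((Polynomial.X + Polynomial.C a) ^ ((p - 1) / 2)) *
        Polynomial.X ^ ((p - 1) / 2) := by
    simp only [map_zero, add_zero, map_pow, map_add, Polynomial.expand_X, Polynomial.expand_C]
    rw [← mul_pow]; ring
  rw [e, Polynomial.coeff_mul_X_pow', if_pos (by omega), Polynomial.coeff_expand (by norm_num),
    if_neg]
  omega
end

noncomputable section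

section Hasse

open PowerSeries

variable {κ : Type*} [CommRing κ]

/-- The `θ - 2` operator, where `θ = z d/dz`. -/
def thetaSubTwo (x : PowerSeries κ) : PowerSeries κ :=
  PowerSeries.X * PowerSeries.derivative κ x - 2 * x

theorem coeff_thetaSubTwo (x : PowerSeries κ) (n : ℕ) :
    coeff n (thetaSubTwo x) = ((n : κ) - 2) * coeff n x := by
  unfold thetaSubTwo
  have h2 : (2 : PowerSeries κ) * x = (2 : κ) • x := by
    rw [two_mul, two_smul]
  cases n with
  | zero => simp [h2]
  | succ n =>
    rw [map_sub, mul_comm X, coeff_succ_mul_X, coeff_derivative, h2, coeff_smul]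
    push_cast
    simp only [smul_eq_mul]; ring

theorem homogenize_pow_eq_sum [IsDomain κ] (a b : κ) (x w : PowerSeries κ) (hw : w ≠ 0) (m : ℕ) :
    (x ^ 3 + C a * w ^ 2 * x + C b * w ^ 3) ^ m =
      ∑ i ∈ Finset.range (3 * m + 1), C (((Polynomial.X ^ 3 + Polynomial.C a * Polynomial.X +
        Polynomial.C b) ^ m).coeff i) * x ^ i * w ^ (3 * m - i) := by
  set K := FractionRing (PowerSeries κ)
  let ι : PowerSeries κ →+* K := algebraMap _ _
  have hι : Function.Injective ι := IsFractionRing.injective _ _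
  have hw' : ι w ≠ 0 := fun h => hw (hι (by rw [h, map_zero]))
  apply hι
  set f := Polynomial.X ^ 3 + Polynomial.C a * Polynomial.X + Polynomial.C b with hf
  have hd : (f ^ m).natDegree < 3 * m + 1 := by
    rw [Polynomial.natDegree_pow, natDegree_cubic]; omega
  obtain ⟨u, hux⟩ : ∃ u, ι x = u * ι w := ⟨ι x / ι w, by rw [div_mul_cancel₀ _ hw']⟩
  have h1 : (f ^ m).eval₂ (ι.comp C) u * ι w ^ (3 * m) =
      ι ((x ^ 3 + C a * w ^ 2 * x + C b * w ^ 3) ^ m) := by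
    rw [Polynomial.eval₂_pow, pow_mul, ← mul_pow, map_pow]
    congr 1
    simp only [hf, Polynomial.eval₂_add, Polynomial.eval₂_mul, Polynomial.eval₂_pow,
      Polynomial.eval₂_X, Polynomial.eval₂_C, map_add, map_mul, map_pow, RingHom.comp_apply]
    rw [hux]; ring
  rw [← h1, Polynomial.eval₂_eq_sum_range' _ hd, Finset.sum_mul, map_sum]
  refine Finset.sum_congr rfl fun i hi => ?_
  have hi := Finset.mem_range.1 hi
  simp only [map_mul, map_pow, RingHom.comp_apply]
  rw [show 3 * m = i + (3 * m - i) by omega, pow_add, Nat.add_sub_cancel_left]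
  rw [hux]; ring

theorem coeff_pow_charP_eq_zero (p : ℕ) [Fact p.Prime] [CharP κ p] (y : PowerSeries κ) :
    coeff (p - 1) (y ^ p) = 0 := by
  have hp := (Fact.out : p.Prime).two_le
  have h := congrArg (coeff (p - 2)) ((PowerSeries.derivative κ).leibniz_pow y p)
  have h0 : (p : PowerSeries κ) = 0 := by
    rw [← map_natCast (C : κ →+* PowerSeries κ), CharP.cast_eq_zero, map_zero]
  rw [coeff_derivative, nsmul_eq_mul, h0, zero_mul, map_zero,
    show p - 2 + 1 = p - 1 by omega] at h
  have h1 : (((p - 2 : ℕ) : κ) + 1) = -1 := by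
    have : (((p - 2 : ℕ) + 2 : ℕ) : κ) = 0 := by
      rw [show p - 2 + 2 = p by omega]; simp
    push_cast at this
    linear_combination this
  rw [h1] at h
  simpa using h

theorem isUnit_natCast_of_not_dvd (p : ℕ) [Fact p.Prime] [CharP κ p] (n : ℕ) (hn : ¬ p ∣ n) :
    IsUnit (n : κ) :=
  (CharP.isUnit_natCast_iff (Fact.out : p.Prime)).2 hn

theorem two_mul_hasseCoeff_of_ode [IsDomain κ] (p : ℕ) [Fact p.Prime] (hp : 3 < p) [CharP κ p]
    (a b P : κ) (x : PowerSeries κ) (hx : coeff 0 x = 1)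
    (hode : ∀ n < p, coeff n (thetaSubTwo x ^ 2) =
      coeff n (4 * (x ^ 3 + C a * X ^ 4 * x + C b * X ^ 6 + C P * X ^ (p - 1)))) :
    2 * hasseCoeff p a b = P := by
  have hodd := (Fact.out : p.Prime).eq_two_or_odd
  set Y := thetaSubTwo x with hY
  have hY0 : coeff 0 Y = -2 := by rw [hY, coeff_thetaSubTwo, hx]; simp
  set m := (p - 1) / 2 with hm
  have hmp : p = 2 * m + 1 := by omega
  set F := x ^ 3 + C a * X ^ 4 * x + C b * X ^ 6 with hF
  have h2m : (2 : κ) * m = -1 := by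
    have : ((2 * m + 1 : ℕ) : κ) = 0 := by rw [← hmp]; simp
    push_cast at this
    linear_combination this
  have hdvd : (X : PowerSeries κ) ^ p ∣ Y ^ 2 - 4 * (F + C P * X ^ (p - 1)) := by
    rw [X_pow_dvd_iff]
    intro n hn
    rw [map_sub, hode n hn, sub_self]
  have hd2 : (X : PowerSeries κ) ^ p ∣
      Y ^ p - Y * (4 ^ m * (F ^ m + (m : PowerSeries κ) * F ^ (m - 1) * (C P * X ^ (p - 1)))) := by
    have e1 : Y ^ p - Y * (4 * (F + C P * X ^ (p - 1))) ^ m =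
        Y * ((Y ^ 2) ^ m - (4 * (F + C P * X ^ (p - 1))) ^ m) := by
      rw [← pow_mul, mul_sub, ← pow_succ', ← hmp]
    have e2 : (X : PowerSeries κ) ^ p ∣ Y ^ p - Y * (4 * (F + C P * X ^ (p - 1))) ^ m := by
      rw [e1]
      exact Dvd.dvd.mul_left (hdvd.trans (sub_dvd_pow_sub_pow _ _ m)) _
    have e3 : (X : PowerSeries κ) ^ p ∣ (F + C P * X ^ (p - 1)) ^ m -
        (F ^ m + (m : PowerSeries κ) * F ^ (m - 1) * (C P * X ^ (p - 1))) := by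
      obtain ⟨k, hk⟩ := Polynomial.powAddExpansion F (C P * X ^ (p - 1)) m
      rw [hk]
      refine ⟨k * C P ^ 2 * X ^ (p - 2), ?_⟩
      have : (X : PowerSeries κ) ^ (p - 1) * X ^ (p - 1) = X ^ p * X ^ (p - 2) := by
        rw [← pow_add, ← pow_add]; congr 1; omega
      linear_combination k * C P ^ 2 * this
    have e4 := dvd_add e2 (Dvd.dvd.mul_left e3 (Y * 4 ^ m))
    convert e4 using 1
    rw [mul_pow]; ring
  have hc := (X_pow_dvd_iff.1 hd2) (p - 1) (by omega)
  rw [map_sub, coeff_pow_charP_eq_zero, zero_sub, neg_eq_zero] at hc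
  have h4 : (4 : PowerSeries κ) = C 4 := (map_ofNat C 4).symm
  have h2u : IsUnit (2 : κ) := by
    have := isUnit_natCast_of_not_dvd (κ := κ) p 2 (fun h => by
      have := Nat.le_of_dvd (by norm_num) h; omega)
    exact_mod_cast this
  have h4u : IsUnit ((4 : κ) ^ m) := by
    have : (4 : κ) = 2 ^ 2 := by norm_num
    rw [this]; exact (h2u.pow 2).pow m
  rw [mul_left_comm, h4, ← map_pow, coeff_C_mul, h4u.mul_right_eq_zero] at hc
  rw [mul_add, map_add] at hc
  have hsecond : coeff (p - 1) (Y * ((m : PowerSeries κ) * F ^ (m - 1) * (C P * X ^ (p - 1)))) = P := by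
    rw [show Y * ((m : PowerSeries κ) * F ^ (m - 1) * (C P * X ^ (p - 1))) =
      C P * ((Y * ((m : PowerSeries κ) * F ^ (m - 1))) * X ^ (p - 1)) by ring, coeff_C_mul]
    have := coeff_mul_X_pow (Y * ((m : PowerSeries κ) * F ^ (m - 1))) (p - 1) 0
    rw [zero_add] at this
    rw [this]
    have hF0 : constantCoeff F = 1 := by
      have : constantCoeff x = 1 := by rw [← coeff_zero_eq_constantCoeff_apply, hx]
      simp [hF, this]
    have hY0' : constantCoeff Y = -2 := by rw [← coeff_zero_eq_constantCoeff_apply, hY0]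
    rw [coeff_zero_eq_constantCoeff_apply, map_mul, map_mul, map_pow, hF0, hY0', map_natCast]
    linear_combination (-P) * h2m
  have hfirst : coeff (p - 1) (Y * F ^ m) = -2 * hasseCoeff p a b := by
    have hFs := homogenize_pow_eq_sum a b x (X ^ 2) (pow_ne_zero 2 X_ne_zero) m
    rw [← pow_mul, ← pow_mul] at hFs
    obtain ⟨h, hh⟩ : ∃ h : ℕ → κ, ∀ i, h i = ((Polynomial.X ^ 3 + Polynomial.C a * Polynomial.X +
        Polynomial.C b) ^ m).coeff i := ⟨_, fun _ => rfl⟩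
    simp_rw [← hh] at hFs
    rw [hasseCoeff, ← hm, ← hh]
    rw [hF, hFs, Finset.mul_sum, map_sum, Finset.sum_eq_single (p - 1)]
    · rw [show Y * (C (h (p - 1)) * x ^ (p - 1) * (X ^ 2) ^ (3 * m - (p - 1))) =
          C (h (p - 1)) * ((Y * x ^ (p - 1)) * X ^ (p - 1)) by
          rw [← pow_mul, show 2 * (3 * m - (p - 1)) = p - 1 by omega]; ring, coeff_C_mul]
      have := coeff_mul_X_pow (Y * x ^ (p - 1)) (p - 1) 0
      rw [zero_add] at this
      have hx' : constantCoeff x = 1 := by rw [← coeff_zero_eq_constantCoeff_apply, hx]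
      have hY0' : constantCoeff Y = -2 := by rw [← coeff_zero_eq_constantCoeff_apply, hY0]
      rw [this, coeff_zero_eq_constantCoeff_apply, map_mul, map_pow, hx', hY0']
      ring
    · intro i hi hne
      have hi := Finset.mem_range.1 hi
      rw [show Y * (C (h i) * x ^ i * (X ^ 2) ^ (3 * m - i)) =
          C (h i) * ((Y * x ^ i) * X ^ (2 * (3 * m - i))) by
          rw [← pow_mul]; ring, coeff_C_mul, coeff_mul_X_pow']
      split_ifs with hle
      · have hi1 : IsUnit ((i + 1 : ℕ) : κ) := by
          apply isUnit_natCast_of_not_dvd p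
          rintro ⟨k, hk⟩
          rcases Nat.lt_or_ge k 2 with h | h
          · interval_cases k <;> omega
          · have : p * 2 ≤ p * k := Nat.mul_le_mul_left _ h
            omega
        have e : ((i + 1 : ℕ) : PowerSeries κ) * (Y * x ^ i) =
            X * PowerSeries.derivative κ (x ^ (i + 1)) - ((2 * (i + 1) : ℕ) : PowerSeries κ) *
              x ^ (i + 1) := by
          rw [(PowerSeries.derivative κ).leibniz_pow, hY, thetaSubTwo]
          change _ = X * ((i + 1) • x ^ (i + 1 - 1) • PowerSeries.derivative κ x) - _
          rw [nsmul_eq_mul, smul_eq_mul, Nat.add_sub_cancel]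
          push_cast
          ring
        have e' := congrArg (coeff (p - 1 - 2 * (3 * m - i))) e
        have hcast : ∀ (n k : ℕ) (y : PowerSeries κ),
            coeff k ((n : PowerSeries κ) * y) = (n : κ) * coeff k y := by
          intro n k y
          rw [← map_natCast (C : κ →+* PowerSeries κ), coeff_C_mul]
        rw [map_sub, hcast, hcast] at e'
        have hX : coeff (p - 1 - 2 * (3 * m - i)) (X * PowerSeries.derivative κ (x ^ (i + 1))) =
            ((p - 1 - 2 * (3 * m - i) : ℕ) : κ) *
              coeff (p - 1 - 2 * (3 * m - i)) (x ^ (i + 1)) := by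
          obtain ⟨n, hn⟩ : ∃ n, p - 1 - 2 * (3 * m - i) = n + 1 := ⟨p - 2 - 2 * (3 * m - i), by omega⟩
          rw [hn, mul_comm X, coeff_succ_mul_X, coeff_derivative]
          push_cast; ring
        rw [hX, ← sub_mul] at e'
        have hz : ((p - 1 - 2 * (3 * m - i) : ℕ) : κ) - ((2 * (i + 1) : ℕ) : κ) = 0 := by
          have : (((p - 1 - 2 * (3 * m - i)) + 2 * p : ℕ) : κ) = ((2 * (i + 1) : ℕ) : κ) := by
            congr 1; omega
          rw [← this]; push_cast; simp
        rw [hz, zero_mul, hi1.mul_right_eq_zero] at e'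
        rw [e', mul_zero]
      · rw [mul_zero]
    · intro hr
      simp only [Finset.mem_range, not_lt] at hr
      omega
  rw [hfirst, hsecond] at hc
  linear_combination -hc

end Hasse
end

noncomputable section

open PowerSeries Filter Topology

/-- The power series `f` converges at `y` with value `v`. -/
def EvalAt (y v : ℂ) (f : ℂ⟦X⟧) : Prop := HasSum (fun n => coeff n f * y ^ n) v

namespace EvalAt

variable {y v w : ℂ} {f g : ℂ⟦X⟧}

theorem add (hf : EvalAt y v f) (hg : EvalAt y w g) : EvalAt y (v + w) (f + g) := by
  have := HasSum.add hf hg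
  simpa [EvalAt, add_mul] using this

theorem neg (hf : EvalAt y v f) : EvalAt y (-v) (-f) := by
  have := HasSum.neg hf
  simpa [EvalAt] using this

theorem sub (hf : EvalAt y v f) (hg : EvalAt y w g) : EvalAt y (v - w) (f - g) := by
  simpa [sub_eq_add_neg] using hf.add hg.neg

theorem mul (hf : EvalAt y v f) (hg : EvalAt y w g) : EvalAt y (v * w) (f * g) := by
  have h1 := (HasSum.summable hf).norm
  have h2 := (HasSum.summable hg).norm
  have h3 := tsum_mul_tsum_eq_tsum_sum_antidiagonal_of_summable_norm h1 h2
  have h4 := (summable_norm_sum_mul_antidiagonal_of_summable_norm h1 h2).of_norm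
  rw [HasSum.tsum_eq hf, HasSum.tsum_eq hg] at h3
  rw [h3]
  refine h4.hasSum.congr_fun ?_
  intro n
  rw [coeff_mul, Finset.sum_mul]
  refine Finset.sum_congr rfl fun x hx => ?_
  rw [← Finset.HasAntidiagonal.mem_antidiagonal.1 hx, pow_add]
  ring

theorem C (y c : ℂ) : EvalAt y c (PowerSeries.C c) := by
  have := hasSum_ite_eq 0 c
  refine this.congr_fun ?_
  intro n
  rcases eq_or_ne n 0 with rfl | h <;> simp [coeff_C, *]

theorem one (y : ℂ) : EvalAt y 1 1 := by simpa using EvalAt.C y 1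

theorem zero (y : ℂ) : EvalAt y 0 0 := by simpa using EvalAt.C y 0

theorem X (y : ℂ) : EvalAt y y X := by
  have := hasSum_ite_eq 1 y
  refine this.congr_fun ?_
  intro n
  rcases eq_or_ne n 1 with rfl | h <;> simp [coeff_X, *]

theorem pow (hf : EvalAt y v f) (n : ℕ) : EvalAt y (v ^ n) (f ^ n) := by
  induction n with
  | zero => simpa using one y
  | succ n ih => simpa [pow_succ] using ih.mul hf

theorem sum {ι : Type*} (s : Finset ι) {V : ι → ℂ} {F : ι → ℂ⟦X⟧}
    (h : ∀ i ∈ s, EvalAt y (V i) (F i)) : EvalAt y (∑ i ∈ s, V i) (∑ i ∈ s, F i) := by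
  classical
  induction s using Finset.induction_on with
  | empty => simpa using zero y
  | insert i s hi ih =>
    rw [Finset.sum_insert hi, Finset.sum_insert hi]
    exact (h i (by simp)).add (ih fun j hj => h j (by simp [hj]))

theorem prod {ι : Type*} (s : Finset ι) {V : ι → ℂ} {F : ι → ℂ⟦X⟧}
    (h : ∀ i ∈ s, EvalAt y (V i) (F i)) : EvalAt y (∏ i ∈ s, V i) (∏ i ∈ s, F i) := by
  classical
  induction s using Finset.induction_on with
  | empty => simpa using one y
  | insert i s hi ih =>
    rw [Finset.prod_insert hi, Finset.prod_insert hi]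
    exact (h i (by simp)).mul (ih fun j hj => h j (by simp [hj]))

theorem unique (hf : EvalAt y v f) (hf' : EvalAt y w f) : v = w := HasSum.unique hf hf'

theorem rescale {c : ℂ} (hf : EvalAt (c * y) v f) : EvalAt y v (PowerSeries.rescale c f) := by
  refine HasSum.congr_fun hf ?_
  intro n
  rw [coeff_rescale, mul_pow]
  ring

theorem expand {d : ℕ} (hd : d ≠ 0) (hf : EvalAt (y ^ d) v f) :
    EvalAt y v (PowerSeries.expand d hd f) := by
  have h : Function.Injective (fun n : ℕ => d * n) := fun a b h => by simpa [hd] using h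
  unfold EvalAt
  rw [← h.hasSum_iff]
  · refine HasSum.congr_fun hf ?_
    intro n
    simp [coeff_expand_mul, pow_mul]
  · intro n hn
    rw [coeff_expand_of_not_dvd, zero_mul]
    rintro ⟨m, rfl⟩
    exact hn ⟨m, rfl⟩

end EvalAt

theorem eq_zero_of_frequently_evalAt {f : ℂ⟦X⟧}
    (h : ∃ᶠ y in 𝓝[≠] (0 : ℂ), EvalAt y 0 f) : f = 0 := by
  obtain ⟨y0, hy0, hy0'⟩ : ∃ y, EvalAt y 0 f ∧ y ≠ 0 :=
    (h.and_eventually self_mem_nhdsWithin).exists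
  set P : FormalMultilinearSeries ℂ ℂ ℂ := FormalMultilinearSeries.ofScalars ℂ (fun n => coeff n f)
  have hr : 0 < P.radius := by
    refine lt_of_lt_of_le ?_ (P.le_radius_of_tendsto (r := ‖y0‖₊) (l := 0) ?_)
    · simpa using hy0'
    · have := (HasSum.summable hy0).norm.tendsto_atTop_zero
      simpa [P, FormalMultilinearSeries.ofScalars_norm] using this
  have hP := P.hasFPowerSeriesOnBall hr
  have han : AnalyticAt ℂ P.sum 0 := hP.analyticAt
  have hev : ∀ y, EvalAt y 0 f → P.sum y = 0 := by
    intro y hy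
    rw [FormalMultilinearSeries.sum, ← HasSum.tsum_eq hy]
    refine tsum_congr fun n => ?_
    simp [P, mul_comm]
  have h0 := han.frequently_zero_iff_eventually_zero.1 (h.mono hev)
  have hz : P = 0 := (hP.hasFPowerSeriesAt.congr h0).eq_zero
  ext n
  have := congrArg (fun Q => Q.coeff n) hz
  rw [FormalMultilinearSeries.coeff_ofScalars] at this
  rw [this]
  simp [FormalMultilinearSeries.coeff]

theorem eq_of_frequently_evalAt {f g : ℂ⟦X⟧}
    (h : ∃ᶠ y in 𝓝[≠] (0 : ℂ), ∃ v, EvalAt y v f ∧ EvalAt y v g) : f = g := by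
  rw [← sub_eq_zero]
  refine eq_zero_of_frequently_evalAt (h.mono ?_)
  rintro y ⟨v, h1, h2⟩
  simpa using h1.sub h2

end

noncomputable section

open PowerSeries Filter Topology

theorem HasFPowerSeriesAt.eventually_evalAt {F : ℂ → ℂ} {c : ℕ → ℂ}
    (h : HasFPowerSeriesAt F (FormalMultilinearSeries.ofScalars ℂ c) 0) :
    ∀ᶠ z in 𝓝[≠] (0 : ℂ), EvalAt z (F z) (PowerSeries.mk c) := by
  have := (hasFPowerSeriesAt_iff.1 h)
  refine (this.filter_mono nhdsWithin_le_nhds).mono fun z hz => ?_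
  simpa [EvalAt, FormalMultilinearSeries.coeff_ofScalars, mul_comm] using hz

namespace PeriodPair

open scoped PeriodPair

variable (L : PeriodPair)

/-- Taylor series at `0` of the function `z ↦ z² ℘(z)`. -/
def laurentSeries : ℂ⟦X⟧ :=
  PowerSeries.mk fun n => if n = 0 then 1 else if n < 3 then 0 else ((n : ℂ) - 1) * L.G n

theorem eventually_notMem : ∀ᶠ z in 𝓝[≠] (0 : ℂ), z ∉ L.lattice := by
  have h := L.compl_lattice_sdiff_singleton_mem_nhds 0
  filter_upwards [nhdsWithin_le_nhds h, self_mem_nhdsWithin] with z h1 h2 h3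
  exact h1 ⟨h3, h2⟩

theorem eventually_evalAt_weierstrassP :
    ∀ᶠ z in 𝓝[≠] (0 : ℂ), EvalAt z (z ^ 2 * L.weierstrassP z) L.laurentSeries := by
  filter_upwards [(L.hasFPowerSeriesAt_weierstrassPExcept 0).eventually_evalAt,
    self_mem_nhdsWithin] with z h hz
  have hz : z ≠ 0 := hz
  have h0 : L.weierstrassPExcept 0 z = L.weierstrassP z - 1 / z ^ 2 := by
    simpa [sub_eq_add_neg] using L.weierstrassPExcept_def 0 z
  have h1 := (EvalAt.one z).add (((EvalAt.X z).pow 2).mul h)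
  rw [h0] at h1
  convert h1 using 1
  · field_simp
    ring
  · ext n
    rw [laurentSeries, coeff_mk, map_add, coeff_X_pow_mul', coeff_one]
    rcases n with _ | _ | _ | n
    · simp
    · simp
    · simp
    · simp

theorem eventually_evalAt_derivWeierstrassP :
    ∀ᶠ z in 𝓝[≠] (0 : ℂ), EvalAt z (z ^ 3 * L.derivWeierstrassP z)
      (thetaSubTwo L.laurentSeries) := by
  filter_upwards [(L.hasFPowerSeriesAt_derivWeierstrassPExcept 0).eventually_evalAt,
    self_mem_nhdsWithin] with z h hz
  have hz : z ≠ 0 := hz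
  have h0 : L.derivWeierstrassPExcept 0 z = L.derivWeierstrassP z + 2 / z ^ 3 := by
    simpa using L.derivWeierstrassPExcept_def 0 z
  have h1 := (((EvalAt.X z).pow 3).mul h).sub (EvalAt.C z 2)
  rw [h0] at h1
  convert h1 using 1
  · field_simp
    ring
  · ext n
    rw [coeff_thetaSubTwo, laurentSeries, coeff_mk, map_sub, coeff_X_pow_mul', coeff_C]
    rcases n with _ | _ | _ | n
    · simp
    · simp
    · simp
    · rw [if_neg (by omega), if_neg (by omega)]
      simp
      ring

/-- The Weierstrass differential equation as an identity of formal power series. -/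
theorem thetaSubTwo_laurentSeries_sq :
    thetaSubTwo L.laurentSeries ^ 2 = 4 * L.laurentSeries ^ 3
      - PowerSeries.C L.g₂ * X ^ 4 * L.laurentSeries - PowerSeries.C L.g₃ * X ^ 6 := by
  refine eq_of_frequently_evalAt (Eventually.frequently ?_)
  filter_upwards [L.eventually_evalAt_weierstrassP, L.eventually_evalAt_derivWeierstrassP,
    L.eventually_notMem] with z h1 h2 h3
  refine ⟨_, h2.pow 2, ?_⟩
  have h4 := (((EvalAt.C z 4).mul (h1.pow 3)).sub
    (((EvalAt.C z L.g₂).mul ((EvalAt.X z).pow 4)).mul h1)).sub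
    ((EvalAt.C z L.g₃).mul ((EvalAt.X z).pow 6))
  rw [show (PowerSeries.C (4 : ℂ)) = 4 from map_ofNat _ 4] at h4
  convert h4 using 1
  rw [mul_pow, L.derivWeierstrassP_sq z h3]
  ring

end PeriodPair

end

noncomputable section

open PowerSeries Filter Topology

theorem thetaSubTwo_ode_unique {x y : ℂ⟦X⟧} {u v : ℂ} (hx0 : coeff 0 x = 1) (hy0 : coeff 0 y = 1)
    (hx : thetaSubTwo x ^ 2 = 4 * x ^ 3 - PowerSeries.C u * X ^ 4 * x - PowerSeries.C v * X ^ 6)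
    (hy : thetaSubTwo y ^ 2 = 4 * y ^ 3 - PowerSeries.C u * X ^ 4 * y - PowerSeries.C v * X ^ 6) :
    x = y := by
  have hsub : thetaSubTwo x - thetaSubTwo y = thetaSubTwo (x - y) := by
    ext n
    rw [map_sub, coeff_thetaSubTwo, coeff_thetaSubTwo, coeff_thetaSubTwo, map_sub]
    ring
  have key : thetaSubTwo (x - y) * (thetaSubTwo x + thetaSubTwo y) =
      (x - y) * (4 * (x ^ 2 + x * y + y ^ 2) - PowerSeries.C u * X ^ 4) := by
    rw [← hsub]
    linear_combination hx - hy
  rw [← sub_eq_zero]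
  ext n
  induction n using Nat.strong_induction_on with
  | _ n ih =>
    obtain ⟨e, he⟩ : X ^ n ∣ x - y := X_pow_dvd_iff.2 fun m hm => by simpa using ih m hm
    have he' : X ^ n ∣ thetaSubTwo (x - y) := X_pow_dvd_iff.2 fun m hm => by
      rw [coeff_thetaSubTwo, ih m hm]
      simp
    obtain ⟨e', he'⟩ := he'
    have h0 : coeff n (x - y) = coeff 0 e := by
      rw [he, coeff_X_pow_mul', if_pos le_rfl, Nat.sub_self]
    have h0' : ((n : ℂ) - 2) * coeff n (x - y) = coeff 0 e' := by
      rw [← coeff_thetaSubTwo, he', coeff_X_pow_mul', if_pos le_rfl, Nat.sub_self]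
    have h1 := congrArg (coeff n) key
    rw [he', he, mul_assoc, mul_assoc, coeff_X_pow_mul', coeff_X_pow_mul', if_pos le_rfl,
      if_pos le_rfl, Nat.sub_self] at h1
    simp only [coeff_zero_eq_constantCoeff, map_mul, map_add, map_sub, map_pow] at h1
    simp only [← coeff_zero_eq_constantCoeff_apply] at h1
    rw [coeff_thetaSubTwo, coeff_thetaSubTwo, hx0, hy0, ← h0, ← h0'] at h1
    simp at h1
    have h4 : constantCoeff (4 : ℂ⟦X⟧) = 4 := map_ofNat _ 4
    rw [h4] at h1
    have h2 : ((n : ℂ) + 1) * (coeff n x - coeff n y) = 0 := by linear_combination -h1 / 4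
    have h3 : (n : ℂ) + 1 ≠ 0 := by exact_mod_cast Nat.succ_ne_zero n
    simpa [h3] using h2

namespace PeriodPair

variable (L M : PeriodPair)

theorem laurentSeries_eq (h2 : L.g₂ = M.g₂) (h3 : L.g₃ = M.g₃) :
    L.laurentSeries = M.laurentSeries := by
  refine thetaSubTwo_ode_unique (u := L.g₂) (v := L.g₃) ?_ ?_ L.thetaSubTwo_laurentSeries_sq ?_
  · simp [laurentSeries]
  · simp [laurentSeries]
  · rw [h2, h3]
    exact M.thetaSubTwo_laurentSeries_sq

theorem countable_lattice : (L.lattice : Set ℂ).Countable := by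
  have : Countable L.lattice := L.latticeEquivProd.toEquiv.countable_iff.2 inferInstance
  exact Set.countable_coe_iff.1 this

theorem lattice_le_of_g_eq (h2 : L.g₂ = M.g₂) (h3 : L.g₃ = M.g₃) : L.lattice ≤ M.lattice := by
  set U : Set ℂ := ((L.lattice : Set ℂ) ∪ M.lattice)ᶜ with hU
  have hc : IsPreconnected U :=
    ((L.countable_lattice.union M.countable_lattice).isConnected_compl_of_one_lt_rank
      (by simp)).isPreconnected
  have hloc : ∀ᶠ z in 𝓝[≠] (0 : ℂ), z ∈ U ∧ L.weierstrassP z = M.weierstrassP z := by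
    filter_upwards [L.eventually_evalAt_weierstrassP, M.eventually_evalAt_weierstrassP,
      L.eventually_notMem, M.eventually_notMem, self_mem_nhdsWithin] with z hL hM hL' hM' hz
    refine ⟨by simp [hU, hL', hM'], ?_⟩
    rw [laurentSeries_eq L M h2 h3] at hL
    exact mul_left_cancel₀ (pow_ne_zero 2 hz) (hL.unique hM)
  have hopen : IsOpen U := (L.isClosed_lattice.union M.isClosed_lattice).isOpen_compl
  obtain ⟨z0, hz0U, hz0⟩ : ∃ z0 ∈ U, L.weierstrassP =ᶠ[𝓝 z0] M.weierstrassP := by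
    obtain ⟨s, hs, hso, hs'⟩ := eventually_nhds_iff.1 (eventually_nhdsWithin_iff.1 hloc)
    have hne : ∀ᶠ z in 𝓝[≠] (0 : ℂ), z ∈ s ∧ z ≠ 0 :=
      (eventually_nhdsWithin_of_eventually_nhds (hso.mem_nhds hs')).and self_mem_nhdsWithin
    obtain ⟨z, hz, hz0⟩ := hne.exists
    refine ⟨z, (hs z hz hz0).1, ?_⟩
    filter_upwards [hso.mem_nhds hz, isOpen_ne.mem_nhds hz0] with w hw hw0
    exact (hs w hw hw0).2
  have heq : Set.EqOn L.weierstrassP M.weierstrassP U :=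
    (L.analyticOnNhd_weierstrassP.mono (by simp [hU])).eqOn_of_preconnected_of_eventuallyEq
      (M.analyticOnNhd_weierstrassP.mono (by simp [hU])) hc hz0U hz0
  intro l hl
  by_contra hl'
  have h1 := L.order_weierstrassP l hl
  have h2 : AnalyticAt ℂ M.weierstrassP l := M.analyticOnNhd_weierstrassP l hl'
  have h3 : L.weierstrassP =ᶠ[𝓝[≠] l] M.weierstrassP := by
    have hL := L.compl_lattice_sdiff_singleton_mem_nhds l
    filter_upwards [nhdsWithin_le_nhds hL, self_mem_nhdsWithin,
      nhdsWithin_le_nhds (M.isClosed_lattice.isOpen_compl.mem_nhds hl')] with z ha hb hc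
    refine heq ?_
    rintro (h | h)
    · exact ha ⟨h, hb⟩
    · exact hc h
  rw [meromorphicOrderAt_congr h3] at h1
  have := h2.meromorphicOrderAt_nonneg
  rw [h1] at this
  exact absurd this (by decide)

theorem lattice_eq_of_g_eq (h2 : L.g₂ = M.g₂) (h3 : L.g₃ = M.g₃) : L.lattice = M.lattice :=
  le_antisymm (lattice_le_of_g_eq L M h2 h3) (lattice_le_of_g_eq M L h2.symm h3.symm)

end PeriodPair

end

noncomputable section

open PowerSeries Filter Topology UpperHalfPlane ModularForm

open scoped Real Nat

theorem eq_of_forall_evalAt_qParam {h : ℝ} (hh : 0 < h) {v : ℍ → ℂ} {f g : ℂ⟦X⟧}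
    (hf : ∀ τ : ℍ, EvalAt (Function.Periodic.qParam h τ) (v τ) f)
    (hg : ∀ τ : ℍ, EvalAt (Function.Periodic.qParam h τ) (v τ) g) : f = g := by
  refine eq_of_frequently_evalAt (Eventually.frequently ?_)
  have h1 : ∀ᶠ y in 𝓝[≠] (0 : ℂ), ‖y‖ < 1 := by
    refine nhdsWithin_le_nhds ?_
    filter_upwards [Metric.ball_mem_nhds (0 : ℂ) one_pos] with y hy
    simpa using hy
  filter_upwards [h1, self_mem_nhdsWithin] with y hy hy0
  have hy0 : y ≠ 0 := hy0
  have him : 0 < (Function.Periodic.invQParam h y).im :=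
    Function.Periodic.im_invQParam_pos_of_norm_lt_one hh hy hy0
  have := Function.Periodic.qParam_right_inv hh.ne' hy0
  exact ⟨v ⟨_, him⟩, by simpa [this] using hf ⟨_, him⟩, by simpa [this] using hg ⟨_, him⟩⟩

/-- The lattice `2πi (ℤ τ + ℤ)`. -/
def periodPair (τ : ℍ) : PeriodPair where
  ω₁ := 2 * π * Complex.I * τ
  ω₂ := 2 * π * Complex.I
  indep := by
    rw [LinearIndependent.pair_iff]
    intro s t h
    have h2 : (2 * π * Complex.I : ℂ) ≠ 0 := Complex.two_pi_I_ne_zero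
    have h3 : (s : ℂ) * τ + t = 0 := by
      refine mul_left_cancel₀ h2 ?_
      simp only [Complex.real_smul] at h
      linear_combination h
    have h4 := congrArg Complex.im h3
    have h5 : s = 0 := by simpa [τ.im_ne_zero] using h4
    subst h5
    simpa using h3

theorem periodPair_G (τ : ℍ) {n : ℕ} (hn : 3 ≤ n) (he : Even n) :
    (periodPair τ).G n = -(bernoulli n / n ! : ℂ) * E hn τ := by
  have h2 : (2 * π * Complex.I : ℂ) ≠ 0 := Complex.two_pi_I_ne_zero
  have h1 : (periodPair τ).G n = (2 * π * Complex.I : ℂ)⁻¹ ^ n *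
      ∑' v : Fin 2 → ℤ, EisensteinSeries.eisSummand n v τ := by
    rw [PeriodPair.G, ← (periodPair τ).latticeEquivProd.symm.toEquiv.tsum_eq,
      ← (finTwoArrowEquiv ℤ).tsum_eq, ← tsum_mul_left]
    refine tsum_congr fun v => ?_
    have e := (periodPair τ).latticeEquiv_symm_apply (v 0, v 1)
    change (((periodPair τ).latticeEquivProd.symm (v 0, v 1)).1 ^ n)⁻¹ = _
    rw [e, EisensteinSeries.eisSummand, zpow_neg, zpow_natCast, ← inv_pow, ← inv_pow, ← mul_pow,
      ← mul_inv]
    congr 2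
    simp only [periodPair]
    ring
  have h3 : E hn τ = (1 / 2 : ℂ) * eisensteinSeries (N := 1) 0 n τ := rfl
  rw [h1, tsum_eisSummand_eq_riemannZeta_mul_eisensteinSeries hn, h3]
  obtain ⟨m, rfl⟩ := he
  have hm : m ≠ 0 := by omega
  have hz := riemannZeta_two_mul_nat hm
  have e1 : ((m + m : ℕ) : ℂ) = 2 * m := by push_cast; ring
  rw [e1, hz, ← two_mul]
  have hpi : (π : ℂ) ≠ 0 := by exact_mod_cast Real.pi_ne_zero
  have hf : ((2 * m)! : ℂ) ≠ 0 := by exact_mod_cast Nat.factorial_ne_zero _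
  rw [inv_pow, mul_pow, mul_pow, pow_mul Complex.I, Complex.I_sq]
  have e2 : (2 : ℂ) ^ (2 * m) = 2 ^ (2 * m - 1) * 2 := by
    rw [← pow_succ]
    congr 1
    omega
  rw [e2]
  have e3 : ((-1 : ℂ) ^ m) ≠ 0 := pow_ne_zero _ (by norm_num)
  field_simp
  ring

theorem evalAt_E {n : ℕ} (hn : 3 ≤ n) (τ : ℍ) :
    EvalAt (Function.Periodic.qParam 1 τ) (E hn τ) (qExpansion 1 (E hn)) := by
  have := ModularForm.hasSum_qExpansion (E hn) one_pos one_mem_strictPeriods_SL τ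
  simpa [EvalAt] using this

end

noncomputable section

open PowerSeries Filter Topology UpperHalfPlane ModularForm

open scoped Real Nat ArithmeticFunction.sigma

/-- The `q`-expansion of `E₄`, with coefficients in any ring. -/
def eisFour (R : Type*) [CommRing R] : R⟦X⟧ :=
  PowerSeries.mk fun m => if m = 0 then 1 else 240 * (σ 3 m : R)

/-- The `q`-expansion of `E₆`, with coefficients in any ring. -/
def eisSix (R : Type*) [CommRing R] : R⟦X⟧ :=
  PowerSeries.mk fun m => if m = 0 then 1 else -504 * (σ 5 m : R)

theorem map_eisFour {R S : Type*} [CommRing R] [CommRing S] (f : R →+* S) :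
    PowerSeries.map f (eisFour R) = eisFour S := by
  ext n
  rw [coeff_map, eisFour, eisFour, coeff_mk, coeff_mk]
  split_ifs
  · simp
  · rw [map_mul, map_natCast, map_ofNat]

theorem map_eisSix {R S : Type*} [CommRing R] [CommRing S] (f : R →+* S) :
    PowerSeries.map f (eisSix R) = eisSix S := by
  ext n
  rw [coeff_map, eisSix, eisSix, coeff_mk, coeff_mk]
  split_ifs
  · simp
  · rw [map_mul, map_natCast, map_neg, map_ofNat]

theorem bernoulli_four : bernoulli 4 = -1 / 30 := by
  rw [bernoulli_eq_bernoulli'_of_ne_one (by norm_num), bernoulli'_four]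

theorem bernoulli_six : bernoulli 6 = 1 / 42 := by
  have h := sum_bernoulli 7
  have h3 : bernoulli 3 = 0 := bernoulli_eq_zero_of_odd (by decide) (by norm_num)
  have h5 : bernoulli 5 = 0 := bernoulli_eq_zero_of_odd (by decide) (by norm_num)
  rw [Finset.sum_range_succ, Finset.sum_range_succ, Finset.sum_range_succ, Finset.sum_range_succ,
    Finset.sum_range_succ, Finset.sum_range_succ, Finset.sum_range_succ, h3, h5,
    bernoulli_four] at h
  have c2 : Nat.choose 7 2 = 21 := by decide
  have c4 : Nat.choose 7 4 = 35 := by decide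
  have c6 : Nat.choose 7 6 = 7 := by decide
  norm_num [c2, c4, c6] at h
  linarith

theorem evalAt_E₄ (τ : ℍ) : EvalAt (Function.Periodic.qParam 1 τ) (E₄ τ) (eisFour ℂ) := by
  have h := evalAt_E (by norm_num : 3 ≤ 4) τ
  convert h
  ext n
  rw [EisensteinSeries.E_qExpansion_coeff _ (by decide), eisFour, coeff_mk, bernoulli_four]
  congr 2
  norm_num

theorem evalAt_E₆ (τ : ℍ) : EvalAt (Function.Periodic.qParam 1 τ) (E₆ τ) (eisSix ℂ) := by
  have h := evalAt_E (by norm_num : 3 ≤ 6) τ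
  convert h
  ext n
  rw [EisensteinSeries.E_qExpansion_coeff _ (by decide), eisSix, coeff_mk, bernoulli_six]
  congr 2
  norm_num

theorem bernoulli_ne_zero_of_even {n : ℕ} (hn : n ≠ 0) (he : Even n) : bernoulli n ≠ 0 := by
  obtain ⟨m, rfl⟩ := he
  have hm : m ≠ 0 := by omega
  have hz := riemannZeta_two_mul_nat hm
  have : riemannZeta (2 * m) ≠ 0 := by
    refine riemannZeta_ne_zero_of_one_lt_re ?_
    norm_cast
    omega
  intro h0
  rw [← two_mul] at h0
  rw [hz, h0] at this
  simp at this

/-- The coefficient of `z ^ n * q ^ m` in `z² ℘(z)` for the lattice `2πi (ℤ τ + ℤ)`. -/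
def weierstrassCoeff (n m : ℕ) : ℚ :=
  if n = 0 then if m = 0 then 1 else 0
  else if n < 3 ∨ Odd n then 0
  else if m = 0 then (1 - n) * (bernoulli n / n !)
  else 2 / (n - 2)! * (σ (n - 1) m : ℚ)

theorem evalAt_laurentSeries (τ : ℍ) (n : ℕ) :
    EvalAt (Function.Periodic.qParam 1 τ) (coeff n (periodPair τ).laurentSeries)
      (PowerSeries.mk fun m => (weierstrassCoeff n m : ℂ)) := by
  rw [PeriodPair.laurentSeries, coeff_mk]
  rcases eq_or_ne n 0 with rfl | hn0
  · rw [if_pos rfl]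
    convert EvalAt.one _
    ext m
    rw [coeff_mk, coeff_one, weierstrassCoeff, if_pos rfl]
    split_ifs <;> simp
  rw [if_neg hn0]
  by_cases h3 : n < 3
  · rw [if_pos h3]
    convert EvalAt.zero _
    ext m
    simp [weierstrassCoeff, hn0, h3]
  rw [if_neg h3]
  rcases Nat.even_or_odd n with he | ho
  · rw [periodPair_G τ (not_lt.1 h3) he]
    convert ((EvalAt.C _ ((n - 1 : ℂ) * -(bernoulli n / n ! : ℂ))).mul
      (evalAt_E (not_lt.1 h3) τ)) using 1
    · ring
    · ext m
      rw [coeff_mk, coeff_C_mul, EisensteinSeries.E_qExpansion_coeff _ he, weierstrassCoeff,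
        if_neg hn0, if_neg (by simp [h3, he])]
      split_ifs
      · push_cast
        ring
      · push_cast
        have hb : (bernoulli n : ℂ) ≠ 0 := by exact_mod_cast bernoulli_ne_zero_of_even hn0 he
        have hf : (n ! : ℂ) = n * (n - 1) * (n - 2)! := by
          obtain ⟨k, rfl⟩ : ∃ k, n = k + 2 := ⟨n - 2, by omega⟩
          rw [Nat.factorial_succ, Nat.factorial_succ]
          push_cast
          ring_nf
        rw [hf]
        have h1 : (n : ℂ) ≠ 0 := by exact_mod_cast hn0
        have h2 : ((n - 2)! : ℂ) ≠ 0 := by exact_mod_cast Nat.factorial_ne_zero _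
        have h4 : (n : ℂ) - 1 ≠ 0 := by
          rw [sub_ne_zero]
          exact_mod_cast (by omega : n ≠ 1)
        field_simp
  · rw [PeriodPair.G_eq_zero_of_odd _ n ho, mul_zero]
    convert EvalAt.zero _
    ext m
    simp [weierstrassCoeff, hn0, ho]

theorem periodPair_g₂ (τ : ℍ) : (periodPair τ).g₂ = E₄ τ / 12 := by
  rw [PeriodPair.g₂, periodPair_G τ (by norm_num : 3 ≤ 4) (by decide), bernoulli_four]
  norm_num [Nat.factorial]
  ring

theorem periodPair_g₃ (τ : ℍ) : (periodPair τ).g₃ = -E₆ τ / 216 := by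
  rw [PeriodPair.g₃, periodPair_G τ (by norm_num : 3 ≤ 6) (by decide), bernoulli_six]
  norm_num [Nat.factorial]
  ring

/-- The coefficients of `x` are convergent at `y`, with values the coefficients of `v`. -/
def CoeffEvalAt (y : ℂ) (v : ℂ⟦X⟧) (x : ℂ⟦X⟧⟦X⟧) : Prop := ∀ n, EvalAt y (coeff n v) (coeff n x)

namespace CoeffEvalAt

variable {y : ℂ} {v w : ℂ⟦X⟧} {x z : ℂ⟦X⟧⟦X⟧}

theorem mul (hv : CoeffEvalAt y v x) (hw : CoeffEvalAt y w z) :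
    CoeffEvalAt y (v * w) (x * z) := by
  intro n
  rw [coeff_mul, coeff_mul]
  exact EvalAt.sum _ fun i _ => (hv i.1).mul (hw i.2)

theorem add (hv : CoeffEvalAt y v x) (hw : CoeffEvalAt y w z) :
    CoeffEvalAt y (v + w) (x + z) := by
  intro n
  rw [map_add, map_add]
  exact (hv n).add (hw n)

theorem C {c : ℂ} {f : ℂ⟦X⟧} (h : EvalAt y c f) :
    CoeffEvalAt y (PowerSeries.C c) (PowerSeries.C f) := by
  intro n
  rw [coeff_C, coeff_C]
  split_ifs
  · exact h
  · exact EvalAt.zero y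

theorem X_pow (k : ℕ) : CoeffEvalAt y (X ^ k) (X ^ k) := by
  intro n
  rw [coeff_X_pow, coeff_X_pow]
  split_ifs
  · exact EvalAt.one y
  · exact EvalAt.zero y

theorem pow (hv : CoeffEvalAt y v x) (k : ℕ) : CoeffEvalAt y (v ^ k) (x ^ k) := by
  induction k with
  | zero => simpa using X_pow (y := y) 0
  | succ k ih => simpa [pow_succ] using ih.mul hv

theorem thetaSubTwo (hv : CoeffEvalAt y v x) :
    CoeffEvalAt y (thetaSubTwo v) (thetaSubTwo x) := by
  intro n
  rw [coeff_thetaSubTwo, coeff_thetaSubTwo]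
  have h := (EvalAt.C y ((n : ℂ) - 2)).mul (hv n)
  rw [map_sub, map_natCast, show (PowerSeries.C (2 : ℂ)) = 2 from map_ofNat _ 2] at h
  exact h

end CoeffEvalAt

/-- The universal series `z² ℘(z)` over the ring of `q`-expansions. -/
def tateSeries : ℂ⟦X⟧⟦X⟧ :=
  PowerSeries.mk fun n => PowerSeries.mk fun m => (weierstrassCoeff n m : ℂ)

theorem thetaSubTwo_tateSeries_sq :
    thetaSubTwo tateSeries ^ 2 = 4 * (tateSeries ^ 3 +
      PowerSeries.C (PowerSeries.C (-1 / 48) * eisFour ℂ) * X ^ 4 * tateSeries +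
      PowerSeries.C (PowerSeries.C (1 / 864) * eisSix ℂ) * X ^ 6) := by
  have hx (τ : ℍ) : CoeffEvalAt (Function.Periodic.qParam 1 τ) (periodPair τ).laurentSeries
      tateSeries := fun n => by
    rw [tateSeries, coeff_mk]
    exact evalAt_laurentSeries τ n
  have h4 : (PowerSeries.C (4 : ℂ)) = 4 := map_ofNat _ 4
  have h4' : (PowerSeries.C (4 : ℂ⟦X⟧)) = 4 := map_ofNat _ 4
  ext1 n
  refine eq_of_forall_evalAt_qParam one_pos
    (v := fun τ => coeff n (thetaSubTwo (periodPair τ).laurentSeries ^ 2))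
    (fun τ => (hx τ).thetaSubTwo.pow 2 n) fun τ => ?_
  rw [(periodPair τ).thetaSubTwo_laurentSeries_sq, periodPair_g₂, periodPair_g₃]
  have h := ((CoeffEvalAt.C (EvalAt.C (Function.Periodic.qParam 1 τ) 4)).mul
    ((((hx τ).pow 3).add
    (((CoeffEvalAt.C ((EvalAt.C _ (-1 / 48)).mul (evalAt_E₄ τ))).mul
      (CoeffEvalAt.X_pow 4)).mul (hx τ))).add
    ((CoeffEvalAt.C ((EvalAt.C _ (1 / 864)).mul (evalAt_E₆ τ))).mul (CoeffEvalAt.X_pow 6)))) n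
  rw [h4, h4'] at h
  convert h using 2
  have e1 : PowerSeries.C (E₄ τ / 12) = -4 * PowerSeries.C (-1 / 48 * E₄ τ) := by
    rw [← h4, ← map_neg, ← map_mul]
    congr 1
    ring
  have e2 : PowerSeries.C (-E₆ τ / 216) = -4 * PowerSeries.C (1 / 864 * E₆ τ) := by
    rw [← h4, ← RingHom.map_neg, ← RingHom.map_mul]
    congr 1
    ring
  rw [e1, e2]
  ring

end

noncomputable section

open PowerSeries ModularForm

open scoped Nat ArithmeticFunction.sigma

/-- Some valuation ring of `ℂ` has residue characteristic `p`. -/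
theorem exists_valuationSubring_natCast_mem_nonunits (p : ℕ) (hp : p.Prime) :
    ∃ O : ValuationSubring ℂ, (p : ℂ) ∈ O.nonunits := by
  let A : Subring ℂ := (Int.castRingHom ℂ).range
  let P : A := ⟨(p : ℂ), p, by simp⟩
  have hI : Ideal.span {P} ≠ ⊤ := by
    rw [Ne, Ideal.span_singleton_eq_top, isUnit_iff_exists_inv]
    rintro ⟨⟨_, m, rfl⟩, hb⟩
    have h : ((p : ℤ) : ℂ) * (m : ℂ) = 1 := by simpa [P] using congrArg Subtype.val hb
    have h2 : (p : ℤ) * m = 1 := by exact_mod_cast h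
    have := Int.eq_one_or_neg_one_of_mul_eq_one h2
    have := hp.two_le
    omega
  obtain ⟨B, -, hB⟩ := Ideal.image_subset_nonunits_valuationSubring _ hI
  exact ⟨B, hB ⟨P, Ideal.mem_span_singleton_self P, rfl⟩⟩

variable {p : ℕ} {O : ValuationSubring ℂ}

theorem inv_natCast_mem (hO : (p : ℂ) ∈ O.nonunits) {n : ℕ} (hn : n.Coprime p) :
    (n : ℂ)⁻¹ ∈ O := by
  by_contra h
  rcases eq_or_ne n 0 with rfl | hn0
  · simp [O.zero_mem] at h
  have h1 : (n : ℂ) ∈ O.nonunits := O.mem_nonunits_iff_or.2 (Or.inr h)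
  have hb := congrArg (fun z : ℤ => (z : ℂ)) (Nat.gcd_eq_gcd_ab n p)
  simp only [hn.gcd_eq_one] at hb
  push_cast at hb
  rw [ValuationSubring.mem_nonunits_iff_exists_mem_maximalIdeal] at h1 hO
  obtain ⟨ha, ha'⟩ := h1
  obtain ⟨hc, hc'⟩ := hO
  have : (1 : O) ∈ IsLocalRing.maximalIdeal O := by
    have h2 := Ideal.add_mem _ (Ideal.mul_mem_right ((n.gcdA p : ℤ) : O) _ ha')
      (Ideal.mul_mem_right ((n.gcdB p : ℤ) : O) _ hc')
    convert h2
    ext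
    push_cast
    exact hb
  exact (Ideal.ne_top_iff_one _).1 (IsLocalRing.maximalIdeal.isMaximal O).ne_top this

theorem charP_residueField (hp : p.Prime) (hO : (p : ℂ) ∈ O.nonunits) :
    CharP (IsLocalRing.ResidueField O) p := by
  rw [CharP.charP_iff_prime_eq_zero hp]
  obtain ⟨h, h'⟩ := ValuationSubring.mem_nonunits_iff_exists_mem_maximalIdeal.1 hO
  rw [← map_natCast (IsLocalRing.residue O), IsLocalRing.residue_eq_zero_iff]
  exact h'

theorem bernoulli_mem (hp : p.Prime) (hO : (p : ℂ) ∈ O.nonunits) {n : ℕ} (hn : n < p - 1) :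
    ((bernoulli n : ℚ) : ℂ) ∈ O := by
  have hp2 := hp.two_le
  rcases Nat.even_or_odd' n with ⟨k, rfl | rfl⟩
  · obtain ⟨m, hm⟩ := Bernoulli.vonStaudt_clausen k
    have : ((bernoulli (2 * k) : ℚ) : ℂ) = m -
        ∑ q ∈ Finset.range (2 * k + 2) with q.Prime ∧ (q - 1) ∣ 2 * k, (q : ℂ)⁻¹ := by
      rw [eq_sub_iff_add_eq]
      have := congrArg (fun z : ℚ => (z : ℂ)) hm
      simp only [one_div] at this
      push_cast at this
      exact this.symm
    rw [this]
    refine sub_mem (intCast_mem O m) (sum_mem fun q hq => inv_natCast_mem hO ?_)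
    rw [Finset.mem_filter, Finset.mem_range] at hq
    exact (Nat.coprime_primes hq.2.1 hp).2 (by omega)
  · rcases eq_or_ne k 0 with rfl | hk
    · have h2 := inv_natCast_mem hO ((Nat.coprime_primes Nat.prime_two hp).2 (by omega))
      rw [mul_zero, zero_add, bernoulli_one]
      convert neg_mem h2 using 1
      norm_num [neg_div]
    · rw [bernoulli_eq_zero_of_odd ⟨k, rfl⟩ (by omega)]
      simp [O.zero_mem]

theorem exists_mul_bernoulli_eq (hp : p.Prime) (hp3 : 3 < p) (hO : (p : ℂ) ∈ O.nonunits) :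
    ∃ z ∈ O, (p : ℂ) * ((bernoulli (p - 1) : ℚ) : ℂ) = -1 + p * z := by
  obtain ⟨k, hk⟩ : Even (p - 1) := hp.even_sub_one (by omega)
  rw [← two_mul] at hk
  obtain ⟨m, hm⟩ := Bernoulli.vonStaudt_clausen k
  have hmem : p ∈ (Finset.range (2 * k + 2)).filter fun q => q.Prime ∧ (q - 1) ∣ 2 * k := by
    rw [Finset.mem_filter, Finset.mem_range]
    exact ⟨by omega, hp, by rw [hk]⟩
  rw [← Finset.add_sum_erase _ _ hmem, ← hk] at hm
  refine ⟨m - ∑ q ∈ ((Finset.range (2 * k + 2)).filter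
    fun q => q.Prime ∧ (q - 1) ∣ 2 * k).erase p, (q : ℂ)⁻¹, ?_, ?_⟩
  · refine sub_mem (intCast_mem O m) (sum_mem fun q hq => inv_natCast_mem hO ?_)
    rw [Finset.mem_erase, Finset.mem_filter, Finset.mem_range] at hq
    exact (Nat.coprime_primes hq.2.2.1 hp).2 hq.1
  · have := congrArg (fun z : ℚ => (z : ℂ)) hm
    simp only [one_div] at this
    push_cast at this
    rw [← hk] at *
    rw [this]
    have hp0 : (p : ℂ) ≠ 0 := Nat.cast_ne_zero.2 hp.ne_zero
    field_simp
    ring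

theorem inv_factorial_mem (hp : p.Prime) (hO : (p : ℂ) ∈ O.nonunits) {n : ℕ} (hn : n < p) :
    (n ! : ℂ)⁻¹ ∈ O :=
  inv_natCast_mem hO ((hp.coprime_factorial_of_lt hn).symm)

theorem weierstrassCoeff_mem (hp : p.Prime) (hO : (p : ℂ) ∈ O.nonunits) {n : ℕ} (hn : n < p - 1)
    (m : ℕ) : ((weierstrassCoeff n m : ℚ) : ℂ) ∈ O := by
  unfold weierstrassCoeff
  split_ifs
  · simp
  · simp
  · simp
  · push_cast
    rw [div_eq_mul_inv]
    exact mul_mem (sub_mem (one_mem _) (natCast_mem O n))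
      (mul_mem (bernoulli_mem hp hO hn) (inv_factorial_mem hp hO (by omega)))
  · push_cast
    rw [div_eq_mul_inv]
    exact mul_mem (mul_mem (ofNat_mem O 2) (inv_factorial_mem hp hO (by omega)))
      (natCast_mem O _)

theorem residue_mk_natCast_mul {p : ℕ} {O : ValuationSubring ℂ} (hp : p.Prime)
    (hO : (p : ℂ) ∈ O.nonunits) {z : ℂ} (hz : z ∈ O) (h : (p : ℂ) * z ∈ O) :
    IsLocalRing.residue O ⟨p * z, h⟩ = 0 := by
  have := charP_residueField hp hO
  have e : (⟨p * z, h⟩ : O) = (p : O) * ⟨z, hz⟩ := Subtype.ext (by simp)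
  rw [e, map_mul, map_natCast, CharP.cast_eq_zero, zero_mul]

theorem exists_residue_mul_weierstrassCoeff {p : ℕ} {O : ValuationSubring ℂ} (hp : p.Prime)
    (hp3 : 3 < p) (hO : (p : ℂ) ∈ O.nonunits) (m : ℕ) :
    ∃ h : (p : ℂ) * ((weierstrassCoeff (p - 1) m : ℚ) : ℂ) ∈ O,
      IsLocalRing.residue O ⟨_, h⟩ = if m = 0 then 2 else 0 := by
  have hch := charP_residueField hp hO
  have : Fact p.Prime := ⟨hp⟩
  have hw : weierstrassCoeff (p - 1) m = if m = 0 then (1 - (p - 1 : ℕ)) *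
      (bernoulli (p - 1) / (p - 1)!) else 2 / (p - 1 - 2)! * (σ (p - 1 - 1) m : ℚ) := by
    rw [weierstrassCoeff, if_neg (by omega), if_neg]
    rw [not_or, Nat.not_odd_iff_even]
    exact ⟨by omega, hp.even_sub_one (by omega)⟩
  rw [hw]
  split_ifs with h0
  · obtain ⟨z, hz, hb⟩ := exists_mul_bernoulli_eq hp hp3 hO
    have hi := inv_factorial_mem hp hO (Nat.sub_lt hp.pos one_pos)
    let u : O := (2 - p) * (-1 + p * ⟨z, hz⟩) * ⟨_, hi⟩
    have hu : (p : ℂ) * (((1 - (p - 1 : ℕ)) * (bernoulli (p - 1) / (p - 1)!) : ℚ) : ℂ) = u := by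
      simp only [u]
      push_cast [Nat.cast_sub hp.one_le]
      rw [← hb, show ((2 : O) : ℂ) = 2 from rfl]
      ring
    have hmem : (p : ℂ) * (((1 - (p - 1 : ℕ)) * (bernoulli (p - 1) / (p - 1)!) : ℚ) : ℂ) ∈ O := by
      rw [hu]
      exact u.2
    refine ⟨hmem, ?_⟩
    have e : (⟨_, hmem⟩ : O) = u := Subtype.ext hu
    have hf : IsLocalRing.residue O ⟨_, hi⟩ = -1 := by
      have h1 : ((p - 1)! : O) * ⟨_, hi⟩ = 1 := Subtype.ext (by
        push_cast
        exact mul_inv_cancel₀ (Nat.cast_ne_zero.2 (Nat.factorial_ne_zero _)))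
      have h2 := congrArg (IsLocalRing.residue O) h1
      have h3 := congrArg (ZMod.castHom dvd_rfl (IsLocalRing.ResidueField O)) (ZMod.wilsons_lemma p)
      rw [map_natCast, map_neg, map_one] at h3
      rw [map_mul, map_natCast, h3, map_one] at h2
      linear_combination -h2
    rw [e]
    simp only [u, map_mul, map_sub, map_add, map_neg, map_natCast, map_one, map_ofNat, hf,
      CharP.cast_eq_zero]
    ring
  · have hi := inv_factorial_mem hp hO (show p - 1 - 2 < p by omega)
    have hz : ((2 / (p - 1 - 2)! * (σ (p - 1 - 1) m : ℚ) : ℚ) : ℂ) ∈ O := by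
      push_cast
      rw [div_eq_mul_inv]
      exact mul_mem (mul_mem (ofNat_mem O 2) hi) (natCast_mem O _)
    have hmem := mul_mem (natCast_mem O p) hz
    exact ⟨hmem, residue_mk_natCast_mul hp hO hz hmem⟩

theorem charP_powerSeries (κ : Type*) [CommRing κ] (p : ℕ) [Nontrivial κ] [Fact p.Prime]
    [CharP κ p] : CharP κ⟦X⟧ p :=
  (CharP.charP_iff_prime_eq_zero Fact.out).2 (by
    rw [← map_natCast (PowerSeries.C (R := κ)), CharP.cast_eq_zero, map_zero])

/-- The differential equation of a series, transferred to its truncation at degree `p - 1`. -/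
theorem coeff_thetaSubTwo_sq_of_coeff_eq {R : Type*} [CommRing R] {p : ℕ} (hp : 1 < p)
    {a b : R} {x y : R⟦X⟧} (hx0 : coeff 0 x = 1)
    (hx : thetaSubTwo x ^ 2 = 4 * (x ^ 3 + C a * X ^ 4 * x + C b * X ^ 6))
    (hy : ∀ n < p - 1, coeff n y = coeff n x) (hyp : coeff (p - 1) y = 0) (n : ℕ) (hn : n < p) :
    coeff n (thetaSubTwo y ^ 2) = coeff n (4 * (y ^ 3 + C a * X ^ 4 * y + C b * X ^ 6 +
      C (p * coeff (p - 1) x) * X ^ (p - 1))) := by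
  set c := coeff (p - 1) x
  have h1 : X ^ p ∣ x - (y + C c * X ^ (p - 1)) := by
    rw [X_pow_dvd_iff]
    intro m hm
    rw [map_sub, map_add, coeff_C_mul_X_pow]
    rcases eq_or_ne m (p - 1) with rfl | h
    · simp [hyp, c]
    · simp [h, hy m (by omega)]
  obtain ⟨r, hr⟩ := h1
  have h2 : X ^ p ∣ thetaSubTwo x - (thetaSubTwo y + C ((p - 3) * c) * X ^ (p - 1)) := by
    rw [X_pow_dvd_iff]
    intro m hm
    rw [map_sub, map_add, coeff_C_mul_X_pow, coeff_thetaSubTwo, coeff_thetaSubTwo]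
    rcases eq_or_ne m (p - 1) with rfl | h
    · rw [hyp, if_pos rfl, Nat.cast_sub hp.le]
      push_cast
      ring
    · simp [h, hy m (by omega)]
  obtain ⟨s, hs⟩ := h2
  have h3 : X ∣ y - 1 := by
    rw [X_dvd_iff, map_sub, ← coeff_zero_eq_constantCoeff, hy 0 (by omega), hx0]
    simp
  obtain ⟨u, hu⟩ := h3
  have h4 : X ∣ thetaSubTwo y + 2 := by
    rw [X_dvd_iff, map_add, ← coeff_zero_eq_constantCoeff, coeff_thetaSubTwo, hy 0 (by omega), hx0,
      coeff_zero_eq_constantCoeff, map_ofNat]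
    simp
  obtain ⟨v, hv⟩ := h4
  obtain ⟨k, rfl⟩ : ∃ k, p = k + 2 := ⟨p - 2, by omega⟩
  rw [show k + 2 - 1 = k + 1 from rfl] at *
  suffices h : X ^ (k + 2) ∣ thetaSubTwo y ^ 2 - 4 * (y ^ 3 + C a * X ^ 4 * y + C b * X ^ 6 +
      C (((k + 2 : ℕ) : R) * c) * X ^ (k + 1)) by
    rw [← sub_eq_zero, ← map_sub]
    exact X_pow_dvd_iff.1 h n hn
  have ex : x = y + C c * X ^ (k + 1) + X ^ (k + 2) * r := by linear_combination hr
  have et : thetaSubTwo x = thetaSubTwo y + C (((k + 2 : ℕ) - 3) * c) * X ^ (k + 1) +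
      X ^ (k + 2) * s := by linear_combination hs
  have ey : y = 1 + X * u := by linear_combination hu
  have eθ : thetaSubTwo y = X * v - 2 := by linear_combination hv
  rw [et, ex] at hx
  rw [eθ] at hx ⊢
  rw [ey] at hx ⊢
  have e4 : (C (((k + 2 : ℕ) : R) * c) : R⟦X⟧) = C (((k + 2 : ℕ) - 3) * c) + 3 * C c := by
    rw [← map_ofNat C 3, ← map_mul, ← map_add]
    congr 1
    ring
  rw [e4]
  set A := (C a : R⟦X⟧)
  set B := (C b : R⟦X⟧)
  set D := (C c : R⟦X⟧)
  set F := (C (((k + 2 : ℕ) - 3) * c) : R⟦X⟧)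
  refine ⟨4 * s - 2 * v * (F + X * s) - X ^ k * (F + X * s) ^ 2 +
    12 * ((2 * u + X * u ^ 2) * (D + X * r) + r) + 12 * (1 + X * u) * X ^ k * (D + X * r) ^ 2 +
    4 * X ^ k * X ^ (k + 1) * (D + X * r) ^ 3 + 4 * A * X ^ 3 * (D + X * r), ?_⟩
  linear_combination hx

theorem map_thetaSubTwo {R S : Type*} [CommRing R] [CommRing S] (f : R →+* S) (x : R⟦X⟧) :
    PowerSeries.map f (thetaSubTwo x) = thetaSubTwo (PowerSeries.map f x) := by
  ext n
  rw [coeff_map, coeff_thetaSubTwo, coeff_thetaSubTwo, coeff_map, map_mul, map_sub, map_natCast,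
    map_ofNat]

/-- The Hasse invariant of the Tate curve is `1` in characteristic `p`. -/
theorem hasseCoeff_tate {p : ℕ} [Fact p.Prime] {O : ValuationSubring ℂ} (hp3 : 3 < p)
    (hO : (p : ℂ) ∈ O.nonunits) :
    hasseCoeff p (PowerSeries.C (-1 / 48) * eisFour (IsLocalRing.ResidueField O))
      (PowerSeries.C (1 / 864) * eisSix (IsLocalRing.ResidueField O)) = 1 := by
  have hp : p.Prime := Fact.out
  have := charP_residueField hp hO
  have := charP_powerSeries (IsLocalRing.ResidueField O) p
  have h48 : ((48 : ℕ) : ℂ)⁻¹ ∈ O := inv_natCast_mem hO (by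
    rw [show 48 = 2 ^ 4 * 3 by norm_num]
    exact Nat.Coprime.mul_left
      (Nat.Coprime.pow_left _ ((Nat.coprime_primes Nat.prime_two hp).2 (by omega)))
      ((Nat.coprime_primes Nat.prime_three hp).2 (by omega)))
  have h864 : ((864 : ℕ) : ℂ)⁻¹ ∈ O := inv_natCast_mem hO (by
    rw [show 864 = 2 ^ 5 * 3 ^ 3 by norm_num]
    exact Nat.Coprime.mul_left
      (Nat.Coprime.pow_left _ ((Nat.coprime_primes Nat.prime_two hp).2 (by omega)))
      (Nat.Coprime.pow_left _ ((Nat.coprime_primes Nat.prime_three hp).2 (by omega))))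
  let f : O →+* ℂ := O.subtype
  let ρ := IsLocalRing.residue O
  have hP (m : ℕ) := (exists_residue_mul_weierstrassCoeff hp hp3 hO m).choose
  have hP' (m : ℕ) : ρ ⟨_, hP m⟩ = _ :=
    (exists_residue_mul_weierstrassCoeff hp hp3 hO m).choose_spec
  let PS : O⟦X⟧ := PowerSeries.mk fun m => ⟨_, hP m⟩
  let a : O⟦X⟧ := PowerSeries.C (-⟨_, h48⟩) * eisFour O
  let b : O⟦X⟧ := PowerSeries.C ⟨_, h864⟩ * eisSix O
  let y : O⟦X⟧⟦X⟧ := PowerSeries.mk fun n => PowerSeries.mk fun m =>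
    if h : n < p - 1 then ⟨_, weierstrassCoeff_mem hp hO h m⟩ else 0
  have hPS : PowerSeries.map ρ PS = 2 := by
    ext m
    rw [coeff_map, coeff_mk, hP', ← map_ofNat PowerSeries.C 2, coeff_C]
  have ha : PowerSeries.map f a = PowerSeries.C (-1 / 48) * eisFour ℂ := by
    rw [map_mul, map_eisFour, map_C]
    congr 2
    change -((48 : ℕ) : ℂ)⁻¹ = _
    push_cast
    ring
  have hb : PowerSeries.map f b = PowerSeries.C (1 / 864) * eisSix ℂ := by
    rw [map_mul, map_eisSix, map_C]
    congr 2
    change ((864 : ℕ) : ℂ)⁻¹ = _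
    push_cast
    ring
  have h48' : ρ (-⟨_, h48⟩) = -1 / 48 := by
    have h : (48 : O) * ⟨_, h48⟩ = 1 := Subtype.ext (by
      change (48 : ℂ) * ((48 : ℕ) : ℂ)⁻¹ = 1
      norm_num)
    have h' := congrArg ρ h
    rw [map_mul, map_ofNat, map_one] at h'
    rw [map_neg, neg_div, one_div, eq_inv_of_mul_eq_one_right h']
  have h864' : ρ ⟨_, h864⟩ = 1 / 864 := by
    have h : (864 : O) * ⟨_, h864⟩ = 1 := Subtype.ext (by
      change (864 : ℂ) * ((864 : ℕ) : ℂ)⁻¹ = 1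
      norm_num)
    have h' := congrArg ρ h
    rw [map_mul, map_ofNat, map_one] at h'
    rw [one_div, eq_inv_of_mul_eq_one_right h']
  have hya (n : ℕ) (hn : n < p - 1) : PowerSeries.map f (coeff n y) = coeff n tateSeries := by
    ext m
    rw [coeff_map, coeff_mk, coeff_mk, dif_pos hn, tateSeries, coeff_mk, coeff_mk]
    rfl
  have hinj : Function.Injective (PowerSeries.map f) :=
    PowerSeries.map_injective f O.subtype_injective
  have hode (n : ℕ) (hn : n < p) : coeff n (thetaSubTwo y ^ 2) = coeff n (4 * (y ^ 3 +
      C a * X ^ 4 * y + C b * X ^ 6 + C PS * X ^ (p - 1))) := by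
    have h := coeff_thetaSubTwo_sq_of_coeff_eq (R := ℂ⟦X⟧) hp.one_lt
      (y := PowerSeries.map (PowerSeries.map f) y) (a := PowerSeries.map f a)
      (b := PowerSeries.map f b) (x := tateSeries) ?_ ?_ ?_ ?_ n hn
    · have e : (p : ℂ⟦X⟧) * coeff (p - 1) tateSeries = PowerSeries.map f PS := by
        ext m
        rw [coeff_map, coeff_mk, ← map_natCast (PowerSeries.C (R := ℂ)), coeff_C_mul, tateSeries,
          coeff_mk, coeff_mk]
        rfl
      rw [e] at h
      apply hinj
      rw [← coeff_map, ← coeff_map, map_pow, map_thetaSubTwo, h]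
      congr 1
      simp [map_ofNat (PowerSeries.map (PowerSeries.map f)) 4]
    · ext m
      rw [tateSeries, coeff_mk, coeff_mk, weierstrassCoeff, if_pos rfl, coeff_one]
      split_ifs <;> simp
    · rw [ha, hb, thetaSubTwo_tateSeries_sq]
    · intro n hn
      rw [coeff_map, hya n hn]
    · rw [coeff_map]
      ext m
      simp [y]
  have key : 2 * hasseCoeff p (PowerSeries.map ρ a) (PowerSeries.map ρ b) =
      PowerSeries.map ρ PS := by
    refine two_mul_hasseCoeff_of_ode p hp3 (PowerSeries.map ρ a) (PowerSeries.map ρ b)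
      (PowerSeries.map ρ PS) (PowerSeries.map (PowerSeries.map ρ) y) ?_ fun n hn => ?_
    · rw [coeff_map]
      have : coeff 0 y = 1 := hinj (by
        rw [hya 0 (by omega), map_one]
        ext m
        rw [tateSeries, coeff_mk, coeff_mk, weierstrassCoeff, if_pos rfl, coeff_one]
        split_ifs <;> simp)
      rw [this, map_one]
    · rw [← map_thetaSubTwo, ← map_pow, coeff_map, hode n hn, ← coeff_map]
      congr 1
      simp [map_ofNat (PowerSeries.map (PowerSeries.map ρ)) 4]
  rw [hPS, map_mul, map_mul, map_eisFour, map_eisSix, map_C, map_C, h48', h864'] at key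
  have h2 : (2 : (IsLocalRing.ResidueField O)⟦X⟧) ≠ 0 := by
    have := CharP.cast_eq_zero_iff (IsLocalRing.ResidueField O)⟦X⟧ p 2
    intro h
    have h2 := Nat.le_of_dvd two_pos (this.1 (by exact_mod_cast h))
    omega
  exact mul_left_cancel₀ h2 (key.trans (mul_one 2).symm)

end

noncomputable section

open PowerSeries Filter Topology UpperHalfPlane ModularForm MatrixGroups

open scoped Real Manifold ArithmeticFunction.sigma

section Invariance

theorem slash_eqn_SL {F : Type*} [FunLike F ℍ ℂ] {k : ℤ} [SlashInvariantFormClass F 𝒮ℒ k] (f : F)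
    (γ : SL(2, ℤ)) (τ : ℍ) : f (γ • τ) = ((γ 1 0 : ℂ) * τ + (γ 1 1 : ℂ)) ^ k * f τ := by
  have h := SlashInvariantForm.slash_action_eqn' (k := k) f
    (MonoidHom.mem_range.mpr ⟨γ, rfl⟩ : Matrix.SpecialLinearGroup.mapGL ℝ γ ∈ 𝒮ℒ) τ
  have h' : f (γ • τ) = UpperHalfPlane.denom (γ : GL (Fin 2) ℝ) τ ^ k * f τ := h
  rw [h']
  simp [UpperHalfPlane.denom]

theorem denom_SL_ne_zero (γ : SL(2, ℤ)) (τ : ℍ) : ((γ 1 0 : ℂ) * τ + (γ 1 1 : ℂ)) ≠ 0 := by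
  have := UpperHalfPlane.denom_ne_zero (γ : GL (Fin 2) ℝ) τ
  simpa [UpperHalfPlane.denom] using this

/-- The Klein invariant. -/
def kleinJ (τ : ℍ) : ℂ := E₄ τ ^ 3 / discriminant τ

theorem discriminant_SL (γ : SL(2, ℤ)) (τ : ℍ) :
    discriminant (γ • τ) = ((γ 1 0 : ℂ) * τ + (γ 1 1 : ℂ)) ^ 12 * discriminant τ := by
  have := slash_eqn_SL CuspForm.discriminant γ τ
  exact_mod_cast this

theorem E₄_SL (γ : SL(2, ℤ)) (τ : ℍ) :
    E₄ (γ • τ) = ((γ 1 0 : ℂ) * τ + (γ 1 1 : ℂ)) ^ 4 * E₄ τ := by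
  have := slash_eqn_SL E₄ γ τ
  exact_mod_cast this

theorem E₆_SL (γ : SL(2, ℤ)) (τ : ℍ) :
    E₆ (γ • τ) = ((γ 1 0 : ℂ) * τ + (γ 1 1 : ℂ)) ^ 6 * E₆ τ := by
  have := slash_eqn_SL E₆ γ τ
  exact_mod_cast this

theorem kleinJ_SL (γ : SL(2, ℤ)) (τ : ℍ) : kleinJ (γ • τ) = kleinJ τ := by
  rw [kleinJ, kleinJ, discriminant_SL, E₄_SL]
  have := denom_SL_ne_zero γ τ
  have := discriminant_ne_zero τ
  field_simp

theorem kleinJ_sub (τ : ℍ) : kleinJ τ - 1728 = E₆ τ ^ 2 / discriminant τ := by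
  have h := discriminant_ne_zero τ
  rw [kleinJ]
  field_simp
  rw [discriminant_eq_E₄_cube_sub_E₆_sq]
  ring

theorem eq_const_of_invariant {F : ℍ → ℂ} (hF : MDiff F) (hinv : ∀ (γ : SL(2, ℤ)) τ, F (γ • τ) = F τ)
    (hb : IsBoundedAtImInfty F) (τ τ' : ℍ) : F τ = F τ' := by
  let f : ModularForm 𝒮ℒ 0 :=
    { toFun := F
      slash_action_eq' := by
        rintro _ ⟨γ, rfl⟩
        ext τ
        have := hinv γ τ
        change (F ∣[(0 : ℤ)] γ) τ = F τ
        rw [ModularForm.SL_slash_apply, this]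
        simp
      holo' := hF
      bdd_at_cusps' := by
        intro c hc
        rw [Subgroup.IsArithmetic.isCusp_iff_isCusp_SL2Z] at hc
        rw [OnePoint.isBoundedAt_iff_forall_SL2Z hc]
        intro γ _
        have h : F ∣[(0 : ℤ)] γ = F := by
          ext τ
          rw [ModularForm.SL_slash_apply, hinv]
          simp
        change IsBoundedAtImInfty (F ∣[(0 : ℤ)] γ)
        rwa [h] }
  obtain ⟨c, hc⟩ := ModularFormClass.levelOne_weight_zero_const f
  exact (congrFun hc τ).trans (congrFun hc τ').symm

end Invariance

end

noncomputable section

open UpperHalfPlane ModularForm MatrixGroups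

open scoped Real

section Homothety

theorem UpperHalfPlane.int_mul_add_eq_zero {τ : ℍ} {m n : ℝ} (h : (m : ℂ) * τ + n = 0) :
    m = 0 ∧ n = 0 := by
  have h4 := congrArg Complex.im h
  have h5 : m = 0 := by simpa [τ.im_ne_zero] using h4
  subst h5
  exact ⟨rfl, by simpa using h⟩

theorem UpperHalfPlane.int_mul_add_eq_zero' {τ : ℍ} {m n : ℤ} (h : (m : ℂ) * τ + n = 0) :
    m = 0 ∧ n = 0 := by
  have := UpperHalfPlane.int_mul_add_eq_zero (τ := τ) (m := m) (n := n) (by exact_mod_cast h)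
  exact_mod_cast this

theorem exists_SL_of_det {a b c d : ℤ} (h : a * d - b * c = 1) :
    ∃ γ : SL(2, ℤ), γ 0 0 = a ∧ γ 0 1 = b ∧ γ 1 0 = c ∧ γ 1 1 = d :=
  ⟨⟨!![a, b; c, d], by rw [Matrix.det_fin_two_of, h]⟩, rfl, rfl, rfl, rfl⟩

theorem coe_SL_smul (γ : SL(2, ℤ)) (τ : ℍ) : ((γ • τ : ℍ) : ℂ) =
    ((γ 0 0 : ℂ) * τ + (γ 0 1 : ℂ)) / ((γ 1 0 : ℂ) * τ + (γ 1 1 : ℂ)) := by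
  rw [UpperHalfPlane.coe_specialLinearGroup_apply]
  simp

/-- An integral linear change of basis between two lattices with positively oriented bases
comes from the modular group. -/
theorem exists_SL_smul_eq {τ τ' : ℍ} {l : ℂ} {a b c d a' b' c' d' : ℤ}
    (h1 : l * τ = a * τ' + b) (h2 : l = c * τ' + d)
    (h3 : (τ' : ℂ) = l * (a' * τ + b')) (h4 : 1 = l * (c' * τ + d')) :
    ∃ γ : SL(2, ℤ), γ • τ' = τ := by
  have e1 : (((a' * a + b' * c - 1 : ℤ) : ℂ)) * τ' + ((a' * b + b' * d : ℤ) : ℂ) = 0 := by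
    push_cast
    linear_combination -h3 - a' * h1 - b' * h2
  have e2 : (((c' * a + d' * c : ℤ) : ℂ)) * τ' + ((c' * b + d' * d - 1 : ℤ) : ℂ) = 0 := by
    push_cast
    linear_combination -h4 - c' * h1 - d' * h2
  obtain ⟨f1, f2⟩ := UpperHalfPlane.int_mul_add_eq_zero' e1
  obtain ⟨f3, f4⟩ := UpperHalfPlane.int_mul_add_eq_zero' e2
  have hdet : (a' * d' - b' * c') * (a * d - b * c) = 1 := by
    have g1 : a' * a + b' * c = 1 := by linarith
    have g4 : c' * b + d' * d = 1 := by linarith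
    linear_combination (c' * b + d' * d) * g1 + g4 - (c' * a + d' * c) * f2
  have hl : l ≠ 0 := by
    rintro rfl
    simp at h4
  have hn : (0 : ℝ) < Complex.normSq l := Complex.normSq_pos.2 hl
  have him : τ.im * Complex.normSq l = (a * d - b * c : ℤ) * τ'.im := by
    have k1 : τ.im * Complex.normSq l = ((l * τ) * (starRingEnd ℂ) l).im := by
      rw [mul_right_comm, Complex.mul_conj, Complex.im_ofReal_mul]
      exact mul_comm _ _
    rw [k1, h1, h2]
    simp
    ring
  have hpos : 0 < a * d - b * c := by
    have : (0 : ℝ) < (a * d - b * c : ℤ) * τ'.im := him ▸ mul_pos τ.im_pos hn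
    exact_mod_cast (pos_iff_pos_of_mul_pos this).2 τ'.im_pos
  have hone : a * d - b * c = 1 := by
    rcases Int.isUnit_iff.1 (IsUnit.of_mul_eq_one_right _ hdet) with h | h <;> omega
  obtain ⟨γ, g1, g2, g3, g4⟩ := exists_SL_of_det hone
  refine ⟨γ, ?_⟩
  ext1
  rw [coe_SL_smul, g1, g2, g3, g4, ← h1, ← h2]
  field_simp

/-- The period pair with both periods multiplied by `c`. -/
def PeriodPair.scale (L : PeriodPair) {c : ℂ} (hc : c ≠ 0) : PeriodPair where
  ω₁ := c * L.ω₁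
  ω₂ := c * L.ω₂
  indep := by
    have h := L.indep
    rw [LinearIndependent.pair_iff] at h ⊢
    intro s t hst
    refine h s t (mul_left_cancel₀ hc ?_)
    simp only [Complex.real_smul] at hst ⊢
    linear_combination hst

theorem PeriodPair.scale_G (L : PeriodPair) {c : ℂ} (hc : c ≠ 0) (n : ℕ) :
    (L.scale hc).G n = c⁻¹ ^ n * L.G n := by
  rw [PeriodPair.G, PeriodPair.G, ← (L.scale hc).latticeEquivProd.symm.toEquiv.tsum_eq,
    ← L.latticeEquivProd.symm.toEquiv.tsum_eq, ← tsum_mul_left]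
  refine tsum_congr fun v => ?_
  have e := (L.scale hc).latticeEquiv_symm_apply v
  have e' := L.latticeEquiv_symm_apply v
  change (((L.scale hc).latticeEquivProd.symm v).1 ^ n)⁻¹ =
    c⁻¹ ^ n * ((L.latticeEquivProd.symm v).1 ^ n)⁻¹
  rw [e, e', ← inv_pow, ← inv_pow, ← mul_pow, ← mul_inv]
  congr 2
  simp only [PeriodPair.scale]
  ring

theorem exists_scaling_of_kleinJ_eq {τ τ' : ℍ} (h : kleinJ τ = kleinJ τ') :
    ∃ l : ℂ, l ≠ 0 ∧ E₄ τ = l ^ 4 * E₄ τ' ∧ E₆ τ = l ^ 6 * E₆ τ' := by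
  have hd := discriminant_ne_zero τ
  have hd' := discriminant_ne_zero τ'
  have h6 : E₆ τ ^ 2 / discriminant τ = E₆ τ' ^ 2 / discriminant τ' := by
    rw [← kleinJ_sub, ← kleinJ_sub, h]
  rw [kleinJ, kleinJ, div_eq_div_iff hd hd'] at h
  rw [div_eq_div_iff hd hd'] at h6
  have key : ∀ σ : ℍ, E₄ σ = 0 → E₆ σ ≠ 0 := by
    intro σ h4 h6
    apply discriminant_ne_zero σ
    rw [discriminant_eq_E₄_cube_sub_E₆_sq, h4, h6]
    simp
  by_cases h4 : E₄ τ' = 0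
  · have h4' : E₄ τ = 0 := by simpa [h4, hd'] using h
    obtain ⟨l, hl⟩ := IsAlgClosed.exists_pow_nat_eq (E₆ τ / E₆ τ') (n := 6) (by norm_num)
    have := key τ h4'
    have := key τ' h4
    refine ⟨l, ?_, by simp [h4, h4'], by rw [hl]; field_simp⟩
    rintro rfl
    rw [zero_pow (by norm_num), eq_comm, div_eq_zero_iff] at hl
    tauto
  by_cases h0 : E₆ τ' = 0
  · have h0' : E₆ τ = 0 := by simpa [h0, hd'] using h6
    obtain ⟨l, hl⟩ := IsAlgClosed.exists_pow_nat_eq (E₄ τ / E₄ τ') (n := 4) (by norm_num)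
    refine ⟨l, ?_, by rw [hl]; field_simp, by simp [h0, h0']⟩
    rintro rfl
    rw [zero_pow (by norm_num), eq_comm, div_eq_zero_iff] at hl
    rcases hl with hl | hl
    · exact key τ hl h0'
    · exact h4 hl
  have h4' : E₄ τ ≠ 0 := by
    intro e
    simp [e, h4, hd] at h
  have h0' : E₆ τ ≠ 0 := by
    intro e
    simp [e, h0, hd] at h6
  obtain ⟨l, hl⟩ := IsAlgClosed.exists_pow_nat_eq ((E₆ τ / E₆ τ') / (E₄ τ / E₄ τ')) (n := 2)
    (by norm_num)
  have hmn : E₄ τ ^ 3 * E₆ τ' ^ 2 = E₆ τ ^ 2 * E₄ τ' ^ 3 := by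
    have hm : discriminant τ * discriminant τ' ≠ 0 := mul_ne_zero hd hd'
    refine mul_right_cancel₀ hm ?_
    linear_combination E₆ τ' ^ 2 * discriminant τ * h - E₄ τ' ^ 3 * discriminant τ * h6
  refine ⟨l, ?_, ?_, ?_⟩
  · rintro rfl
    rw [zero_pow (by norm_num), eq_comm] at hl
    simp_all
  · rw [show l ^ 4 = (l ^ 2) ^ 2 by ring, hl]
    field_simp
    linear_combination hmn
  · rw [show l ^ 6 = (l ^ 2) ^ 3 by ring, hl]
    field_simp
    linear_combination hmn

theorem exists_SL_smul_eq_of_kleinJ_eq {τ τ' : ℍ} (h : kleinJ τ = kleinJ τ') :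
    ∃ γ : SL(2, ℤ), γ • τ' = τ := by
  obtain ⟨l, hl, h4, h6⟩ := exists_scaling_of_kleinJ_eq h
  have hl' : l⁻¹ ≠ 0 := inv_ne_zero hl
  have hlat : (periodPair τ).lattice = ((periodPair τ').scale hl').lattice := by
    refine PeriodPair.lattice_eq_of_g_eq _ _ ?_ ?_
    · have e : ((periodPair τ').scale hl').g₂ = l ^ 4 * (periodPair τ').g₂ := by
        rw [PeriodPair.g₂, PeriodPair.g₂, PeriodPair.scale_G, inv_inv]
        ring
      rw [e, periodPair_g₂, periodPair_g₂, h4]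
      ring
    · have e : ((periodPair τ').scale hl').g₃ = l ^ 6 * (periodPair τ').g₃ := by
        rw [PeriodPair.g₃, PeriodPair.g₃, PeriodPair.scale_G, inv_inv]
        ring
      rw [e, periodPair_g₃, periodPair_g₃, h6]
      ring
  have h2 : (2 * π * Complex.I : ℂ) ≠ 0 := Complex.two_pi_I_ne_zero
  have m1 : (periodPair τ).ω₁ ∈ ((periodPair τ').scale hl').lattice :=
    hlat ▸ PeriodPair.mem_lattice.2 ⟨1, 0, by simp⟩
  have m2 : (periodPair τ).ω₂ ∈ ((periodPair τ').scale hl').lattice :=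
    hlat ▸ PeriodPair.mem_lattice.2 ⟨0, 1, by simp⟩
  have m3 : ((periodPair τ').scale hl').ω₁ ∈ (periodPair τ).lattice :=
    hlat ▸ PeriodPair.mem_lattice.2 ⟨1, 0, by simp⟩
  have m4 : ((periodPair τ').scale hl').ω₂ ∈ (periodPair τ).lattice :=
    hlat ▸ PeriodPair.mem_lattice.2 ⟨0, 1, by simp⟩
  obtain ⟨a, b, h1⟩ := PeriodPair.mem_lattice.1 m1
  obtain ⟨c, d, h2'⟩ := PeriodPair.mem_lattice.1 m2
  obtain ⟨a', b', h3⟩ := PeriodPair.mem_lattice.1 m3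
  obtain ⟨c', d', h4'⟩ := PeriodPair.mem_lattice.1 m4
  simp only [PeriodPair.scale, periodPair] at h1 h2' h3 h4'
  refine exists_SL_smul_eq (l := l) (a := a) (b := b) (c := c) (d := d) (a' := a') (b' := b')
    (c' := c') (d' := d') ?_ ?_ ?_ ?_
  all_goals refine mul_left_cancel₀ h2 ?_
  all_goals field_simp at h1 h2' h3 h4' ⊢
  · linear_combination -h1
  · linear_combination -h2'
  · linear_combination -h3
  · linear_combination -h4'

theorem kleinJ_eq_iff {τ τ' : ℍ} : kleinJ τ = kleinJ τ' ↔ ∃ γ : SL(2, ℤ), γ • τ' = τ := by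
  refine ⟨exists_SL_smul_eq_of_kleinJ_eq, ?_⟩
  rintro ⟨γ, rfl⟩
  exact kleinJ_SL γ τ'

end Homothety

end

noncomputable section

open PowerSeries Filter Topology UpperHalfPlane ModularForm MatrixGroups

open scoped Real Manifold ArithmeticFunction.sigma

theorem EvalAt.of_X_mul {y v : ℂ} {f : ℂ⟦X⟧} (hy : y ≠ 0) (h : EvalAt y v (PowerSeries.X * f)) :
    EvalAt y (v / y) f := by
  have h1 := (hasSum_nat_add_iff' 1).2 (show HasSum _ _ from h)
  have h2 := h1.div_const y
  refine HasSum.congr_fun (by simpa using h2) fun n => ?_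
  rw [pow_succ]
  field_simp

theorem EvalAt.of_X_pow_mul {y v : ℂ} {f : ℂ⟦X⟧} (hy : y ≠ 0) (n : ℕ)
    (h : EvalAt y (y ^ n * v) (PowerSeries.X ^ n * f)) : EvalAt y v f := by
  induction n with
  | zero => simpa using h
  | succ n ih =>
    rw [pow_succ', pow_succ', mul_assoc, mul_assoc] at h
    have := h.of_X_mul hy
    rw [mul_div_cancel_left₀ _ hy] at this
    exact ih this

/-- The function `F` on the upper half plane is the sum of the power series `f` in
`exp (2πiτ/h)`. -/
def HasQSeries (h : ℝ) (F : ℍ → ℂ) (f : ℂ⟦X⟧) : Prop :=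
  ∀ τ : ℍ, EvalAt (Function.Periodic.qParam h τ) (F τ) f

namespace HasQSeries

variable {h : ℝ} {F G : ℍ → ℂ} {f g : ℂ⟦X⟧}

theorem add (hf : HasQSeries h F f) (hg : HasQSeries h G g) :
    HasQSeries h (fun τ => F τ + G τ) (f + g) := fun τ => (hf τ).add (hg τ)

theorem sub (hf : HasQSeries h F f) (hg : HasQSeries h G g) :
    HasQSeries h (fun τ => F τ - G τ) (f - g) := fun τ => (hf τ).sub (hg τ)

theorem mul (hf : HasQSeries h F f) (hg : HasQSeries h G g) :
    HasQSeries h (fun τ => F τ * G τ) (f * g) := fun τ => (hf τ).mul (hg τ)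

theorem pow (hf : HasQSeries h F f) (n : ℕ) :
    HasQSeries h (fun τ => F τ ^ n) (f ^ n) := fun τ => (hf τ).pow n

theorem const (h : ℝ) (c : ℂ) : HasQSeries h (fun _ => c) (PowerSeries.C c) :=
  fun _ => EvalAt.C _ c

theorem X (h : ℝ) : HasQSeries h (fun τ => Function.Periodic.qParam h τ) PowerSeries.X :=
  fun _ => EvalAt.X _

theorem congr (hf : HasQSeries h F f) (hFG : ∀ τ, F τ = G τ) : HasQSeries h G f :=
  fun τ => hFG τ ▸ hf τ

theorem unique (hh : 0 < h) (hf : HasQSeries h F f) (hg : HasQSeries h F g) : f = g :=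
  eq_of_forall_evalAt_qParam hh hf hg

theorem of_X_pow_mul (n : ℕ) (hf : HasQSeries h
    (fun τ => Function.Periodic.qParam h τ ^ n * F τ) (PowerSeries.X ^ n * f)) :
    HasQSeries h F f :=
  fun τ => (hf τ).of_X_pow_mul (Function.Periodic.qParam_ne_zero _) n

theorem isBoundedAtImInfty (hh : 0 < h) (hf : HasQSeries h F f) : IsBoundedAtImInfty F :=
  isBoundedAtImInfty_of_hasSum_qExpansion (c := fun n => coeff n f) hh fun τ => by
    simpa [EvalAt] using hf τ

theorem tendsto (hh : 0 < h) (hf : HasQSeries h F f) :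
    Tendsto F atImInfty (𝓝 (constantCoeff f)) := by
  obtain ⟨g, hg⟩ := X_dvd_iff.2 (show constantCoeff (f - PowerSeries.C (constantCoeff f)) = 0 by
    simp)
  have h1 : HasQSeries h (fun τ => (F τ - constantCoeff f) / Function.Periodic.qParam h τ) g :=
    fun τ => EvalAt.of_X_mul (Function.Periodic.qParam_ne_zero _)
      (hg ▸ (hf.sub (const h (constantCoeff f))) τ)
  have h2 := h1.isBoundedAtImInfty hh
  have h3 : Tendsto (fun τ : ℍ => Function.Periodic.qParam h τ *
      ((F τ - constantCoeff f) / Function.Periodic.qParam h τ)) atImInfty (𝓝 0) :=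
    (qParam_tendsto_atImInfty hh).zero_mul_isBoundedUnder_le h2.isBoundedUnder_le
  have h4 := h3.add_const (constantCoeff f)
  rw [zero_add] at h4
  refine h4.congr fun τ => ?_
  have := Function.Periodic.qParam_ne_zero (h := h) (τ : ℂ)
  field_simp
  ring

end HasQSeries

theorem exists_hasQSeries {h : ℝ} (hh : 0 < h) {F : ℍ → ℂ} (hF : MDiff F)
    (hper : ∀ τ : ℍ, F (h +ᵥ τ) = F τ) (hb : IsBoundedAtImInfty F) :
    ∃ f, HasQSeries h F f := by
  refine ⟨qExpansion h F, fun τ => ?_⟩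
  have hp : Function.Periodic (F ∘ ofComplex) h := by
    intro z
    by_cases hz : 0 < z.im
    · have hz' : 0 < (z + h).im := by simpa using hz
      simp only [Function.comp]
      rw [ofComplex_apply_of_im_pos hz, ofComplex_apply_of_im_pos hz', ← hper ⟨z, hz⟩]
      congr 1
      ext1
      simp [add_comm]
    · have hz' : ¬ 0 < (z + h).im := by simpa using hz
      simp only [Function.comp]
      rw [ofComplex_apply_of_im_nonpos (not_lt.1 hz), ofComplex_apply_of_im_nonpos (not_lt.1 hz')]
  have := UpperHalfPlane.hasSum_qExpansion hh hp hF hb τ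
  simpa [EvalAt] using this

theorem hasQSeries_E₄ : HasQSeries 1 (fun τ => E₄ τ) (eisFour ℂ) := evalAt_E₄

theorem hasQSeries_E₆ : HasQSeries 1 (fun τ => E₆ τ) (eisSix ℂ) := evalAt_E₆

theorem qParam_add (h : ℝ) (z w : ℂ) : Function.Periodic.qParam h (z + w) =
    Function.Periodic.qParam h z * Function.Periodic.qParam h w := by
  rw [Function.Periodic.qParam, Function.Periodic.qParam, Function.Periodic.qParam,
    ← Complex.exp_add]
  congr 1
  ring

theorem qParam_one_one : Function.Periodic.qParam 1 1 = 1 := by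
  simp [Function.Periodic.qParam]

theorem mdifferentiable_qParam (h : ℝ) :
    MDiff (fun τ : ℍ => Function.Periodic.qParam h τ) := by
  have h1 : Differentiable ℂ (Function.Periodic.qParam h) := by
    unfold Function.Periodic.qParam
    fun_prop
  exact (h1.mdifferentiable).comp mdifferentiable_coe

section IntegralSeries

theorem exists_disc_unit : ∃ U : ℤ⟦X⟧, constantCoeff U = 1 ∧
    1728 * (PowerSeries.X * U) = eisFour ℤ ^ 3 - eisSix ℤ ^ 2 := by
  have hs : ∀ d : ℤ, (12 : ℤ) ∣ 5 * d ^ 3 + 7 * d ^ 5 := by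
    intro d
    have h1 : (((5 * d ^ 3 + 7 * d ^ 5 : ℤ)) : ZMod 12) = 0 := by
      push_cast
      generalize (d : ZMod 12) = x
      revert x
      decide
    exact_mod_cast (ZMod.intCast_zmod_eq_zero_iff_dvd _ 12).1 h1
  have hs' : ∀ m : ℕ, (12 : ℤ) ∣ 5 * (σ 3 m : ℤ) + 7 * (σ 5 m : ℤ) := by
    intro m
    rw [ArithmeticFunction.sigma_apply, ArithmeticFunction.sigma_apply]
    push_cast
    rw [Finset.mul_sum, Finset.mul_sum, ← Finset.sum_add_distrib]
    exact Finset.dvd_sum fun d _ => hs d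
  choose c hc using hs'
  set A : ℤ⟦X⟧ := PowerSeries.mk fun m => (σ 3 m : ℤ) with hA
  set B : ℤ⟦X⟧ := PowerSeries.mk fun m => (σ 5 m : ℤ) with hB
  set Cs : ℤ⟦X⟧ := PowerSeries.mk c with hCs
  have h4 : eisFour ℤ = 1 + 240 * A := by
    ext m
    rw [eisFour, coeff_mk, map_add, ← map_ofNat PowerSeries.C 240, coeff_C_mul, hA, coeff_mk,
      coeff_one]
    split_ifs with h
    · subst h
      simp
    · simp
  have h6 : eisSix ℤ = 1 - 504 * B := by
    ext m
    rw [eisSix, coeff_mk, map_sub, ← map_ofNat PowerSeries.C 504, coeff_C_mul, hB, coeff_mk,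
      coeff_one]
    split_ifs with h
    · subst h
      simp
    · simp
  have h12 : 12 * Cs = 5 * A + 7 * B := by
    ext m
    rw [map_add, ← map_ofNat PowerSeries.C 12, ← map_ofNat PowerSeries.C 5,
      ← map_ofNat PowerSeries.C 7, coeff_C_mul, coeff_C_mul, coeff_C_mul, hA, hB, hCs, coeff_mk,
      coeff_mk, coeff_mk]
    exact (hc m).symm
  have hA0 : constantCoeff A = 0 := by
    rw [← coeff_zero_eq_constantCoeff_apply, hA, coeff_mk]
    simp
  have hB0 : constantCoeff B = 0 := by
    rw [← coeff_zero_eq_constantCoeff_apply, hB, coeff_mk]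
    simp
  obtain ⟨A', hA'⟩ := X_dvd_iff.2 hA0
  obtain ⟨B', hB'⟩ := X_dvd_iff.2 hB0
  have hC0 : constantCoeff Cs = 0 := by
    have := congrArg constantCoeff h12
    simp only [map_mul, map_add, hA0, hB0, map_ofNat] at this
    omega
  obtain ⟨C', hC'⟩ := X_dvd_iff.2 hC0
  have hC1 : constantCoeff C' = 1 := by
    have h1 : coeff 1 Cs = constantCoeff C' := by
      rw [hC', show (1 : ℕ) = 0 + 1 from rfl, coeff_succ_X_mul, coeff_zero_eq_constantCoeff_apply]
    rw [← h1, hCs, coeff_mk]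
    have := hc 1
    simp at this
    omega
  refine ⟨C' + PowerSeries.X * (100 * A' ^ 2 + 8000 * PowerSeries.X * A' ^ 3 - 147 * B' ^ 2),
    by simp [hC1], ?_⟩
  rw [h4, h6]
  rw [hA', hB', hC'] at h12
  rw [hA', hB']
  linear_combination 144 * h12

/-- The `q`-expansion of `Δ/q`, with coefficients in any ring. -/
def discUnit (R : Type*) [CommRing R] : R⟦X⟧ :=
  PowerSeries.map (Int.castRingHom R) exists_disc_unit.choose

/-- The `q`-expansion of `q/Δ`, with coefficients in any ring. -/
def discUnitInv (R : Type*) [CommRing R] : R⟦X⟧ :=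
  PowerSeries.map (Int.castRingHom R) (invOfUnit exists_disc_unit.choose 1)

/-- The `q`-expansion of `q j`, with coefficients in any ring. -/
def jSeries (R : Type*) [CommRing R] : R⟦X⟧ := eisFour R ^ 3 * discUnitInv R

variable {R S : Type*} [CommRing R] [CommRing S]

theorem discUnit_mul_discUnitInv : discUnit R * discUnitInv R = 1 := by
  rw [discUnit, discUnitInv, ← map_mul, mul_invOfUnit _ _
    (by simpa using exists_disc_unit.choose_spec.1), map_one]

theorem constantCoeff_discUnit : constantCoeff (discUnit R) = 1 := by
  rw [discUnit, ← coeff_zero_eq_constantCoeff_apply, coeff_map,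
    coeff_zero_eq_constantCoeff_apply, exists_disc_unit.choose_spec.1, map_one]

theorem constantCoeff_discUnitInv : constantCoeff (discUnitInv R) = 1 := by
  have := congrArg constantCoeff (discUnit_mul_discUnitInv (R := R))
  rwa [map_mul, constantCoeff_discUnit, one_mul, map_one] at this

theorem constantCoeff_eisFour : constantCoeff (eisFour R) = 1 := by
  rw [← coeff_zero_eq_constantCoeff_apply, eisFour, coeff_mk, if_pos rfl]

theorem constantCoeff_eisSix : constantCoeff (eisSix R) = 1 := by
  rw [← coeff_zero_eq_constantCoeff_apply, eisSix, coeff_mk, if_pos rfl]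

theorem constantCoeff_jSeries : constantCoeff (jSeries R) = 1 := by
  rw [jSeries, map_mul, map_pow, constantCoeff_eisFour, constantCoeff_discUnitInv]
  simp

theorem map_discUnitInv (f : R →+* S) : PowerSeries.map f (discUnitInv R) = discUnitInv S := by
  ext n
  simp [discUnitInv]

theorem map_jSeries (f : R →+* S) : PowerSeries.map f (jSeries R) = jSeries S := by
  rw [jSeries, map_mul, map_pow, map_eisFour, map_discUnitInv, jSeries]

theorem disc_eq : 1728 * (PowerSeries.X * discUnit R) = eisFour R ^ 3 - eisSix R ^ 2 := by
  have := congrArg (PowerSeries.map (Int.castRingHom R)) exists_disc_unit.choose_spec.2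
  rw [map_sub, map_pow, map_pow, map_eisFour, map_eisSix, map_mul, map_mul, PowerSeries.map_X,
    map_ofNat (PowerSeries.map (Int.castRingHom R)) 1728] at this
  exact this

theorem hasQSeries_discriminant :
    HasQSeries 1 (fun τ => discriminant τ) (PowerSeries.X * discUnit ℂ) := by
  have h := ((hasQSeries_E₄.pow 3).sub (hasQSeries_E₆.pow 2)).mul
    (HasQSeries.const 1 (1728 : ℂ)⁻¹)
  rw [← disc_eq, mul_comm, ← mul_assoc, ← map_ofNat PowerSeries.C 1728, ← map_mul,
    inv_mul_cancel₀ (by norm_num), map_one, one_mul] at h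
  refine h.congr fun τ => ?_
  rw [discriminant_eq_E₄_cube_sub_E₆_sq, div_eq_mul_inv]

theorem mdifferentiable_discriminant : MDiff discriminant := CuspForm.discriminant.holo'

theorem mdifferentiable_E₄ : MDiff (fun τ => E₄ τ) := E₄.holo'

theorem mdifferentiable_E₆ : MDiff (fun τ => E₆ τ) := E₆.holo'

theorem mdifferentiable_kleinJ : MDiff kleinJ :=
  (mdifferentiable_E₄.pow 3).div mdifferentiable_discriminant discriminant_ne_zero

theorem hasQSeries_discUnit : HasQSeries 1
    (fun τ => discriminant τ / Function.Periodic.qParam 1 τ) (discUnit ℂ) :=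
  fun τ => (hasQSeries_discriminant τ).of_X_mul (Function.Periodic.qParam_ne_zero _)

theorem coe_T_smul (τ : ℍ) : ((ModularGroup.T • τ : ℍ) : ℂ) = τ + 1 := by
  rw [coe_SL_smul]
  simp [ModularGroup.T]

theorem T_smul_eq (τ : ℍ) : ModularGroup.T • τ = (1 : ℝ) +ᵥ τ := by
  ext1
  rw [coe_T_smul]
  simp [add_comm]

theorem hasQSeries_discUnitInv : HasQSeries 1
    (fun τ => Function.Periodic.qParam 1 τ / discriminant τ) (discUnitInv ℂ) := by
  have hb : IsBoundedAtImInfty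
      (fun τ : ℍ => Function.Periodic.qParam 1 τ / discriminant τ) := by
    have h1 := hasQSeries_discUnit.tendsto one_pos
    rw [constantCoeff_discUnit] at h1
    have h2 := h1.inv₀ one_ne_zero
    refine (h2.congr fun τ => ?_).isBigO_one ℝ
    rw [inv_div]
  have hq : ∀ τ : ℍ, Function.Periodic.qParam 1 ((((1 : ℝ) +ᵥ τ : ℍ)) : ℂ) =
      Function.Periodic.qParam 1 τ := by
    intro τ
    rw [coe_vadd, qParam_add, Complex.ofReal_one, qParam_one_one, one_mul]
  obtain ⟨V, hV⟩ := exists_hasQSeries one_pos ((mdifferentiable_qParam 1).div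
    mdifferentiable_discriminant discriminant_ne_zero) (fun τ => by
      simp only [Pi.div_apply]
      rw [← T_smul_eq, discriminant_SL, T_smul_eq, hq]
      simp [ModularGroup.T]) hb
  have h1 := (hasQSeries_discUnit.mul hV).unique one_pos ((HasQSeries.const 1 1).congr fun τ => by
    have := Function.Periodic.qParam_ne_zero (h := 1) (τ : ℂ)
    have := discriminant_ne_zero τ
    simp only [Pi.div_apply]
    field_simp)
  rw [map_one] at h1
  have h2 : V = discUnitInv ℂ := by
    calc V = (discUnit ℂ * discUnitInv ℂ) * V := by rw [discUnit_mul_discUnitInv, one_mul]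
      _ = discUnitInv ℂ * (discUnit ℂ * V) := by ring
      _ = _ := by rw [h1, mul_one]
  exact h2 ▸ hV

theorem hasQSeries_kleinJ : HasQSeries 1
    (fun τ => Function.Periodic.qParam 1 τ * kleinJ τ) (jSeries ℂ) := by
  refine ((hasQSeries_E₄.pow 3).mul hasQSeries_discUnitInv).congr fun τ => ?_
  rw [kleinJ]
  ring

end IntegralSeries

end

noncomputable section

open PowerSeries Filter Topology UpperHalfPlane ModularForm MatrixGroups

open scoped Real Manifold

section WeightZero

theorem eisFour_tendsto : Tendsto (fun τ => E₄ τ) atImInfty (𝓝 1) := by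
  have := hasQSeries_E₄.tendsto one_pos
  rwa [constantCoeff_eisFour] at this

theorem discriminant_tendsto : Tendsto (fun τ => discriminant τ) atImInfty (𝓝 0) := by
  have := hasQSeries_discriminant.tendsto one_pos
  simpa using this

theorem kleinJ_surjective (c : ℂ) : ∃ τ, kleinJ τ = c := by
  by_contra! h
  set G : ℍ → ℂ := fun τ => discriminant τ / (E₄ τ ^ 3 - c * discriminant τ) with hG
  have h0 : ∀ τ, E₄ τ ^ 3 - c * discriminant τ ≠ 0 := by
    intro τ h1
    apply h τ
    rw [kleinJ, div_eq_iff (discriminant_ne_zero τ)]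
    linear_combination h1
  have hM : MDiff G := mdifferentiable_discriminant.div
    ((mdifferentiable_E₄.pow 3).sub (mdifferentiable_const.mul mdifferentiable_discriminant)) h0
  have hinv : ∀ (γ : SL(2, ℤ)) τ, G (γ • τ) = G τ := by
    intro γ τ
    have := denom_SL_ne_zero γ τ
    have h1 := h0 τ
    have h2 := h0 (γ • τ)
    simp only [hG]
    rw [div_eq_div_iff h2 h1, discriminant_SL, E₄_SL]
    ring
  have ht : Tendsto G atImInfty (𝓝 0) := by
    have := discriminant_tendsto.div ((eisFour_tendsto.pow 3).sub
      (discriminant_tendsto.const_mul c)) (by simp)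
    rw [zero_div] at this
    exact this
  have hc := eq_const_of_invariant hM hinv (ht.isBigO_one ℝ)
  have hz : G UpperHalfPlane.I = 0 := by
    refine tendsto_nhds_unique ?_ ht
    exact tendsto_const_nhds.congr fun τ => hc _ τ
  exact div_ne_zero (discriminant_ne_zero _) (h0 _) hz

variable {R : Type*} [CommRing R]

theorem PowerSeries.map_injective' {S : Type*} [CommRing S] {f : R →+* S}
    (hf : Function.Injective f) : Function.Injective (PowerSeries.map f) := by
  intro a b h
  ext n
  apply hf
  rw [← coeff_map, ← coeff_map, h]

/-- `∑ Wᵢ Jⁱ X^(N-i)`, the series of `q^N W(j)`. -/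
def jPoly (N : ℕ) (W : Polynomial R) : R⟦X⟧ :=
  ∑ i ∈ Finset.range (N + 1), PowerSeries.C (W.coeff i) * jSeries R ^ i * PowerSeries.X ^ (N - i)

theorem jPoly_succ (N : ℕ) (W : Polynomial R) : jPoly (N + 1) W =
    PowerSeries.X * jPoly N W + PowerSeries.C (W.coeff (N + 1)) * jSeries R ^ (N + 1) := by
  rw [jPoly, Finset.sum_range_succ, jPoly, Finset.mul_sum, Nat.sub_self, pow_zero, mul_one]
  congr 1
  refine Finset.sum_congr rfl fun i hi => ?_
  rw [Finset.mem_range] at hi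
  rw [show N + 1 - i = (N - i) + 1 by omega, pow_succ]
  ring

theorem map_jPoly {S : Type*} [CommRing S] (f : R →+* S) (N : ℕ) (W : Polynomial R) :
    PowerSeries.map f (jPoly N W) = jPoly N (W.map f) := by
  simp [jPoly, map_jSeries]

theorem jPoly_sub (N : ℕ) (W W' : Polynomial R) :
    jPoly N (W - W') = jPoly N W - jPoly N W' := by
  rw [jPoly, jPoly, jPoly, ← Finset.sum_sub_distrib]
  refine Finset.sum_congr rfl fun i _ => ?_
  rw [Polynomial.coeff_sub, map_sub]
  ring

theorem coeff_eq_zero_of_jPoly_eq_zero [IsDomain R] (N : ℕ) (W : Polynomial R)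
    (h : jPoly N W = 0) : ∀ i ≤ N, W.coeff i = 0 := by
  induction N with
  | zero =>
    intro i hi
    obtain rfl : i = 0 := by omega
    have := congrArg constantCoeff h
    simpa [jPoly] using this
  | succ N ih =>
    rw [jPoly_succ] at h
    have h0 : W.coeff (N + 1) = 0 := by
      have := congrArg constantCoeff h
      simpa [constantCoeff_jSeries] using this
    rw [h0, map_zero, zero_mul, add_zero, mul_eq_zero, or_iff_right PowerSeries.X_ne_zero] at h
    intro i hi
    rcases Nat.le_succ_iff.1 hi with hi | rfl
    · exact ih h i hi
    · exact h0

theorem jPoly_injOn [IsDomain R] {N : ℕ} {W W' : Polynomial R} (hW : W.natDegree ≤ N)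
    (hW' : W'.natDegree ≤ N) (h : jPoly N W = jPoly N W') : W = W' := by
  rw [← sub_eq_zero, ← jPoly_sub] at h
  have := coeff_eq_zero_of_jPoly_eq_zero N _ h
  ext i
  rcases le_or_gt i N with hi | hi
  · exact sub_eq_zero.1 (by rw [← Polynomial.coeff_sub]; exact this i hi)
  · rw [Polynomial.coeff_eq_zero_of_natDegree_lt (hW.trans_lt hi),
      Polynomial.coeff_eq_zero_of_natDegree_lt (hW'.trans_lt hi)]

variable {ι : R →+* ℂ}

theorem exists_polynomial_of_hasQSeries (hι : Function.Injective ι) (N : ℕ) : ∀ {F : ℍ → ℂ}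
    {f : R⟦X⟧}, MDiff F → (∀ (γ : SL(2, ℤ)) τ, F (γ • τ) = F τ) →
    HasQSeries 1 (fun τ => Function.Periodic.qParam 1 τ ^ N * F τ) (PowerSeries.map ι f) →
    ∃ W : Polynomial R, W.natDegree ≤ N ∧ (∀ τ, F τ = W.eval₂ ι (kleinJ τ)) ∧ f = jPoly N W := by
  induction N with
  | zero =>
    intro F f hF hinv hf
    simp only [pow_zero, one_mul] at hf
    have hc := eq_const_of_invariant hF hinv (hf.isBoundedAtImInfty one_pos)
    have h1 := hf.unique one_pos ((HasQSeries.const 1 (F UpperHalfPlane.I)).congr fun τ => hc _ τ)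
    have h2 : F UpperHalfPlane.I = ι (constantCoeff f) := by
      have := congrArg (coeff 0) h1
      rw [coeff_map] at this
      simpa using this.symm
    rw [h2, ← PowerSeries.map_C] at h1
    have h3 := PowerSeries.map_injective' hι h1
    refine ⟨Polynomial.C (constantCoeff f), by simp, fun τ => ?_, ?_⟩
    · rw [Polynomial.eval₂_C, ← h2]
      exact hc _ _
    · simpa [jPoly] using h3
  | succ N ih =>
    intro F f hF hinv hf
    set c := constantCoeff f with hc
    obtain ⟨f1, hf1⟩ := X_dvd_iff.2 (show constantCoeff
      (f - PowerSeries.C c * jSeries R ^ (N + 1)) = 0 by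
        simp [constantCoeff_jSeries, hc])
    have h1 : HasQSeries 1 (fun τ => Function.Periodic.qParam 1 τ ^ N *
        (F τ - ι c * kleinJ τ ^ (N + 1))) (PowerSeries.map ι f1) := by
      have h2 := hf.sub ((HasQSeries.const 1 (ι c)).mul (hasQSeries_kleinJ.pow (N + 1)))
      have h3 : PowerSeries.map ι f - PowerSeries.C (ι c) * jSeries ℂ ^ (N + 1) =
          PowerSeries.X ^ 1 * PowerSeries.map ι f1 := by
        rw [pow_one, ← map_jSeries ι, ← PowerSeries.map_X ι, ← map_mul, ← hf1]
        simp
      rw [h3] at h2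
      refine HasQSeries.of_X_pow_mul 1 (h2.congr fun τ => ?_)
      ring
    obtain ⟨W, hW, hWF, hWf⟩ := ih (hF.sub (mdifferentiable_const.mul
      (mdifferentiable_kleinJ.pow (N + 1)))) (fun γ τ => by
        simp only [Pi.sub_apply, Pi.mul_apply, Pi.pow_apply]
        rw [hinv, kleinJ_SL]) h1
    refine ⟨W + Polynomial.C c * Polynomial.X ^ (N + 1), ?_, fun τ => ?_, ?_⟩
    · refine (Polynomial.natDegree_add_le _ _).trans (max_le (by omega) ?_)
      exact Polynomial.natDegree_C_mul_X_pow_le _ _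
    · have := hWF τ
      rw [Polynomial.eval₂_add, ← this]
      simp
    · have e1 : (W + Polynomial.C c * Polynomial.X ^ (N + 1)).coeff (N + 1) = c := by
        rw [Polynomial.coeff_add, Polynomial.coeff_eq_zero_of_natDegree_lt (by omega)]
        simp
      have e2 : jPoly N (W + Polynomial.C c * Polynomial.X ^ (N + 1)) = jPoly N W := by
        refine Finset.sum_congr rfl fun i hi => ?_
        rw [Finset.mem_range] at hi
        rw [Polynomial.coeff_add, Polynomial.coeff_C_mul_X_pow, if_neg (by omega), add_zero]
      rw [jPoly_succ, e1, e2, ← hWf, ← hf1]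
      ring

theorem qParam_natCast_pow {p : ℕ} (hp : p ≠ 0) (z : ℂ) :
    Function.Periodic.qParam p z ^ p = Function.Periodic.qParam 1 z := by
  have hp' : (p : ℂ) ≠ 0 := by exact_mod_cast hp
  rw [Function.Periodic.qParam, Function.Periodic.qParam, ← Complex.exp_nat_mul]
  congr 1
  push_cast
  field_simp

theorem HasQSeries.expand {p : ℕ} (hp : p ≠ 0) {F : ℍ → ℂ} {f : ℂ⟦X⟧} (hf : HasQSeries 1 F f) :
    HasQSeries p F (PowerSeries.expand p hp f) := fun τ => by
  refine EvalAt.expand hp ?_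
  rw [qParam_natCast_pow hp]
  exact hf τ

/-- A modular function whose expansion in `q^(1/p)` is integral is an integral polynomial in the
Klein invariant. -/
theorem exists_polynomial_of_hasQSeries_natCast {p : ℕ} (hp : p ≠ 0) (hι : Function.Injective ι)
    {N : ℕ} {F : ℍ → ℂ} {g : R⟦X⟧} (hF : MDiff F) (hinv : ∀ (γ : SL(2, ℤ)) τ, F (γ • τ) = F τ)
    (hg : HasQSeries p (fun τ => Function.Periodic.qParam 1 τ ^ N * F τ) (PowerSeries.map ι g)) :
    ∃ W : Polynomial R, W.natDegree ≤ N ∧ (∀ τ, F τ = W.eval₂ ι (kleinJ τ)) ∧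
      g = PowerSeries.expand p hp (jPoly N W) := by
  have hp0 : (0 : ℝ) < p := by positivity
  obtain ⟨f', hf'⟩ := exists_hasQSeries one_pos (((mdifferentiable_qParam 1).pow N).mul hF)
    (fun τ => by
      simp only [Pi.mul_apply, Pi.pow_apply]
      rw [← T_smul_eq, hinv, T_smul_eq, coe_vadd, qParam_add, Complex.ofReal_one, qParam_one_one,
        one_mul]) (hg.isBoundedAtImInfty hp0)
  have he : PowerSeries.map ι g = PowerSeries.expand p hp f' := hg.unique hp0 (hf'.expand hp)
  have hf : PowerSeries.map ι (PowerSeries.mk fun n => coeff (p * n) g) = f' := by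
    ext n
    rw [coeff_map, coeff_mk, ← coeff_map, he, coeff_expand_mul]
  have hgf : g = PowerSeries.expand p hp (PowerSeries.mk fun n => coeff (p * n) g) := by
    apply PowerSeries.map_injective' hι
    rw [PowerSeries.map_expand, hf, he]
  rw [← hf] at hf'
  obtain ⟨W, h1, h2, h3⟩ := exists_polynomial_of_hasQSeries hι N hF hinv hf'
  exact ⟨W, h1, h2, h3 ▸ hgf⟩

end WeightZero

end

noncomputable section

open PowerSeries Filter Topology UpperHalfPlane ModularForm MatrixGroups

open scoped Real Manifold

section HeckeFamily

/-- The homogeneous function of degree `-k` on bases of lattices attached to a function of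
weight `k` on the upper half plane. -/
def homogExt (k : ℕ) (E : ℍ → ℂ) (w z : ℂ) : ℂ := (z ^ k)⁻¹ * E (ofComplex (w / z))

/-- `E` transforms like a modular form of weight `k`. -/
def HasWeight (k : ℕ) (E : ℍ → ℂ) : Prop :=
  ∀ (γ : SL(2, ℤ)) (τ : ℍ), E (γ • τ) = ((γ 1 0 : ℂ) * τ + (γ 1 1 : ℂ)) ^ k * E τ

theorem homogExt_mul (k : ℕ) (E : ℍ → ℂ) {s : ℂ} (hs : s ≠ 0) (w z : ℂ) :
    homogExt k E (s * w) (s * z) = (s ^ k)⁻¹ * homogExt k E w z := by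
  rw [homogExt, homogExt, mul_div_mul_left _ _ hs, mul_pow, mul_inv, mul_assoc]

theorem homogExt_coe (k : ℕ) (E : ℍ → ℂ) (τ : ℍ) : homogExt k E τ 1 = E τ := by
  simp [homogExt, ofComplex_apply]

theorem homogExt_SL {k : ℕ} {E : ℍ → ℂ} (hE : HasWeight k E) {a b c d : ℤ}
    (h : a * d - b * c = 1) {w z : ℂ} (hw : 0 < (w / z).im) :
    homogExt k E (a * w + b * z) (c * w + d * z) = homogExt k E w z := by
  obtain ⟨γ, h1, h2, h3, h4⟩ := exists_SL_of_det h
  have hz : z ≠ 0 := by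
    rintro rfl
    simp at hw
  set τ : ℍ := ⟨w / z, hw⟩ with hτ
  have hτ' : (τ : ℂ) = w / z := rfl
  have hd := denom_SL_ne_zero γ τ
  have hγ := coe_SL_smul γ τ
  have hEγ := hE γ τ
  rw [h1, h2, h3, h4] at hγ
  rw [h3, h4] at hEγ hd
  have e1 : (a * w + b * z : ℂ) = (z * (c * τ + d)) * (γ • τ : ℍ) := by
    rw [hγ, mul_assoc, mul_div_cancel₀ _ hd, hτ']
    field_simp
  have e2 : (c * w + d * z : ℂ) = (z * (c * τ + d)) * 1 := by
    rw [hτ']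
    field_simp
  have e3 : homogExt k E w z = homogExt k E (z * τ) (z * 1) := by
    rw [hτ', mul_one, mul_div_cancel₀ _ hz]
  rw [e1, e2, e3, homogExt_mul _ _ hz, homogExt_mul _ _ (mul_ne_zero hz hd), homogExt_coe,
    homogExt_coe, hEγ, mul_pow]
  have := pow_ne_zero k hd
  field_simp

variable (p : ℕ) [Fact p.Prime]

/-- The integral matrix `!![A, B; C, D]` kills the point `x` of the projective line modulo `p`. -/
def Kills (x : Option (ZMod p)) (A B C D : ℤ) : Prop :=
  match x with
  | none => (A : ZMod p) = 0 ∧ (C : ZMod p) = 0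
  | some b => (B : ZMod p) = A * b ∧ (D : ZMod p) = C * b

/-- The lattice function `E` evaluated on the index `p` sublattices of `ℤτ + ℤ`. -/
def heckeFun (k : ℕ) (E : ℍ → ℂ) (x : Option (ZMod p)) (τ : ℍ) : ℂ :=
  match x with
  | none => p ^ k * E (ofComplex (p * τ))
  | some b => E (ofComplex ((τ + b.val) / p))

variable {p}

theorem exists_kills {A B C D : ℤ} (h : A * D - B * C = p) : ∃ x, Kills p x A B C D := by
  have h' : (A : ZMod p) * D = B * C := by
    have := congrArg (Int.cast : ℤ → ZMod p) h
    push_cast at this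
    rw [CharP.cast_eq_zero] at this
    linear_combination this
  by_cases hA : (A : ZMod p) = 0
  · by_cases hC : (C : ZMod p) = 0
    · exact ⟨none, hA, hC⟩
    · refine ⟨some (D / C), ?_, ?_⟩
      · rw [hA, zero_mul, eq_comm, mul_eq_zero, or_iff_left hC] at h'
        rw [h', hA, zero_mul]
      · field_simp
  · refine ⟨some (B / A), ?_, ?_⟩
    · field_simp
    · field_simp
      linear_combination h'

theorem not_all_dvd {A B C D : ℤ} (h : A * D - B * C = p) :
    ¬ ((A : ZMod p) = 0 ∧ (B : ZMod p) = 0 ∧ (C : ZMod p) = 0 ∧ (D : ZMod p) = 0) := by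
  rintro ⟨h1, h2, h3, h4⟩
  rw [ZMod.intCast_zmod_eq_zero_iff_dvd] at h1 h2 h3 h4
  obtain ⟨a, rfl⟩ := h1
  obtain ⟨b, rfl⟩ := h2
  obtain ⟨c, rfl⟩ := h3
  obtain ⟨d, rfl⟩ := h4
  have hp := (Fact.out : p.Prime)
  have h0 : (p : ℤ) ≠ 0 := by exact_mod_cast hp.ne_zero
  have h5 : (p : ℤ) * (a * d - b * c) = 1 := by
    refine mul_left_cancel₀ h0 ?_
    linear_combination h
  have := Int.isUnit_iff.1 (IsUnit.of_mul_eq_one _ h5)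
  have := hp.two_le
  omega

theorem Kills.unique {A B C D : ℤ} (h : A * D - B * C = p) {x y : Option (ZMod p)}
    (hx : Kills p x A B C D) (hy : Kills p y A B C D) : x = y := by
  have := not_all_dvd h
  rcases x with _ | b <;> rcases y with _ | b'
  · rfl
  · obtain ⟨h1, h2⟩ := hx
    obtain ⟨h3, h4⟩ := hy
    rw [h1, zero_mul] at h3
    rw [h2, zero_mul] at h4
    tauto
  · obtain ⟨h1, h2⟩ := hy
    obtain ⟨h3, h4⟩ := hx
    rw [h1, zero_mul] at h3
    rw [h2, zero_mul] at h4
    tauto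
  · obtain ⟨h1, h2⟩ := hx
    obtain ⟨h3, h4⟩ := hy
    by_contra hne
    have hbb : b - b' ≠ 0 := sub_ne_zero.2 fun e => hne (congrArg some e)
    have hA : (A : ZMod p) = 0 := by
      refine (mul_eq_zero.1 (?_ : (A : ZMod p) * (b - b') = 0)).resolve_right hbb
      linear_combination h3 - h1
    have hC : (C : ZMod p) = 0 := by
      refine (mul_eq_zero.1 (?_ : (C : ZMod p) * (b - b') = 0)).resolve_right hbb
      linear_combination h4 - h2
    rw [hA, zero_mul] at h1
    rw [hC, zero_mul] at h2
    tauto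

theorem Kills.line_eq {A B C D : ℤ} (h : A * D - B * C = p) {x : Option (ZMod p)}
    (hx : Kills p x A B C D) {u v : ZMod p} (h1 : A * u + B * v = 0) (h2 : C * u + D * v = 0) :
    match x with
    | none => v = 0
    | some b => u = -(b * v) := by
  have := not_all_dvd h
  rcases x with _ | b
  · obtain ⟨h3, h4⟩ := hx
    rw [h3, zero_mul, zero_add, mul_eq_zero] at h1
    rw [h4, zero_mul, zero_add, mul_eq_zero] at h2
    tauto
  · obtain ⟨h3, h4⟩ := hx
    have h5 : (A : ZMod p) * (u + b * v) = 0 := by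
      rw [← h1, h3]
      ring
    have h6 : (C : ZMod p) * (u + b * v) = 0 := by
      rw [← h2, h4]
      ring
    rw [mul_eq_zero] at h5 h6
    refine eq_neg_of_add_eq_zero_left ?_
    by_contra hne
    have hA := h5.resolve_right hne
    have hC := h6.resolve_right hne
    rw [hA, zero_mul] at h3
    rw [hC, zero_mul] at h4
    tauto

theorem Kills.eq_of_mulVec {A B C D A' B' C' D' : ℤ} (h : A * D - B * C = p)
    (h' : A' * D' - B' * C' = p) {x x' : Option (ZMod p)} (hx : Kills p x A B C D)
    (hx' : Kills p x' A' B' C' D') {u v : ZMod p} (huv : ¬ (u = 0 ∧ v = 0))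
    (h1 : A * u + B * v = 0) (h2 : C * u + D * v = 0)
    (h3 : A' * u + B' * v = 0) (h4 : C' * u + D' * v = 0) : x = x' := by
  have e := hx.line_eq h h1 h2
  have e' := hx'.line_eq h' h3 h4
  rcases x with _ | b <;> rcases x' with _ | b' <;> simp only at e e'
  · rfl
  · simp_all
  · simp_all
  · by_cases hv : v = 0
    · simp_all
    · rw [e, neg_inj, mul_left_inj' hv] at e'
      rw [e']

theorem homogExt_of_kills {k : ℕ} {E : ℍ → ℂ} (hE : HasWeight k E) {A B C D : ℤ}
    (h : A * D - B * C = p) {x : Option (ZMod p)} (hx : Kills p x A B C D) (τ : ℍ) :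
    p ^ k * homogExt k E (A * τ + B) (C * τ + D) = heckeFun p k E x τ := by
  have hp := (Fact.out : p.Prime)
  have hp0 : (p : ℂ) ≠ 0 := by exact_mod_cast hp.ne_zero
  have h0 : (p : ℤ) ≠ 0 := by exact_mod_cast hp.ne_zero
  have hpR : (0 : ℝ) < p := by exact_mod_cast hp.pos
  rcases x with _ | b
  · obtain ⟨h1, h2⟩ := hx
    rw [ZMod.intCast_zmod_eq_zero_iff_dvd] at h1 h2
    obtain ⟨a, rfl⟩ := h1
    obtain ⟨c, rfl⟩ := h2
    have hd : a * D - B * c = 1 := by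
      refine mul_left_cancel₀ h0 ?_
      linear_combination h
    have := homogExt_SL hE hd (w := p * τ) (z := 1) (by simpa using mul_pos hpR τ.im_pos)
    have e : heckeFun p k E none τ = p ^ k * homogExt k E (p * τ) 1 := by
      simp [heckeFun, homogExt]
    rw [e, ← this]
    push_cast
    congr 2 <;> ring
  · obtain ⟨h1, h2⟩ := hx
    have hb : (b : ZMod p) = ((b.val : ℤ) : ZMod p) := by simp
    obtain ⟨b1, hb1⟩ : ∃ b1, B = A * b.val + p * b1 := by
      have : ((B - A * b.val : ℤ) : ZMod p) = 0 := by
        push_cast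
        rw [ZMod.natCast_zmod_val, h1, sub_self]
      obtain ⟨m, hm⟩ := (ZMod.intCast_zmod_eq_zero_iff_dvd _ _).1 this
      exact ⟨m, by linear_combination hm⟩
    obtain ⟨d1, hd1⟩ : ∃ d1, D = C * b.val + p * d1 := by
      have : ((D - C * b.val : ℤ) : ZMod p) = 0 := by
        push_cast
        rw [ZMod.natCast_zmod_val, h2, sub_self]
      obtain ⟨m, hm⟩ := (ZMod.intCast_zmod_eq_zero_iff_dvd _ _).1 this
      exact ⟨m, by linear_combination hm⟩
    subst hb1 hd1
    have hd : A * d1 - b1 * C = 1 := by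
      refine mul_left_cancel₀ h0 ?_
      linear_combination h
    have him : 0 < (((τ : ℂ) + b.val) / p).im := by
      rw [Complex.div_natCast_im]
      have : ((τ : ℂ) + b.val).im = τ.im := by simp [-ZMod.natCast_val]
      rw [this]
      exact div_pos τ.im_pos hpR
    have := homogExt_SL hE hd him
    have e : heckeFun p k E (some b) τ = p ^ k * homogExt k E (τ + b.val) p := by
      simp only [heckeFun, homogExt]
      field_simp
    rw [e, ← this]
    push_cast
    congr 2 <;> ring

theorem exists_kills_matrix (x : Option (ZMod p)) :
    ∃ A B C D : ℤ, A * D - B * C = p ∧ Kills p x A B C D := by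
  rcases x with _ | b
  · exact ⟨p, 0, 0, 1, by ring, by simp [Kills]⟩
  · exact ⟨1, b.val, 0, p, by ring, by simp [Kills]⟩

/-- The modular group permutes the index `p` sublattices. -/
theorem exists_perm_heckeFun (γ : SL(2, ℤ)) : ∃ s : Equiv.Perm (Option (ZMod p)),
    ∀ {k : ℕ} {E : ℍ → ℂ}, HasWeight k E → ∀ x τ, heckeFun p k E x (γ • τ) =
      ((γ 1 0 : ℂ) * τ + (γ 1 1 : ℂ)) ^ k * heckeFun p k E (s x) τ := by
  choose A B C D hdet hk using exists_kills_matrix (p := p)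
  have hγ : γ 0 0 * γ 1 1 - γ 0 1 * γ 1 0 = 1 := by
    rw [← Matrix.det_fin_two]
    exact γ.2
  have hdet' : ∀ x, (A x * γ 0 0 + B x * γ 1 0) * (C x * γ 0 1 + D x * γ 1 1) -
      (A x * γ 0 1 + B x * γ 1 1) * (C x * γ 0 0 + D x * γ 1 0) = p := by
    intro x
    linear_combination (A x * D x - B x * C x) * hγ + hdet x
  choose y hy using fun x => exists_kills (hdet' x)
  have hinj : Function.Injective y := by
    intro x x' hxx
    have h1 := hy x
    have h2 := hy x'
    rw [← hxx] at h2
    have hγ' : ((γ 0 0 : ℤ) : ZMod p) * ((γ 1 1 : ℤ) : ZMod p) - ((γ 0 1 : ℤ) : ZMod p) *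
        ((γ 1 0 : ℤ) : ZMod p) = 1 := by exact_mod_cast congrArg (Int.cast : ℤ → ZMod p) hγ
    rcases hyx : y x with _ | b
    · rw [hyx] at h1 h2
      obtain ⟨h3, h4⟩ := h1
      obtain ⟨h5, h6⟩ := h2
      push_cast at h3 h4 h5 h6
      refine Kills.eq_of_mulVec (hdet x) (hdet x') (hk x) (hk x')
        (u := ((γ 0 0 : ℤ) : ZMod p)) (v := ((γ 1 0 : ℤ) : ZMod p)) ?_ h3 h4 h5 h6
      rintro ⟨e1, e2⟩
      rw [e1, e2] at hγ'
      simp at hγ'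
    · rw [hyx] at h1 h2
      obtain ⟨h3, h4⟩ := h1
      obtain ⟨h5, h6⟩ := h2
      push_cast at h3 h4 h5 h6
      refine Kills.eq_of_mulVec (hdet x) (hdet x') (hk x) (hk x')
        (u := ((γ 0 1 : ℤ) : ZMod p) - ((γ 0 0 : ℤ) : ZMod p) * b)
        (v := ((γ 1 1 : ℤ) : ZMod p) - ((γ 1 0 : ℤ) : ZMod p) * b) ?_ ?_ ?_ ?_ ?_
      · rintro ⟨e1, e2⟩
        have : (1 : ZMod p) = 0 := by
          rw [← hγ']
          linear_combination ((γ 0 0 : ℤ) : ZMod p) * e2 - ((γ 1 0 : ℤ) : ZMod p) * e1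
        exact one_ne_zero this
      · linear_combination h3
      · linear_combination h4
      · linear_combination h5
      · linear_combination h6
  refine ⟨Equiv.ofBijective y (Finite.injective_iff_bijective.1 hinj), ?_⟩
  intro k E hE x τ
  rw [Equiv.ofBijective_apply, ← homogExt_of_kills hE (hdet' x) (hy x),
    ← homogExt_of_kills hE (hdet x) (hk x), coe_SL_smul]
  have hd := denom_SL_ne_zero γ τ
  have := homogExt_mul k E hd
    (A x * (((γ 0 0 : ℂ) * τ + (γ 0 1 : ℂ)) / ((γ 1 0 : ℂ) * τ + (γ 1 1 : ℂ))) + B x)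
    (C x * (((γ 0 0 : ℂ) * τ + (γ 0 1 : ℂ)) / ((γ 1 0 : ℂ) * τ + (γ 1 1 : ℂ))) + D x)
  have e : ∀ r s : ℤ, ((γ 1 0 : ℂ) * τ + (γ 1 1 : ℂ)) *
      (r * (((γ 0 0 : ℂ) * τ + (γ 0 1 : ℂ)) / ((γ 1 0 : ℂ) * τ + (γ 1 1 : ℂ))) + s) =
      ((r * γ 0 0 + s * γ 1 0 : ℤ) : ℂ) * τ + ((r * γ 0 1 + s * γ 1 1 : ℤ) : ℂ) := by
    intro r s
    push_cast
    field_simp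
    ring
  rw [e, e] at this
  rw [this, mul_left_comm, mul_inv_cancel_left₀ (pow_ne_zero k hd)]

/-- If an integral matrix of determinant `p` fixes `τ`, then the corresponding sublattice is
homothetic to the whole lattice. -/
theorem heckeFun_of_fixed {k : ℕ} {E : ℍ → ℂ} (hE : HasWeight k E) {A B C D : ℤ}
    (h : A * D - B * C = p) {x : Option (ZMod p)} (hx : Kills p x A B C D) {τ : ℍ} {β β' : ℂ}
    (h1 : (A : ℂ) * τ + B = β * τ) (h2 : (C : ℂ) * τ + D = β) (hβ : β * β' = p) :
    heckeFun p k E x τ = β' ^ k * E τ := by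
  have hp0 : (p : ℂ) ≠ 0 := by exact_mod_cast (Fact.out : p.Prime).ne_zero
  have hβ0 : β ≠ 0 := by
    rintro rfl
    simp at hβ
    exact hp0 hβ.symm
  rw [← homogExt_of_kills hE h hx, h1, h2, ← hβ, mul_pow]
  have := homogExt_mul k E hβ0 τ 1
  rw [mul_one, homogExt_coe] at this
  rw [this]
  field_simp

end HeckeFamily

end

noncomputable section

open PowerSeries Filter Topology UpperHalfPlane ModularForm MatrixGroups Derivative

open scoped Real Manifold

section DerivKleinJ

theorem tendsto_normalizedDeriv {F : ℍ → ℂ} (hF : MDiff F) {c : ℂ}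
    (hc : Tendsto F atImInfty (𝓝 c)) : Tendsto (D F) atImInfty (𝓝 0) := by
  suffices h : Tendsto (fun τ : ℍ => deriv (F ∘ ofComplex) τ) atImInfty (𝓝 0) by
    have h' := h.const_mul (2 * π * Complex.I)⁻¹
    rw [mul_zero] at h'
    exact h'
  rw [UpperHalfPlane.mdifferentiable_iff] at hF
  rw [Metric.tendsto_nhds]
  intro ε hε
  have h1 := (Metric.tendsto_nhds.1 hc) (ε / 2) (by positivity)
  rw [Filter.Eventually, atImInfty_mem] at h1 ⊢
  obtain ⟨A, hA⟩ := h1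
  refine ⟨max A 0 + 2, fun z hz => ?_⟩
  have him : ∀ w : ℂ, w ∈ Metric.closedBall (z : ℂ) 1 → max A 0 < w.im := by
    intro w hw
    rw [Metric.mem_closedBall, Complex.dist_eq] at hw
    have := (Complex.abs_im_le_norm (w - z)).trans hw
    rw [abs_le, Complex.sub_im, coe_im] at this
    linarith [this.1]
  have hpos : ∀ w : ℂ, w ∈ Metric.closedBall (z : ℂ) 1 → 0 < w.im := fun w hw =>
    (le_max_right A 0).trans_lt (him w hw)
  have hder : deriv (F ∘ ofComplex) (z : ℂ) = deriv (fun w => (F ∘ ofComplex) w - c) (z : ℂ) := by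
    rw [deriv_sub_const]
  have hd : DiffContOnCl ℂ (fun w => (F ∘ ofComplex) w - c) (Metric.ball (z : ℂ) 1) := by
    refine DifferentiableOn.diffContOnCl ?_
    rw [closure_ball _ one_ne_zero]
    exact (hF.mono hpos).sub_const c
  have := Complex.norm_deriv_le_of_forall_mem_sphere_norm_le one_pos hd (C := ε / 2) (by
    intro w hw
    have hw' := Metric.sphere_subset_closedBall hw
    have h2 := hA ⟨w, hpos w hw'⟩ (((le_max_left A 0).trans_lt (him w hw')).le)
    rw [Set.mem_ofPred_eq, dist_eq_norm] at h2
    rw [Function.comp_apply, ofComplex_apply_of_im_pos (hpos w hw')]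
    exact h2.le)
  rw [Set.mem_ofPred_eq, dist_zero_right, hder]
  linarith

theorem HasWeight.slash {k : ℕ} {F : ℍ → ℂ} (h : HasWeight k F) (γ : SL(2, ℤ)) :
    F ∣[(k : ℤ)] γ = F := by
  ext τ
  have hne := denom_SL_ne_zero γ τ
  rw [ModularForm.SL_slash_apply, h γ τ]
  simp [UpperHalfPlane.denom]
  field_simp

theorem HasWeight.of_slash {k : ℕ} {F : ℍ → ℂ} (h : ∀ γ : SL(2, ℤ), F ∣[(k : ℤ)] γ = F) :
    HasWeight k F := by
  intro γ τ
  have hne := denom_SL_ne_zero γ τ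
  have h2 := congrFun (h γ) τ
  rw [ModularForm.SL_slash_apply] at h2
  have h3 : UpperHalfPlane.denom (γ : GL (Fin 2) ℝ) τ = (γ 1 0 : ℂ) * τ + (γ 1 1 : ℂ) := by
    simp [UpperHalfPlane.denom]
  rw [h3, zpow_neg, zpow_natCast] at h2
  rw [← h2, mul_comm (F _), mul_inv_cancel_left₀ (pow_ne_zero _ hne)]

theorem HasWeight.serreDerivative {k : ℕ} {F : ℍ → ℂ} (hF : MDiff F)
    (h : HasWeight k F) : HasWeight (k + 2) (Derivative.serreDerivative k F) :=
  .of_slash fun γ => by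
    have := serreDerivative_slash_invariant (γ := γ) hF (h.slash γ)
    simpa only [Nat.cast_add, Nat.cast_ofNat, Int.cast_natCast] using this

theorem hasWeight_E₄ : HasWeight 4 (fun τ => E₄ τ) := E₄_SL

theorem hasWeight_E₆ : HasWeight 6 (fun τ => E₆ τ) := E₆_SL

/-- The first Rankin-Cohen bracket of `E₄` and `E₆`. -/
def eisBracket (τ : ℍ) : ℂ := 4 * E₄ τ * D (fun τ => E₆ τ) τ - 6 * E₆ τ * D (fun τ => E₄ τ) τ

theorem hasWeight_eisBracket : HasWeight 12 eisBracket := by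
  have h4 := hasWeight_E₄.serreDerivative mdifferentiable_E₄
  have h6 := hasWeight_E₆.serreDerivative mdifferentiable_E₆
  have key : ∀ τ, eisBracket τ = 4 * E₄ τ * serreDerivative (6 : ℕ) (fun τ => E₆ τ) τ -
      6 * E₆ τ * serreDerivative (4 : ℕ) (fun τ => E₄ τ) τ := by
    intro τ
    simp only [eisBracket, serreDerivative_apply]
    push_cast
    ring
  intro γ τ
  rw [key, key, h4 γ τ, h6 γ τ, E₄_SL, E₆_SL]
  ring

theorem mdifferentiable_eisBracket : MDiff eisBracket := by
  have h4 := normalizedDerivOfComplex_mdifferentiable mdifferentiable_E₄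
  have h6 := normalizedDerivOfComplex_mdifferentiable mdifferentiable_E₆
  exact ((mdifferentiable_const.mul mdifferentiable_E₄).mul h6).sub
    ((mdifferentiable_const.mul mdifferentiable_E₆).mul h4)

theorem eisBracket_tendsto : Tendsto eisBracket atImInfty (𝓝 0) := by
  have h4 := hasQSeries_E₄.tendsto one_pos
  have h6 := hasQSeries_E₆.tendsto one_pos
  have := ((h4.const_mul 4).mul (tendsto_normalizedDeriv mdifferentiable_E₆ h6)).sub
    ((h6.const_mul 6).mul (tendsto_normalizedDeriv mdifferentiable_E₄ h4))
  simpa using! this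

theorem exists_eisBracket_eq : ∃ c : ℂ, ∀ τ, eisBracket τ = c * discriminant τ := by
  let f : CuspForm 𝒮ℒ 12 :=
    { toFun := eisBracket
      slash_action_eq' := by
        rintro _ ⟨γ, rfl⟩
        exact hasWeight_eisBracket.slash γ
      holo' := mdifferentiable_eisBracket
      zero_at_cusps' := by
        intro c hc
        rw [Subgroup.IsArithmetic.isCusp_iff_isCusp_SL2Z] at hc
        rw [OnePoint.isZeroAt_iff_forall_SL2Z hc]
        intro γ _
        have h : eisBracket ∣[(12 : ℤ)] γ = eisBracket := hasWeight_eisBracket.slash γ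
        change IsZeroAtImInfty (eisBracket ∣[(12 : ℤ)] γ)
        rw [h]
        exact eisBracket_tendsto }
  obtain ⟨c, hc⟩ := CuspForm.exists_smul_discriminant_of_weight_eq_twelve f
  exact ⟨c, fun τ => (DFunLike.congr_fun hc τ).symm⟩

theorem normalizedDeriv_kleinJ (τ : ℍ) :
    D kleinJ τ * discriminant τ ^ 2 = E₄ τ ^ 2 * E₆ τ * eisBracket τ / 3456 := by
  have hj := mdifferentiable_kleinJ
  have h4 := mdifferentiable_E₄
  have h6 := mdifferentiable_E₆
  have hd := mdifferentiable_discriminant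
  have e1 : (fun τ => E₄ τ) ^ 3 = kleinJ * (fun τ => discriminant τ) := by
    ext τ
    have := discriminant_ne_zero τ
    simp only [Pi.pow_apply, Pi.mul_apply, kleinJ]
    field_simp
  have e2 : (1728 : ℂ) • (fun τ => discriminant τ) = (fun τ => E₄ τ) ^ 3 - (fun τ => E₆ τ) ^ 2 := by
    ext τ
    simp only [Pi.pow_apply, Pi.sub_apply, Pi.smul_apply, smul_eq_mul]
    rw [discriminant_eq_E₄_cube_sub_E₆_sq]
    ring
  have d1 := congrFun (congrArg D e1) τ
  rw [normalizedDerivOfComplex_pow _ _ h4, normalizedDerivOfComplex_mul _ _ hj hd] at d1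
  have d2 := congrFun (congrArg D e2) τ
  rw [normalizedDerivOfComplex_sub _ _ (h4.pow 3) (h6.pow 2), normalizedDerivOfComplex_pow _ _ h4,
    normalizedDerivOfComplex_pow _ _ h6, normalizedDerivOfComplex_smul _ _ hd] at d2
  have v1 := congrFun e1 τ
  have v2 := congrFun e2 τ
  simp only [Pi.pow_apply, Pi.sub_apply, Pi.smul_apply, smul_eq_mul, Pi.mul_apply,
    Pi.add_apply, Pi.natCast_apply] at d1 d2 v1 v2
  push_cast at d1 d2
  norm_num at d1 d2
  rw [eisBracket]
  linear_combination (-discriminant τ) * d1 - (E₄ τ ^ 3 / 1728) * d2 +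
    D (fun τ => discriminant τ) τ * v1 + (E₄ τ ^ 2 * D (fun τ => E₄ τ) τ * 3 / 1728) * v2

theorem deriv_kleinJ_ne_zero {τ : ℍ} (h4 : E₄ τ ≠ 0) (h6 : E₆ τ ≠ 0) :
    deriv (kleinJ ∘ ofComplex) τ ≠ 0 := by
  obtain ⟨c, hc⟩ := exists_eisBracket_eq
  have hc0 : c ≠ 0 := by
    rintro rfl
    have hz : ∀ z : ℂ, 0 < z.im → deriv (kleinJ ∘ ofComplex) z = 0 := by
      intro z hz
      have h1 := normalizedDeriv_kleinJ ⟨z, hz⟩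
      rw [hc, zero_mul, mul_zero, zero_div] at h1
      have h2 := (mul_eq_zero.1 h1).resolve_right (pow_ne_zero _ (discriminant_ne_zero _))
      rw [normalizedDerivOfComplex] at h2
      exact (mul_eq_zero.1 h2).resolve_left (inv_ne_zero Complex.two_pi_I_ne_zero)
    obtain ⟨τ₁, h₁⟩ := kleinJ_surjective 0
    obtain ⟨τ₂, h₂⟩ := kleinJ_surjective 1
    have hd := UpperHalfPlane.mdifferentiable_iff.1 mdifferentiable_kleinJ
    have := isOpen_upperHalfPlaneSet.is_const_of_deriv_eq_zero
      (convex_halfSpace_im_gt 0).isPreconnected hd hz τ₁.im_pos τ₂.im_pos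
    rw [Function.comp_apply, Function.comp_apply, ofComplex_apply, ofComplex_apply, h₁, h₂] at this
    exact zero_ne_one this
  intro h
  have h1 := normalizedDeriv_kleinJ τ
  rw [normalizedDerivOfComplex, h, hc, mul_zero, zero_mul] at h1
  have := discriminant_ne_zero τ
  have h2 : E₄ τ ^ 2 * E₆ τ * (c * discriminant τ) ≠ 0 := by positivity
  apply h2
  linear_combination (-3456) * h1

end DerivKleinJ

end

noncomputable section

open PowerSeries Filter Topology UpperHalfPlane ModularForm MatrixGroups Function.Periodic

open scoped Real Manifold

section HeckeProduct

variable {p : ℕ}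

theorem im_natCast_mul_pos (hp : p ≠ 0) (τ : ℍ) : 0 < ((p : ℂ) * τ).im := by
  have : (0 : ℝ) < p := by positivity
  simpa using! mul_pos this τ.im_pos

theorem im_add_div_pos (hp : p ≠ 0) (b : ℕ) (τ : ℍ) : 0 < (((τ : ℂ) + b) / p).im := by
  have : (0 : ℝ) < p := by positivity
  rw [Complex.div_natCast_im]
  simpa using! div_pos τ.im_pos this

theorem qParam_pow_mul_self (hp : p ≠ 0) (z : ℂ) : qParam p z ^ (p * p) = qParam 1 (p * z) := by
  rw [pow_mul, qParam_natCast_pow hp, qParam, qParam, ← Complex.exp_nat_mul]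
  congr 1
  push_cast
  ring

theorem qParam_one_pow_mul (hp : p ≠ 0) (b : ℕ) (z : ℂ) :
    qParam p 1 ^ b * qParam p z = qParam 1 ((z + b) / p) := by
  have hp' : (p : ℂ) ≠ 0 := by exact_mod_cast hp
  rw [qParam, qParam, qParam, ← Complex.exp_nat_mul, ← Complex.exp_add]
  congr 1
  push_cast
  field_simp
  ring

theorem HasQSeries.comp_mul (hp : p ≠ 0) {F : ℍ → ℂ} {f : ℂ⟦X⟧} (hf : HasQSeries 1 F f) :
    HasQSeries p (fun τ => F (ofComplex (p * τ)))
      (PowerSeries.expand (p * p) (mul_ne_zero hp hp) f) := fun τ => by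
  refine EvalAt.expand _ ?_
  have h := hf (ofComplex (p * τ))
  rw [ofComplex_apply_of_im_pos (im_natCast_mul_pos hp τ)] at h
  simp only [qParam_pow_mul_self hp, ofComplex_apply_of_im_pos (im_natCast_mul_pos hp τ)]
  exact h

theorem HasQSeries.comp_add_div (hp : p ≠ 0) (b : ℕ) {F : ℍ → ℂ} {f : ℂ⟦X⟧}
    (hf : HasQSeries 1 F f) :
    HasQSeries p (fun τ => F (ofComplex ((τ + b) / p)))
      (PowerSeries.rescale (qParam p 1 ^ b) f) := fun τ => by
  refine EvalAt.rescale ?_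
  have h := hf (ofComplex ((τ + b) / p))
  rw [ofComplex_apply_of_im_pos (im_add_div_pos hp b τ)] at h
  simp only [qParam_one_pow_mul hp, ofComplex_apply_of_im_pos (im_add_div_pos hp b τ)]
  exact h

theorem HasQSeries.prod {h : ℝ} {α : Type*} (s : Finset α) {F : α → ℍ → ℂ} {f : α → ℂ⟦X⟧}
    (hf : ∀ i ∈ s, HasQSeries h (F i) (f i)) :
    HasQSeries h (fun τ => ∏ i ∈ s, F i τ) (∏ i ∈ s, f i) := fun τ =>
  EvalAt.prod s fun i hi => hf i hi τ

variable [Fact p.Prime]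

theorem mdifferentiable_heckeFun {k : ℕ} {E : ℍ → ℂ} (hE : MDiff E) (x : Option (ZMod p)) :
    MDiff (heckeFun p k E x) := by
  have hp : p ≠ 0 := (Fact.out : p.Prime).ne_zero
  rw [UpperHalfPlane.mdifferentiable_iff] at hE ⊢
  rcases x with _ | b
  · have h1 : DifferentiableOn ℂ (fun z : ℂ => (p : ℂ) ^ k * (E ∘ ofComplex) (p * z))
        {z | 0 < z.im} := by
      refine (hE.comp (f := fun z : ℂ => (p : ℂ) * z) (by fun_prop) fun z hz => ?_).const_mul _
      exact im_natCast_mul_pos hp ⟨z, hz⟩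
    refine h1.congr fun z hz => ?_
    simp [heckeFun, ofComplex_apply_of_im_pos hz]
  · have h1 : DifferentiableOn ℂ (fun z : ℂ => (E ∘ ofComplex) ((z + b.val) / p))
        {z | 0 < z.im} := by
      refine hE.comp (f := fun z : ℂ => (z + b.val) / p) (by fun_prop) fun z hz => ?_
      exact im_add_div_pos hp b.val ⟨z, hz⟩
    refine h1.congr fun z hz => ?_
    simp [heckeFun, ofComplex_apply_of_im_pos hz]

theorem mdifferentiable_prod {α : Type*} (s : Finset α) {F : α → ℍ → ℂ}
    (hF : ∀ i ∈ s, MDiff (F i)) : MDiff (fun τ => ∏ i ∈ s, F i τ) := by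
  simp only [UpperHalfPlane.mdifferentiable_iff] at hF ⊢
  exact DifferentiableOn.fun_finsetProd hF

/-- The product of `c - λ` where `λ` runs over the values of the lattice function `E` at index `p`
sublattices, normalised by `H`. -/
def heckeProd (p : ℕ) [Fact p.Prime] (k : ℕ) (E H c : ℍ → ℂ) (τ : ℍ) : ℂ :=
  ∏ x : Option (ZMod p), (c τ - heckeFun p k E x τ * H τ)

theorem heckeProd_SL {k : ℕ} {E H c : ℍ → ℂ} (hE : HasWeight k E)
    (hH : ∀ (γ : SL(2, ℤ)) τ, ((γ 1 0 : ℂ) * τ + (γ 1 1 : ℂ)) ^ k * H (γ • τ) = H τ)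
    (hc : ∀ (γ : SL(2, ℤ)) τ, c (γ • τ) = c τ) (γ : SL(2, ℤ)) (τ : ℍ) :
    heckeProd p k E H c (γ • τ) = heckeProd p k E H c τ := by
  obtain ⟨s, hs⟩ := exists_perm_heckeFun (p := p) γ
  rw [heckeProd, heckeProd, ← Equiv.prod_comp s (fun x => c τ - heckeFun p k E x τ * H τ)]
  refine Finset.prod_congr rfl fun x _ => ?_
  rw [hs hE, hc, ← hH γ τ]
  ring

theorem mdifferentiable_heckeProd {k : ℕ} {E H c : ℍ → ℂ} (hE : MDiff E) (hH : MDiff H)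
    (hc : MDiff c) : MDiff (heckeProd p k E H c) :=
  mdifferentiable_prod _ fun x _ => hc.sub ((mdifferentiable_heckeFun hE x).mul hH)

end HeckeProduct

section ResidueField

open IsLocalRing

variable {p : ℕ} [Fact p.Prime] {O : ValuationSubring ℂ}

theorem mem_of_aeval_monic {f : Polynomial O} (hf : f.Monic) {z : ℂ}
    (hz : f.eval₂ O.subtype z = 0) : z ∈ O := by
  have h : IsIntegral O z := ⟨f, hf, hz⟩
  obtain ⟨y, hy⟩ := (IsIntegrallyClosed.isIntegral_iff (R := O) (K := ℂ)).1 h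
  rw [← hy]
  exact y.2

theorem qParam_one_pow {p : ℕ} (hp : p ≠ 0) : qParam p 1 ^ p = 1 := by
  rw [qParam_natCast_pow hp, qParam_one_one]

theorem exists_zeta (O : ValuationSubring ℂ) : ∃ z : O, O.subtype z = qParam p 1 := by
  have hp : p ≠ 0 := (Fact.out : p.Prime).ne_zero
  refine ⟨⟨qParam p 1, ?_⟩, rfl⟩
  refine mem_of_aeval_monic (f := Polynomial.X ^ p - Polynomial.C 1)
    (Polynomial.monic_X_pow_sub_C _ hp) ?_
  simp [Polynomial.eval₂_sub, qParam_one_pow hp]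

theorem residue_eq_one_of_pow (hO : (p : ℂ) ∈ O.nonunits) {z : O}
    (hz : O.subtype z = qParam p 1) : residue O z = 1 := by
  have hp : p.Prime := Fact.out
  have := charP_residueField hp hO
  have h1 : z ^ p = 1 := by
    apply O.subtype_injective
    rw [map_pow, hz, qParam_one_pow hp.ne_zero, map_one]
  have h2 : (residue O z - 1) ^ p = 0 := by
    rw [sub_pow_char, ← map_pow, h1, map_one, one_pow, sub_self]
  exact sub_eq_zero.1 (pow_eq_zero_iff hp.ne_zero |>.1 h2)

theorem pow_char_eq_expand {κ : Type*} [Field κ] [CharP κ p] {f : κ⟦X⟧}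
    (hf : PowerSeries.map (frobenius κ p) f = f) :
    f ^ p = PowerSeries.expand p (Fact.out : p.Prime).ne_zero f := by
  have h := MvPowerSeries.map_frobenius_expand p (Fact.out : p.Prime).ne_zero (f := f)
  rw [← h]
  conv_rhs => rw [← hf, ← PowerSeries.map_expand]
  rfl

end ResidueField

end

noncomputable section

open PowerSeries Filter Topology UpperHalfPlane ModularForm MatrixGroups Function.Periodic IsLocalRing

open scoped Real Manifold

section JPoly

variable {R : Type*} [CommRing R]

theorem jPoly_C_mul (N : ℕ) (c : R) (W : Polynomial R) :
    jPoly N (Polynomial.C c * W) = PowerSeries.C c * jPoly N W := by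
  simp only [jPoly, Finset.mul_sum, Polynomial.coeff_C_mul, map_mul, mul_assoc]

theorem jPoly_X_pow {N i : ℕ} (hi : i ≤ N) :
    jPoly N (Polynomial.X ^ i : Polynomial R) = jSeries R ^ i * PowerSeries.X ^ (N - i) := by
  rw [jPoly, Finset.sum_eq_single i]
  · simp
  · intro j _ hj
    simp [Polynomial.coeff_X_pow, hj]
  · intro h
    simp at h
    omega

theorem constantCoeff_jPoly (N : ℕ) (W : Polynomial R) :
    constantCoeff (jPoly N W) = W.coeff N := by
  cases N with
  | zero => simp [jPoly]
  | succ N => simp [jPoly_succ, constantCoeff_jSeries]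

theorem expand_injective' {p : ℕ} (hp : p ≠ 0) {f g : R⟦X⟧}
    (h : PowerSeries.expand p hp f = PowerSeries.expand p hp g) : f = g := by
  ext n
  rw [← coeff_expand_mul p hp, h, coeff_expand_mul]

end JPoly

section

variable {p : ℕ} [Fact p.Prime] {R : Type*} [CommRing R] {ι : R →+* ℂ}

theorem exists_polynomial_of_prod (hι : Function.Injective ι) {m n N : ℕ} (hmn : m + p * n = p * N)
    {F : Option (ZMod p) → ℍ → ℂ} {g₀ : R⟦X⟧} {g : ZMod p → R⟦X⟧}
    (hF : MDiff (fun τ => ∏ x, F x τ))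
    (hinv : ∀ (γ : SL(2, ℤ)) τ, ∏ x, F x (γ • τ) = ∏ x, F x τ)
    (h₀ : HasQSeries p (fun τ => qParam p τ ^ m * F none τ) (PowerSeries.map ι g₀))
    (hg : ∀ b, HasQSeries p (fun τ => qParam p τ ^ n * F (some b) τ) (PowerSeries.map ι (g b))) :
    ∃ W : Polynomial R, W.natDegree ≤ N ∧ (∀ τ, ∏ x, F x τ = W.eval₂ ι (kleinJ τ)) ∧
      g₀ * ∏ b, g b = PowerSeries.expand p (Fact.out : p.Prime).ne_zero (jPoly N W) := by
  refine exists_polynomial_of_hasQSeries_natCast _ hι hF hinv ?_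
  rw [map_mul, map_prod]
  refine (h₀.mul (HasQSeries.prod Finset.univ fun b _ => hg b)).congr fun τ => ?_
  rw [Fintype.prod_option, Finset.prod_mul_distrib, Finset.prod_const, Finset.card_univ,
    ZMod.card, ← qParam_natCast_pow (Fact.out : p.Prime).ne_zero, ← pow_mul, ← pow_mul, ← hmn,
    pow_add, mul_comm n p]
  ring

end

section ModularPolynomial

variable {p : ℕ} [Fact p.Prime] {O : ValuationSubring ℂ}

theorem hasWeight_kleinJ : HasWeight 0 kleinJ := fun γ τ => by
  rw [kleinJ_SL, pow_zero, one_mul]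

theorem map_frobenius_jSeries {κ : Type*} [Field κ] [CharP κ p] :
    PowerSeries.map (frobenius κ p) (jSeries κ) = jSeries κ := map_jSeries _

theorem hasQSeries_qParam_pow_mul_kleinJ : HasQSeries p (fun τ => qParam p τ ^ p * kleinJ τ)
    (PowerSeries.expand p (Fact.out : p.Prime).ne_zero (jSeries ℂ)) :=
  (hasQSeries_kleinJ.expand (Fact.out : p.Prime).ne_zero).congr fun τ => by
    rw [qParam_natCast_pow (Fact.out : p.Prime).ne_zero]

theorem hasQSeries_heckeFun_kleinJ_none :
    HasQSeries p (fun τ => qParam p τ ^ (p * p) * heckeFun p 0 kleinJ none τ)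
      (PowerSeries.expand (p * p) (mul_ne_zero (Fact.out : p.Prime).ne_zero
        (Fact.out : p.Prime).ne_zero) (jSeries ℂ)) := by
  have hp := (Fact.out : p.Prime).ne_zero
  refine (hasQSeries_kleinJ.comp_mul hp).congr fun τ => ?_
  have : ((ofComplex (p * τ) : ℍ) : ℂ) = p * τ := by
    rw [ofComplex_apply_of_im_pos (im_natCast_mul_pos hp τ)]
  rw [this, qParam_pow_mul_self hp, heckeFun, pow_zero, one_mul]

theorem hasQSeries_heckeFun_kleinJ_some (b : ZMod p) :
    HasQSeries p (fun τ => qParam p τ ^ p * heckeFun p 0 kleinJ (some b) τ)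
      (PowerSeries.C (qParam p 1 ^ b.val) ^ (p - 1) * PowerSeries.X ^ (p - 1) *
        PowerSeries.rescale (qParam p 1 ^ b.val) (jSeries ℂ)) := by
  have hp := (Fact.out : p.Prime).ne_zero
  have h1 := (((HasQSeries.const p (qParam p 1 ^ b.val)).pow (p - 1)).mul
    ((HasQSeries.X p).pow (p - 1))).mul (hasQSeries_kleinJ.comp_add_div hp b.val)
  refine h1.congr fun τ => ?_
  have : ((ofComplex ((τ + b.val) / p) : ℍ) : ℂ) = (τ + b.val) / p := by
    rw [ofComplex_apply_of_im_pos (im_add_div_pos hp b.val τ)]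
  rw [this, ← qParam_one_pow_mul hp, heckeFun]
  obtain ⟨n, rfl⟩ := Nat.exists_eq_succ_of_ne_zero hp
  have h2 := qParam_one_pow hp
  set q := qParam (n.succ : ℕ) (τ : ℂ)
  set ζ := qParam (n.succ : ℕ) (1 : ℂ)
  have h3 : (ζ ^ b.val) ^ n * ζ ^ b.val = 1 := by
    rw [← pow_succ, ← pow_mul, mul_comm b.val, pow_mul, h2, one_pow]
  rw [Nat.succ_sub_one, pow_succ q]
  linear_combination q ^ n * q * kleinJ (ofComplex ((τ + b.val) / (n.succ : ℕ))) * h3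

/-- The modular equation, and Kronecker's congruence for its diagonal. -/
theorem exists_modularPolynomial (hO : (p : ℂ) ∈ O.nonunits) : ∃ W : Polynomial O,
    W.natDegree ≤ 2 * p ∧ W.coeff (2 * p) = -1 ∧
    (∀ τ, ∏ x, (kleinJ τ - heckeFun p 0 kleinJ x τ) = W.eval₂ O.subtype (kleinJ τ)) ∧
    W.map (residue O) = -(Polynomial.X ^ p - Polynomial.X) ^ 2 := by
  have hp := (Fact.out : p.Prime).ne_zero
  have hp1 := (Fact.out : p.Prime).one_lt
  have hpp := mul_ne_zero hp hp
  obtain ⟨z, hz⟩ := exists_zeta (p := p) O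
  have hz1 := residue_eq_one_of_pow hO hz
  have hchar := charP_residueField (Fact.out : p.Prime) hO
  have hchar' := charP_powerSeries (ResidueField O) p
  let g₀ : O⟦X⟧ := PowerSeries.X ^ (p * (p - 1)) * PowerSeries.expand p hp (jSeries O) -
    PowerSeries.expand (p * p) hpp (jSeries O)
  let g : ZMod p → O⟦X⟧ := fun b => PowerSeries.expand p hp (jSeries O) -
    PowerSeries.C (z ^ b.val) ^ (p - 1) * PowerSeries.X ^ (p - 1) *
      PowerSeries.rescale (z ^ b.val) (jSeries O)
  have hprod : ∀ τ, heckeProd p 0 kleinJ (fun _ => 1) kleinJ τ =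
      ∏ x, (kleinJ τ - heckeFun p 0 kleinJ x τ) := fun τ => by simp [heckeProd]
  have hmd := mdifferentiable_heckeProd (p := p) (k := 0) mdifferentiable_kleinJ
    (mdifferentiable_const (c := (1 : ℂ))) mdifferentiable_kleinJ
  have hinv := heckeProd_SL (p := p) hasWeight_kleinJ (H := fun _ => 1) (fun γ τ => by simp)
    kleinJ_SL
  simp only [hprod] at hinv
  rw [funext hprod] at hmd
  have e1 : p * (p - 1) + p = p * p := by
    rw [← Nat.mul_succ, Nat.succ_eq_add_one, Nat.sub_add_cancel hp1.le]
  obtain ⟨W, hW, hWF, hWg⟩ := exists_polynomial_of_prod (ι := O.subtype) (g₀ := g₀) (g := g)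
    (N := 2 * p) (m := p * p) (n := p) O.subtype_injective (by ring) hmd hinv
    (by
      have := (((HasQSeries.X p).pow (p * (p - 1))).mul hasQSeries_qParam_pow_mul_kleinJ).sub
        hasQSeries_heckeFun_kleinJ_none
      rw [map_sub, map_mul, map_pow, PowerSeries.map_X, PowerSeries.map_expand,
        PowerSeries.map_expand, map_jSeries]
      refine this.congr fun τ => ?_
      rw [← mul_assoc, ← pow_add, e1]
      ring)
    (fun b => by
      have := hasQSeries_qParam_pow_mul_kleinJ.sub (hasQSeries_heckeFun_kleinJ_some b)
      simp only [g, map_sub, map_mul, map_pow, PowerSeries.map_X, PowerSeries.map_C,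
        PowerSeries.map_expand, ← PowerSeries.rescale_map, map_jSeries, hz] at this ⊢
      refine this.congr fun τ => ?_
      ring)
  have hred : PowerSeries.map (residue O) (g₀ * ∏ b, g b) =
      PowerSeries.expand p hp (-(jSeries (ResidueField O) ^ p -
        PowerSeries.X ^ (p - 1) * jSeries (ResidueField O)) ^ 2) := by
    have hJ := pow_char_eq_expand (p := p) (map_frobenius_jSeries (κ := ResidueField O))
    have h1 : ∀ b, PowerSeries.map (residue O) (g b) =
        PowerSeries.expand p hp (jSeries (ResidueField O)) -
          PowerSeries.X ^ (p - 1) * jSeries (ResidueField O) := by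
      intro b
      simp only [g, map_sub, map_mul, map_pow, PowerSeries.map_X, PowerSeries.map_C,
        PowerSeries.map_expand, ← PowerSeries.rescale_map, map_jSeries, hz1, one_pow,
        map_one, one_mul, rescale_one]
      rfl
    rw [map_mul, map_prod, Finset.prod_congr rfl fun b _ => h1 b, Finset.prod_const,
      Finset.card_univ, ZMod.card, map_sub, map_mul, map_pow, PowerSeries.map_X,
      PowerSeries.map_expand, PowerSeries.map_expand, map_jSeries,
      PowerSeries.expand_mul p hp p hp, sub_pow_char, mul_pow, ← map_pow, ← pow_mul,
      mul_comm (p - 1) p, hJ]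
    simp only [map_neg, map_pow, map_sub, map_mul, PowerSeries.expand_X]
    rw [← pow_mul]
    ring
  refine ⟨W, hW, ?_, hWF, ?_⟩
  · rw [← constantCoeff_jPoly, ← constantCoeff_expand p hp, ← hWg, map_mul, map_prod]
    have hp1' : p - 1 ≠ 0 := by omega
    simp [g₀, g, constantCoeff_jSeries, hp, hp1']
  · refine jPoly_injOn (N := 2 * p) ?_ ?_ ?_
    · exact (Polynomial.natDegree_map_le).trans hW
    · rw [Polynomial.natDegree_neg]
      refine Polynomial.natDegree_pow_le.trans ?_
      refine Nat.mul_le_mul_left 2 ((Polynomial.natDegree_sub_le _ _).trans ?_)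
      simp [hp1.le]
    · rw [← map_jPoly]
      apply expand_injective' hp
      rw [← PowerSeries.map_expand, ← hWg, hred]
      congr 1
      have e2 : (-(Polynomial.X ^ p - Polynomial.X) ^ 2 : Polynomial (ResidueField O)) =
          Polynomial.C 2 * Polynomial.X ^ (p + 1) - Polynomial.X ^ (2 * p) - Polynomial.X ^ 2 := by
        rw [map_ofNat Polynomial.C 2]
        ring
      rw [e2, jPoly_sub, jPoly_sub, jPoly_C_mul, jPoly_X_pow (by omega), jPoly_X_pow le_rfl,
        jPoly_X_pow (by omega), map_ofNat PowerSeries.C 2]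
      obtain ⟨n, rfl⟩ : ∃ n, p = n + 1 := ⟨p - 1, by omega⟩
      rw [show 2 * (n + 1) - (n + 1 + 1) = n by omega, show 2 * (n + 1) - 2 = 2 * n by omega,
        Nat.sub_self, Nat.add_sub_cancel]
      ring

end ModularPolynomial

end

noncomputable section

open PowerSeries Filter Topology UpperHalfPlane ModularForm MatrixGroups Function.Periodic IsLocalRing

open scoped Real Manifold

section HeckePolynomial

variable {p : ℕ} [Fact p.Prime] {O : ValuationSubring ℂ}

theorem hasQSeries_qParam_mul_pow_div {E : ℍ → ℂ} {e : ℂ⟦X⟧} (he : HasQSeries 1 E e) (n : ℕ) :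
    HasQSeries p (fun τ => qParam 1 τ * (E τ ^ n / discriminant τ))
      (PowerSeries.expand p (Fact.out : p.Prime).ne_zero (e ^ n * discUnitInv ℂ)) :=
  (((he.pow n).mul hasQSeries_discUnitInv).expand (Fact.out : p.Prime).ne_zero).congr
    fun τ => by ring

/-- A polynomial in the Klein invariant, vanishing at CM points, whose reduction is given by the
Eichler-Shimura congruence. -/
theorem exists_heckePolynomial (hO : (p : ℂ) ∈ O.nonunits) {k n : ℕ} (hk : k * (n + 1) = 12)
    {E : ℍ → ℂ} (hE : HasWeight k E) (hEm : MDiff E) {e : O⟦X⟧}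
    (he : HasQSeries 1 E (PowerSeries.map O.subtype e))
    (hef : PowerSeries.map (residue O) e ^ p = PowerSeries.expand p (Fact.out : p.Prime).ne_zero
      (PowerSeries.map (residue O) e)) {β β' : ℂ} (hβ : β * β' = p) {c₁ c₂ c₃ : O}
    (hc₂ : (c₂ : ℂ) = β ^ k) (hc₃ : (c₃ : ℂ) = β' ^ k * c₁) (hc : residue O c₂ = 0) :
    ∃ W : Polynomial (ResidueField O), W.natDegree ≤ p + 1 ∧
      jPoly (p + 1) W = PowerSeries.C (residue O c₁) * PowerSeries.X *
        (PowerSeries.C (residue O c₃) ^ p * PowerSeries.X ^ p -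
          PowerSeries.map (residue O) e * (PowerSeries.map (residue O) e ^ n * discUnitInv _) ^ p) ∧
      ∀ (τ : ℍ) (x : Option (ZMod p)) (j : O), (j : ℂ) = kleinJ τ →
        heckeFun p k E x τ * (E τ ^ n / discriminant τ) = c₃ → W.eval (residue O j) = 0 := by
  have hp := (Fact.out : p.Prime).ne_zero
  have hp0 : (p : ℂ) ≠ 0 := by exact_mod_cast hp
  have hpp := mul_ne_zero hp hp
  obtain ⟨z, hz⟩ := exists_zeta (p := p) O
  have hz1 := residue_eq_one_of_pow hO hz
  have hchar := charP_residueField (Fact.out : p.Prime) hO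
  have hchar' := charP_powerSeries (ResidueField O) p
  have hβ0 : β' ≠ 0 := by
    rintro rfl
    rw [mul_zero] at hβ
    exact hp0 hβ.symm
  set H : ℍ → ℂ := fun τ => E τ ^ n / discriminant τ with hH
  let F : Option (ZMod p) → ℍ → ℂ := fun x τ =>
    match x with
    | none => (β' ^ k)⁻¹ * (c₃ - heckeFun p k E none τ * H τ)
    | some b => c₃ - heckeFun p k E (some b) τ * H τ
  have hprod : ∀ τ, (β' ^ k)⁻¹ * heckeProd p k E H (fun _ => c₃) τ = ∏ x, F x τ := fun τ => by
    simp only [heckeProd, Fintype.prod_option, F, mul_assoc]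
  have hHm : MDiff H := MDifferentiable.div (hEm.pow n) mdifferentiable_discriminant
    discriminant_ne_zero
  have hHinv : ∀ (γ : SL(2, ℤ)) τ, ((γ 1 0 : ℂ) * τ + (γ 1 1 : ℂ)) ^ k * H (γ • τ) = H τ := by
    intro γ τ
    have h1 := denom_SL_ne_zero γ τ
    have h2 := discriminant_ne_zero τ
    simp only [hH, hE γ τ, discriminant_SL, ← hk]
    field_simp
    ring
  have hmd : MDiff (fun τ => ∏ x, F x τ) := by
    rw [← funext hprod]
    exact mdifferentiable_const.mul (mdifferentiable_heckeProd hEm hHm mdifferentiable_const)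
  have hinv : ∀ (γ : SL(2, ℤ)) τ, ∏ x, F x (γ • τ) = ∏ x, F x τ := fun γ τ => by
    rw [← hprod, ← hprod, heckeProd_SL hE hHinv fun γ τ => rfl]
  set G : O⟦X⟧ := PowerSeries.expand p hp (e ^ n * discUnitInv O) with hG
  let g₀ : O⟦X⟧ := PowerSeries.C c₁ * PowerSeries.X ^ p -
    PowerSeries.C c₂ * (PowerSeries.expand (p * p) hpp e * G)
  let g : ZMod p → O⟦X⟧ := fun b => PowerSeries.C c₃ * PowerSeries.X ^ p -
    PowerSeries.rescale (z ^ b.val) e * G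
  have hGq : HasQSeries p (fun τ => qParam 1 τ * H τ) (PowerSeries.map O.subtype G) := by
    have := hasQSeries_qParam_mul_pow_div (p := p) he n
    rwa [hG, PowerSeries.map_expand, map_mul, map_pow, map_discUnitInv]
  obtain ⟨W, hW, hWF, hWg⟩ := exists_polynomial_of_prod (ι := O.subtype) (F := F) (g₀ := g₀) (g := g)
    (N := p + 1) (m := p) (n := p) O.subtype_injective (by ring) hmd hinv
    (by
      have := ((HasQSeries.const p (c₁ : ℂ)).mul ((HasQSeries.X p).pow p)).sub
        ((HasQSeries.const p (c₂ : ℂ)).mul ((he.comp_mul hp).mul hGq))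
      simp only [g₀, map_sub, map_mul, map_pow, PowerSeries.map_X, PowerSeries.map_C,
        PowerSeries.map_expand]
      refine this.congr fun τ => ?_
      rw [qParam_natCast_pow hp]
      simp only [F, heckeFun, hc₂, hc₃, ← hβ]
      field_simp
      ring)
    (fun b => by
      have := ((HasQSeries.const p (c₃ : ℂ)).mul ((HasQSeries.X p).pow p)).sub
        ((he.comp_add_div hp b.val).mul hGq)
      simp only [g, map_sub, map_mul, map_pow, PowerSeries.map_X, PowerSeries.map_C,
        ← PowerSeries.rescale_map, hz]
      refine this.congr fun τ => ?_
      rw [qParam_natCast_pow hp]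
      simp only [F, heckeFun]
      ring)
  refine ⟨W.map (residue O), Polynomial.natDegree_map_le.trans hW, ?_, ?_⟩
  · rw [← map_jPoly]
    apply expand_injective' hp
    have h0 : PowerSeries.map (residue O) g₀ =
        PowerSeries.C (residue O c₁) * PowerSeries.X ^ p := by
      simp only [g₀, map_sub, map_mul, map_pow, PowerSeries.map_X, PowerSeries.map_C, hc, map_zero,
        zero_mul, sub_zero]
    have h1 : ∀ b, PowerSeries.map (residue O) (g b) =
        PowerSeries.C (residue O c₃) * PowerSeries.X ^ p -
          PowerSeries.map (residue O) e * PowerSeries.expand p hp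
            (PowerSeries.map (residue O) e ^ n * discUnitInv _) := by
      intro b
      simp only [g, hG, map_sub, map_mul, map_pow, PowerSeries.map_X, PowerSeries.map_C,
        PowerSeries.map_expand, ← PowerSeries.rescale_map, map_discUnitInv, hz1, one_pow,
        rescale_one, RingHom.id_apply]
    rw [← PowerSeries.map_expand, ← hWg, map_mul, map_prod, Finset.prod_congr rfl fun b _ => h1 b,
      Finset.prod_const, Finset.card_univ, ZMod.card, h0, sub_pow_char, mul_pow, mul_pow, hef]
    simp only [map_sub, map_mul, map_pow, PowerSeries.expand_X, PowerSeries.expand_C]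
  · intro τ x j hj hx
    have h2 : F x τ = 0 := by
      rcases x with _ | b
      · simp only [F, hx, hH, sub_self, mul_zero]
      · simp only [F, hx, hH, sub_self]
    have h3 := hWF τ
    rw [Finset.prod_eq_zero (Finset.mem_univ x) h2, ← hj] at h3
    have h4 : W.eval j = 0 := by
      apply O.subtype_injective
      rw [map_zero, h3]
      exact (Polynomial.eval₂_at_apply O.subtype j).symm
    rw [Polynomial.eval_map, Polynomial.eval₂_at_apply, h4, map_zero]

end HeckePolynomial

end

noncomputable section

open PowerSeries

section HeckeForm

variable (p : ℕ) {κ : Type*} [Field κ]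

/-- The isobaric form of weight `6 * (p + 1)` in variables of weight `2` and `3` expressing the
Eichler-Shimura congruence. -/
def heckeForm (W : Polynomial κ) (c₁ c₃ : κ) (i j n : ℕ) {R : Type*} [CommRing R] [Algebra κ R]
    (u v : R) : R :=
  ∑ l ∈ Finset.range (p + 2), algebraMap κ R (W.coeff l) * (u ^ 3) ^ l *
      (algebraMap κ R (1 / 1728) * (u ^ 3 - v ^ 2)) ^ (p + 1 - l) -
    algebraMap κ R c₁ * (algebraMap κ R (1 / 1728) * (u ^ 3 - v ^ 2)) *
      (algebraMap κ R c₃ ^ p * (algebraMap κ R (1 / 1728) * (u ^ 3 - v ^ 2)) ^ p -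
        hasseCoeff p (algebraMap κ R (-1 / 48) * u) (algebraMap κ R (1 / 864) * v) ^
          (2 * (2 * i + 3 * j)) * (u ^ i * v ^ j) ^ (1 + n * p))

variable {p} {W : Polynomial κ} {c₁ c₃ : κ} {i j n : ℕ}

theorem map_heckeForm {R S : Type*} [CommRing R] [Algebra κ R] [CommRing S] [Algebra κ S]
    (φ : R →ₐ[κ] S) (u v : R) :
    φ (heckeForm p W c₁ c₃ i j n u v) = heckeForm p W c₁ c₃ i j n (φ u) (φ v) := by
  have h := map_hasseCoeff p (φ : R →+* S)
  simp only [AlgHom.coe_toRingHom] at h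
  simp only [heckeForm, map_sub, map_sum, map_mul, map_pow, h, AlgHom.commutes]

theorem heckeForm_homog {R : Type*} [CommRing R] [IsDomain R] [Algebra κ R] (hp : p % 2 = 1)
    (hn : (2 * i + 3 * j) * (n + 1) = 6) {d : R} (hd : d ≠ 0) (u v : R) :
    heckeForm p W c₁ c₃ i j n (d ^ 2 * u) (d ^ 3 * v) =
      d ^ (6 * (p + 1)) * heckeForm p W c₁ c₃ i j n u v := by
  have hA : hasseCoeff p (algebraMap κ R (-1 / 48) * (d ^ 2 * u))
      (algebraMap κ R (1 / 864) * (d ^ 3 * v)) = d ^ ((p - 1) / 2) *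
        hasseCoeff p (algebraMap κ R (-1 / 48) * u) (algebraMap κ R (1 / 864) * v) := by
    rw [← hasseCoeff_homog p _ _ d hd hp]
    congr 1 <;> ring
  have hδ : algebraMap κ R (1 / 1728) * ((d ^ 2 * u) ^ 3 - (d ^ 3 * v) ^ 2) =
      d ^ 6 * (algebraMap κ R (1 / 1728) * (u ^ 3 - v ^ 2)) := by ring
  simp only [heckeForm, hA, hδ, mul_sub (d ^ (6 * (p + 1))), Finset.mul_sum]
  congr 1
  · refine Finset.sum_congr rfl fun l hl => ?_
    have : p + 1 = l + (p + 1 - l) := by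
      have := Finset.mem_range.1 hl
      omega
    conv_rhs => rw [this, mul_add, pow_add, pow_mul, pow_mul, Nat.add_sub_cancel_left]
    rw [mul_pow (d ^ 6), mul_pow (d ^ 2), ← pow_mul d, mul_pow (d ^ (2 * 3))]
    ring
  · have h1 : ((p - 1) / 2) * (2 * (2 * i + 3 * j)) + (2 * i + 3 * j) * (1 + n * p) = 6 * p := by
      have h3 : (p - 1) / 2 * 2 + 1 = p := by omega
      calc _ = (2 * i + 3 * j) * ((p - 1) / 2 * 2 + 1) + (2 * i + 3 * j) * n * p := by ring
        _ = (2 * i + 3 * j) * (n + 1) * p := by rw [h3]; ring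
        _ = _ := by rw [hn]
    have h2 : d ^ (6 * (p + 1)) = d ^ 6 * (d ^ 6) ^ p := by rw [mul_add, pow_add, pow_mul]; ring
    have h4 : (d ^ 6) ^ p = (d ^ ((p - 1) / 2)) ^ (2 * (2 * i + 3 * j)) *
        (d ^ (2 * i + 3 * j)) ^ (1 + n * p) := by
      rw [← pow_mul, ← pow_mul, ← pow_mul, ← pow_add, h1]
    have h5 : (d ^ 2 * u) ^ i * (d ^ 3 * v) ^ j = d ^ (2 * i + 3 * j) * (u ^ i * v ^ j) := by ring
    rw [h5, h2, mul_pow (d ^ 6), mul_pow (d ^ ((p - 1) / 2)), mul_pow (d ^ (2 * i + 3 * j))]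
    linear_combination -algebraMap κ R c₁ * (algebraMap κ R (1 / 1728) * (u ^ 3 - v ^ 2)) * d ^ 6 *
      (-hasseCoeff p (algebraMap κ R (-1 / 48) * u) (algebraMap κ R (1 / 864) * v) ^
          (2 * (2 * i + 3 * j)) * (u ^ i * v ^ j) ^ (1 + n * p)) * h4

theorem polynomial_eq_zero_of_aeval_X_mul {f g : κ⟦X⟧} (hg : f = PowerSeries.X * g) (hg0 : g ≠ 0)
    {P : Polynomial κ} (hP : Polynomial.aeval f P = 0) : P = 0 := by
  have hc : ∀ Q : Polynomial κ, Polynomial.aeval f Q = 0 → Q.coeff 0 = 0 := by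
    intro Q hQ
    have h : constantCoeff (Polynomial.aeval f Q) = 0 := by rw [hQ, map_zero]
    rw [← Polynomial.divX_mul_X_add Q, map_add, map_mul, Polynomial.aeval_X, hg] at h
    simpa using h
  ext m
  rw [Polynomial.coeff_zero]
  induction m generalizing P with
  | zero => exact hc P hP
  | succ m ih =>
    rw [← Polynomial.coeff_divX]
    apply ih
    have h := hP
    rw [← Polynomial.divX_mul_X_add P, hc P hP, map_zero, add_zero, map_mul, Polynomial.aeval_X] at h
    refine (mul_eq_zero.1 h).resolve_right ?_
    rw [hg]
    exact mul_ne_zero PowerSeries.X_ne_zero hg0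

theorem heckeForm_self_eq_zero (hp : p % 2 = 1) (hn : (2 * i + 3 * j) * (n + 1) = 6)
    (h1728 : (1728 : κ) ≠ 0)
    (h : heckeForm p W c₁ c₃ i j n (eisFour κ) (eisSix κ) = 0) :
    heckeForm p W c₁ c₃ i j n (Polynomial.X : Polynomial κ) Polynomial.X = 0 := by
  have h4 : constantCoeff (eisFour κ) ≠ 0 := by rw [constantCoeff_eisFour]; exact one_ne_zero
  have h6 : constantCoeff (eisSix κ) ≠ 0 := by rw [constantCoeff_eisSix]; exact one_ne_zero
  have h6' := PowerSeries.mul_inv_cancel _ h6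
  have hd : eisFour κ * (eisSix κ)⁻¹ ≠ 0 := by
    intro h0
    have := congrArg constantCoeff h0
    rw [map_mul, constantCoeff_eisFour, PowerSeries.constantCoeff_inv, constantCoeff_eisSix] at this
    simp at this
  have h1 := heckeForm_homog (W := W) (c₁ := c₁) (c₃ := c₃) hp hn hd (eisFour κ) (eisSix κ)
  set s : κ⟦X⟧ := eisFour κ ^ 3 * (eisSix κ)⁻¹ ^ 2 with hs
  have h2 : (eisFour κ * (eisSix κ)⁻¹) ^ 2 * eisFour κ = s := by rw [hs]; ring
  have h3 : (eisFour κ * (eisSix κ)⁻¹) ^ 3 * eisSix κ = s := by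
    rw [hs]
    linear_combination eisFour κ ^ 3 * (eisSix κ)⁻¹ ^ 2 * h6'
  rw [h, mul_zero, h2, h3] at h1
  have h5 : s - 1 = PowerSeries.X * (1728 * discUnit κ * (eisSix κ)⁻¹ ^ 2) := by
    rw [hs]
    linear_combination -(eisSix κ)⁻¹ ^ 2 * disc_eq (R := κ) + (1 + eisSix κ * (eisSix κ)⁻¹) * h6'
  have h7 : (1728 * discUnit κ * (eisSix κ)⁻¹ ^ 2) ≠ 0 := by
    intro h0
    have := congrArg constantCoeff h0
    rw [map_mul, map_mul, map_pow, constantCoeff_discUnit, PowerSeries.constantCoeff_inv,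
      constantCoeff_eisSix, map_ofNat (constantCoeff (R := κ)) 1728] at this
    simp [h1728] at this
  set P : Polynomial κ := heckeForm p W c₁ c₃ i j n (Polynomial.X : Polynomial κ) Polynomial.X
  have h8 : (P.comp (Polynomial.X + 1)) = 0 := by
    apply polynomial_eq_zero_of_aeval_X_mul h5 h7
    rw [Polynomial.aeval_comp, map_add, Polynomial.aeval_X, map_one, sub_add_cancel, map_heckeForm,
      Polynomial.aeval_X, h1]
  have h9 := congrArg (fun Q => Q.comp (Polynomial.X - 1)) h8
  simpa [Polynomial.comp_assoc] using h9

theorem heckeForm_field_eq_zero (hp : p % 2 = 1) (hn : (2 * i + 3 * j) * (n + 1) = 6)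
    (h : heckeForm p W c₁ c₃ i j n (Polynomial.X : Polynomial κ) Polynomial.X = 0)
    {F : Type*} [Field F] [Algebra κ F] {u v : F} (hu : u ≠ 0) (hv : v ≠ 0) :
    heckeForm p W c₁ c₃ i j n u v = 0 := by
  have hd : u / v ≠ 0 := div_ne_zero hu hv
  have h1 := heckeForm_homog (W := W) (c₁ := c₁) (c₃ := c₃) hp hn hd u v
  have h2 : (u / v) ^ 2 * u = u ^ 3 / v ^ 2 := by field_simp
  have h3 : (u / v) ^ 3 * v = u ^ 3 / v ^ 2 := by field_simp
  have h4 := map_heckeForm (p := p) (W := W) (c₁ := c₁) (c₃ := c₃) (i := i) (j := j) (n := n)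
    (Polynomial.aeval (R := κ) (u ^ 3 / v ^ 2)) Polynomial.X Polynomial.X
  rw [h, map_zero, Polynomial.aeval_X] at h4
  rw [h2, h3, ← h4] at h1
  exact (mul_eq_zero.1 h1.symm).resolve_left (pow_ne_zero _ hd)

theorem heckeForm_polynomial_eq_zero (hp : p % 2 = 1) (hn : (2 * i + 3 * j) * (n + 1) = 6)
    (h : heckeForm p W c₁ c₃ i j n (Polynomial.X : Polynomial κ) Polynomial.X = 0)
    {u v : Polynomial κ} (hu : u ≠ 0) (hv : v ≠ 0) :
    heckeForm p W c₁ c₃ i j n u v = 0 := by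
  have hinj : Function.Injective (algebraMap (Polynomial κ) (RatFunc κ)) :=
    RatFunc.algebraMap_injective κ
  apply hinj
  have h1 := map_heckeForm (p := p) (W := W) (c₁ := c₁) (c₃ := c₃) (i := i) (j := j) (n := n)
    (IsScalarTower.toAlgHom κ (Polynomial κ) (RatFunc κ)) u v
  rw [IsScalarTower.coe_toAlgHom'] at h1
  rw [h1, map_zero]
  exact heckeForm_field_eq_zero hp hn h ((map_ne_zero_iff _ hinj).2 hu)
    ((map_ne_zero_iff _ hinj).2 hv)

/-- An isobaric relation satisfied by the Eisenstein series is satisfied everywhere. -/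
theorem heckeForm_eq_zero (hp : p % 2 = 1) (hn : (2 * i + 3 * j) * (n + 1) = 6)
    (h1728 : (1728 : κ) ≠ 0)
    (h : heckeForm p W c₁ c₃ i j n (eisFour κ) (eisSix κ) = 0) (u v : κ) :
    heckeForm p W c₁ c₃ i j n u v = 0 := by
  have h1 := heckeForm_self_eq_zero hp hn h1728 h
  have key : ∀ a b : Polynomial κ, a ≠ 0 → b ≠ 0 →
      heckeForm p W c₁ c₃ i j n (a.eval 0) (b.eval 0) = 0 := by
    intro a b ha hb
    have h2 := map_heckeForm (p := p) (W := W) (c₁ := c₁) (c₃ := c₃) (i := i) (j := j) (n := n)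
      (Polynomial.aeval (R := κ) (0 : κ)) a b
    rw [heckeForm_polynomial_eq_zero hp hn h1 ha hb, map_zero] at h2
    simpa [Polynomial.coe_aeval_eq_eval] using h2.symm
  have h3 : ∀ c : κ, Polynomial.X + Polynomial.C c ≠ 0 := fun c => Polynomial.X_add_C_ne_zero c
  simpa using key _ _ (h3 u) (h3 v)

end HeckeForm

end

noncomputable section

open PowerSeries Filter Topology UpperHalfPlane ModularForm MatrixGroups IsLocalRing

open scoped Real Manifold

section EichlerShimura

variable {p : ℕ} [Fact p.Prime] {O : ValuationSubring ℂ}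

theorem heckeForm_eisenstein {p : ℕ} {κ : Type*} [Field κ] (h1728 : (1728 : κ) ≠ 0)
    {W : Polynomial κ} {c₁ c₃ : κ} {i j n : ℕ}
    (hA : hasseCoeff p (PowerSeries.C (-1 / 48) * eisFour κ)
      (PowerSeries.C (1 / 864) * eisSix κ) = 1)
    (hW : jPoly (p + 1) W = PowerSeries.C c₁ * PowerSeries.X *
        (PowerSeries.C c₃ ^ p * PowerSeries.X ^ p - (eisFour κ ^ i * eisSix κ ^ j) *
          ((eisFour κ ^ i * eisSix κ ^ j) ^ n * discUnitInv _) ^ p)) :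
    heckeForm p W c₁ c₃ i j n (eisFour κ) (eisSix κ) = 0 := by
  have hδ : PowerSeries.C (1 / 1728) * (eisFour κ ^ 3 - eisSix κ ^ 2) =
      PowerSeries.X * discUnit κ := by
    rw [← disc_eq, ← mul_assoc, ← map_ofNat (PowerSeries.C (R := κ)) 1728, ← map_mul,
      one_div_mul_cancel h1728, map_one, one_mul]
  have hU := discUnit_mul_discUnitInv (R := κ)
  have hsum : ∑ l ∈ Finset.range (p + 2), PowerSeries.C (W.coeff l) * (eisFour κ ^ 3) ^ l *
      (PowerSeries.X * discUnit κ) ^ (p + 1 - l) = discUnit κ ^ (p + 1) * jPoly (p + 1) W := by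
    rw [jPoly, Finset.mul_sum]
    refine Finset.sum_congr rfl fun l hl => ?_
    have : p + 1 = l + (p + 1 - l) := by
      have := Finset.mem_range.1 hl
      omega
    conv_rhs => rw [this, pow_add, Nat.add_sub_cancel_left]
    rw [mul_pow PowerSeries.X, jSeries, mul_pow (eisFour κ ^ 3)]
    have h2 : discUnit κ ^ l * discUnitInv κ ^ l = 1 := by rw [← mul_pow, hU, one_pow]
    linear_combination -PowerSeries.C (W.coeff l) * (eisFour κ ^ 3) ^ l *
      PowerSeries.X ^ (p + 1 - l) * discUnit κ ^ (p + 1 - l) * h2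
  have halg : ∀ a : κ, algebraMap κ κ⟦X⟧ a = PowerSeries.C a := fun a => rfl
  simp only [heckeForm, halg]
  rw [hδ, hA, hsum, hW, one_pow, one_mul, mul_pow PowerSeries.X,
    mul_pow _ (discUnitInv κ)]
  have h2 : discUnit κ ^ p * discUnitInv κ ^ p = 1 := by rw [← mul_pow, hU, one_pow]
  rw [pow_add _ 1, pow_mul, pow_one, pow_succ (discUnit κ)]
  linear_combination -PowerSeries.C c₁ * PowerSeries.X * discUnit κ *
    (eisFour κ ^ i * eisSix κ ^ j) * ((eisFour κ ^ i * eisSix κ ^ j) ^ n) ^ p * h2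

theorem natCast_residue_ne_zero (hO : (p : ℂ) ∈ O.nonunits) {m : ℕ} (hm : m.Coprime p) :
    (m : ResidueField O) ≠ 0 := by
  have := charP_residueField (Fact.out : p.Prime) hO
  rw [Ne, CharP.cast_eq_zero_iff _ p]
  intro h
  exact (Fact.out : p.Prime).one_lt.ne' (Nat.dvd_one.1 (hm ▸ Nat.dvd_gcd h dvd_rfl))

theorem coprime_of_three_lt (hp3 : 3 < p) {a b : ℕ} : (2 ^ a * 3 ^ b).Coprime p := by
  have h2 : Nat.Coprime 2 p := (Nat.coprime_primes Nat.prime_two Fact.out).2 (by omega)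
  have h3 : Nat.Coprime 3 p := (Nat.coprime_primes Nat.prime_three Fact.out).2 (by omega)
  exact (h2.pow_left a).mul_left (h3.pow_left b)

theorem mdifferentiable_eisenstein_monomial (i j : ℕ) :
    MDiff (fun τ : ℍ => E₄ τ ^ i * E₆ τ ^ j) :=
  (mdifferentiable_E₄.pow i).mul (mdifferentiable_E₆.pow j)

/-- The Hasse invariant at the reduction of a CM point is given by the multiplier of the
corresponding endomorphism. -/
theorem hasseCoeff_pow_mul_eq (hp3 : 3 < p) (hO : (p : ℂ) ∈ O.nonunits) {i j n : ℕ}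
    (hn : (2 * i + 3 * j) * (n + 1) = 6)
    (hE : HasWeight (2 * (2 * i + 3 * j)) (fun τ => E₄ τ ^ i * E₆ τ ^ j)) {τ : ℍ}
    {A B C D : ℤ} (h : A * D - B * C = p) (hfix : (A : ℂ) * τ + B = (C * τ + D) * τ) {c : O}
    (hβ : ((C : ℂ) * τ + D) * (c : ℂ) = p) (hβn : (C * τ + D : ℂ) ∈ O.nonunits) {r c₁ : O}
    (hr : (r : ℂ) = kleinJ τ) {u v : ResidueField O} (hδ : u ^ 3 - v ^ 2 ≠ 0)
    (hr' : residue O r * (u ^ 3 - v ^ 2) = 1728 * u ^ 3) (huv : u ^ i * v ^ j ≠ 0)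
    (hc₁ : (c₁ : ℂ) = (E₄ τ ^ i * E₆ τ ^ j) ^ (n + 1) / discriminant τ)
    (hc₁' : residue O c₁ * (u ^ 3 - v ^ 2) = 1728 * (u ^ i * v ^ j) ^ (n + 1)) :
    hasseCoeff p (-1 / 48 * u) (1 / 864 * v) ^ (2 * (2 * i + 3 * j)) * (u ^ i * v ^ j) =
      (residue O c ^ (2 * (2 * i + 3 * j)) * (u ^ i * v ^ j)) ^ p := by
  have hchar := charP_residueField (Fact.out : p.Prime) hO
  have h1728 : (1728 : ResidueField O) ≠ 0 := by
    have := natCast_residue_ne_zero hO (coprime_of_three_lt hp3 (a := 6) (b := 3))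
    norm_num at this
    exact this
  obtain ⟨x, hx⟩ := exists_kills h
  obtain ⟨hb1, hb2⟩ := ValuationSubring.mem_nonunits_iff_exists_mem_maximalIdeal.1 hβn
  set b : O := ⟨_, hb1⟩ with hb
  set k := 2 * (2 * i + 3 * j) with hk
  have hk0 : k ≠ 0 := by
    intro h0
    have : 2 * i + 3 * j = 0 := by omega
    rw [this] at hn
    omega
  have hH := heckeFun_of_fixed hE h hx hfix rfl hβ
  obtain ⟨W, hWd, hW, hW0⟩ := exists_heckePolynomial hO (k := k) (n := n) (by
      rw [hk, mul_assoc, hn]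
      norm_num)
    hE (mdifferentiable_eisenstein_monomial i j) (e := eisFour O ^ i * eisSix O ^ j)
    (by
      rw [map_mul, map_pow, map_pow, map_eisFour, map_eisSix]
      exact (hasQSeries_E₄.pow i).mul (hasQSeries_E₆.pow j))
    (pow_char_eq_expand (by
      simp only [map_mul, map_pow, map_eisFour, map_eisSix])) hβ (c₁ := c₁) (c₂ := b ^ k)
    (c₃ := c ^ k * c₁) (by simp [hb]) (by simp)
    (by rw [map_pow, (residue_eq_zero_iff b).2 hb2, zero_pow hk0])
  have hroot := hW0 τ x r hr (by
    rw [hH]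
    push_cast
    rw [hc₁]
    ring)
  simp only [map_mul, map_pow, map_eisFour, map_eisSix] at hW
  rw [← map_pow, ← map_mul] at hW
  have h0 := heckeForm_eq_zero (by
      rcases (Fact.out : p.Prime).eq_two_or_odd with h | h
      · omega
      · exact h) hn h1728 (heckeForm_eisenstein h1728 (hasseCoeff_tate hp3 hO) hW) u v
  set δ := 1 / 1728 * (u ^ 3 - v ^ 2) with hδ'
  have hδ0 : δ ≠ 0 := mul_ne_zero (one_div_ne_zero h1728) hδ
  have hr'' : u ^ 3 = residue O r * δ := by
    rw [hδ']
    field_simp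
    linear_combination -hr'
  have hc'' : (u ^ i * v ^ j) ^ (n + 1) = residue O c₁ * δ := by
    rw [hδ']
    field_simp
    linear_combination -hc₁'
  have hsum : ∑ l ∈ Finset.range (p + 2), W.coeff l * (u ^ 3) ^ l * δ ^ (p + 1 - l) = 0 := by
    have : ∀ l ∈ Finset.range (p + 2), W.coeff l * (u ^ 3) ^ l * δ ^ (p + 1 - l) =
        δ ^ (p + 1) * (W.coeff l * residue O r ^ l) := by
      intro l hl
      have : p + 1 = l + (p + 1 - l) := by
        have := Finset.mem_range.1 hl
        omega
      conv_rhs => rw [this, pow_add]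
      rw [hr'']
      ring_nf
    rw [Finset.sum_congr rfl this, ← Finset.mul_sum,
      ← Polynomial.eval_eq_sum_range' (by omega), hroot, mul_zero]
  simp only [heckeForm, Algebra.algebraMap_self, RingHom.id_apply, ← hδ', hsum, zero_sub,
    neg_eq_zero] at h0
  have hc0 : residue O c₁ ≠ 0 := by
    intro h
    rw [h, zero_mul] at hc''
    exact pow_ne_zero _ huv hc''
  have h2 := sub_eq_zero.1 ((mul_eq_zero.1 h0).resolve_left (mul_ne_zero hc0 hδ0))
  rw [← mul_pow, mul_assoc, ← hc'', pow_add _ 1, pow_one, mul_comm n p, pow_mul _ p,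
    pow_succ _ n] at h2
  apply mul_right_cancel₀ (pow_ne_zero n (pow_ne_zero p huv))
  rw [mul_assoc, ← h2]
  ring_nf

end EichlerShimura

end

noncomputable section

open UpperHalfPlane ModularForm MatrixGroups IsLocalRing

section TraceCongruence

variable {p : ℕ} [Fact p.Prime]

/-- The `j`-invariant of `y² = x³ + ax + b`. -/
def jInv (a b : ZMod p) : ZMod p := 1728 * (4 * a ^ 3) / (4 * a ^ 3 + 27 * b ^ 2)

variable {O : ValuationSubring ℂ}

theorem mem_of_sq_eq {β s n : ℂ} (hs : s ∈ O) (hn : n ∈ O) (h : β ^ 2 = s * β - n) : β ∈ O := by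
  rcases O.mem_or_inv_mem β with h1 | h1
  · exact h1
  · rcases eq_or_ne β 0 with rfl | h0
    · exact O.zero_mem
    · have : β = s - n * β⁻¹ := by
        field_simp
        linear_combination h
      rw [this]
      exact O.sub_mem hs (O.mul_mem _ _ hn h1)

theorem mem_nonunits_or {x y : ℂ} (h : x * y ∈ O.nonunits) :
    x ∈ O.nonunits ∨ y ∈ O.nonunits := by
  by_contra! hc
  rw [ValuationSubring.mem_nonunits_iff, ValuationSubring.mem_nonunits_iff, not_lt, not_lt] at hc
  rw [ValuationSubring.mem_nonunits_iff, map_mul] at h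
  exact h.not_ge (one_le_mul hc.1 hc.2)

/-- An integral matrix of determinant `p` fixing `τ` has an eigenvalue in the maximal ideal, up to
passing to the adjugate; the other eigenvalue reduces to the trace. -/
theorem exists_multiplier {p : ℕ} (hO : (p : ℂ) ∈ O.nonunits) {τ : ℍ} {A B C D : ℤ}
    (h : A * D - B * C = p) (hfix : (A : ℂ) * τ + B = (C * τ + D) * τ) :
    ∃ (A' B' C' D' : ℤ) (c : O), A' * D' - B' * C' = p ∧
      (A' : ℂ) * τ + B' = (C' * τ + D') * τ ∧ ((C' : ℂ) * τ + D') * (c : ℂ) = p ∧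
      (C' * τ + D' : ℂ) ∈ O.nonunits ∧ residue O c = ((A + D : ℤ) : ResidueField O) := by
  have h' : (A : ℂ) * D - B * C = p := by exact_mod_cast h
  have hmul : ((C : ℂ) * τ + D) * (A - C * τ) = p := by
    linear_combination h' + (C : ℂ) * hfix
  have hpO : (p : ℂ) ∈ O := natCast_mem O p
  have hβ : (C * τ + D : ℂ) ∈ O := by
    refine mem_of_sq_eq (intCast_mem O (A + D)) hpO ?_
    push_cast
    linear_combination -hmul
  have hβ' : (A - C * τ : ℂ) ∈ O := by
    have : (A - C * τ : ℂ) = ((A + D : ℤ) : ℂ) - (C * τ + D) := by push_cast; ring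
    rw [this]
    exact O.sub_mem (intCast_mem O _) hβ
  have hres : ∀ {x y : O}, (x + y : ℂ) = ((A + D : ℤ) : ℂ) → (y : ℂ) ∈ O.nonunits →
      residue O x = ((A + D : ℤ) : ResidueField O) := by
    intro x y hxy hy
    obtain ⟨hy1, hy2⟩ := ValuationSubring.mem_nonunits_iff_exists_mem_maximalIdeal.1 hy
    have h1 : x + y = ((A + D : ℤ) : O) := Subtype.ext (by push_cast; push_cast at hxy; exact hxy)
    rw [← map_intCast (residue O), ← h1, map_add, (residue_eq_zero_iff y).2 hy2, add_zero]
  rcases mem_nonunits_or (by rwa [hmul]) with hn | hn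
  · exact ⟨A, B, C, D, ⟨_, hβ'⟩, h, hfix, hmul, hn,
      hres (y := ⟨_, hβ⟩) (by push_cast; ring) hn⟩
  · refine ⟨D, -B, -C, A, ⟨_, hβ⟩, by linear_combination h, ?_, ?_, ?_,
      hres (y := ⟨_, hβ'⟩) (by push_cast; ring) hn⟩
    · push_cast
      linear_combination -hfix
    · push_cast
      linear_combination hmul
    · convert hn using 1
      push_cast
      ring

/-- The trace of Frobenius of the reduction of a CM curve agrees with the trace of the
corresponding endomorphism up to a root of unity of order dividing `4` or `6`. -/
theorem hasseCoeff_pow_eq (hp3 : 3 < p) (hO : (p : ℂ) ∈ O.nonunits)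
    (ι : ZMod p →+* ResidueField O) {τ : ℍ} {A B C D : ℤ} (h : A * D - B * C = p)
    (hfix : (A : ℂ) * τ + B = (C * τ + D) * τ) {r : O} (hr : (r : ℂ) = kleinJ τ) {a b : ZMod p}
    (hab : 4 * a ^ 3 + 27 * b ^ 2 ≠ 0) (hj : residue O r = ι (jInv a b)) :
    (a ≠ 0 → hasseCoeff p a b ^ 4 = ((A + D : ℤ) : ZMod p) ^ 4) ∧
      (b ≠ 0 → hasseCoeff p a b ^ 6 = ((A + D : ℤ) : ZMod p) ^ 6) := by
  have hcop : ∀ {k l : ℕ}, ((2 ^ k * 3 ^ l : ℕ) : ZMod p) ≠ 0 := by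
    intro k l h0
    have h1 := (ZMod.natCast_eq_zero_iff _ p).1 h0
    have h2 := coprime_of_three_lt (p := p) hp3 (a := k) (b := l)
    exact (Fact.out : p.Prime).one_lt.ne' (Nat.dvd_one.1 (h2 ▸ Nat.dvd_gcd h1 dvd_rfl))
  have h48 : (48 : ZMod p) ≠ 0 := by simpa using hcop (k := 4) (l := 1)
  have h864 : (864 : ZMod p) ≠ 0 := by simpa using hcop (k := 5) (l := 3)
  have h1728 : (1728 : ZMod p) ≠ 0 := by simpa using hcop (k := 6) (l := 3)
  have h16 : (27648 : ZMod p) ≠ 0 := by simpa using hcop (k := 10) (l := 3)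
  have hι := ι.injective
  obtain ⟨A', B', C', D', c, h1, h2, h3, h4, h5⟩ := exists_multiplier hO h hfix
  set u : ResidueField O := ι (-48 * a) with hu
  set v : ResidueField O := ι (864 * b) with hv
  have hδ' : u ^ 3 - v ^ 2 = ι (-27648 * (4 * a ^ 3 + 27 * b ^ 2)) := by
    rw [hu, hv, ← map_pow, ← map_pow, ← map_sub]
    congr 1
    ring
  have hδ : u ^ 3 - v ^ 2 ≠ 0 := by
    rw [hδ']
    exact (map_ne_zero ι).2 (mul_ne_zero (neg_ne_zero.2 h16) hab)
  have hr' : residue O r * (u ^ 3 - v ^ 2) = 1728 * u ^ 3 := by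
    rw [hj, hδ', hu, ← map_pow, ← map_mul, ← map_ofNat ι 1728, ← map_mul]
    congr 1
    rw [jInv]
    field_simp
    ring
  have hA : hasseCoeff p (-1 / 48 * u) (1 / 864 * v) = ι (hasseCoeff p a b) := by
    rw [map_hasseCoeff]
    congr 1
    · rw [hu, ← map_ofNat ι 48, ← map_one ι, ← map_neg, ← map_div₀, ← map_mul]
      congr 1
      field_simp
    · rw [hv, ← map_ofNat ι 864, ← map_one ι, ← map_div₀, ← map_mul]
      congr 1
      field_simp
  have hc : residue O c = ι ((A + D : ℤ) : ZMod p) := by rw [h5, map_intCast]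
  have hdisc := discriminant_eq_E₄_cube_sub_E₆_sq τ
  have hdisc0 := discriminant_ne_zero τ
  constructor
  · intro ha
    have hu0 : u ≠ 0 := (map_ne_zero ι).2 (mul_ne_zero (neg_ne_zero.2 h48) ha)
    have := hasseCoeff_pow_mul_eq hp3 hO (i := 1) (j := 0) (n := 2) (by norm_num)
      (by simpa using hasWeight_E₄) h1 h2 h3 h4 hr (c₁ := r) hδ hr' (by simpa using hu0)
      (by rw [hr, kleinJ]; norm_num) (by simpa using hr')
    rw [hA, hc] at this
    rw [show 2 * (2 * 1 + 3 * 0) = 4 from rfl, pow_one, pow_zero, mul_one, hu, ← map_pow, ← map_pow,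
      ← map_mul, ← map_mul, ← map_pow, hι.eq_iff, ZMod.pow_card] at this
    exact mul_right_cancel₀ (mul_ne_zero (neg_ne_zero.2 h48) ha) (by simpa using this)
  · intro hb
    have hv0 : v ≠ 0 := (map_ne_zero ι).2 (mul_ne_zero h864 hb)
    have := hasseCoeff_pow_mul_eq hp3 hO (i := 0) (j := 1) (n := 1) (by norm_num)
      (by simpa using hasWeight_E₆) h1 h2 h3 h4 hr (c₁ := r - 1728) hδ hr' (by simpa using hv0)
      (by
        push_cast
        rw [hr]
        have h6 : ((1728 : O) : ℂ) = 1728 := rfl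
        rw [h6]
        simpa using kleinJ_sub τ)
      (by
        rw [map_sub, map_ofNat]
        linear_combination hr')
    rw [hA, hc] at this
    rw [show 2 * (2 * 0 + 3 * 1) = 6 from rfl, pow_one, pow_zero, one_mul, hv, ← map_pow, ← map_pow,
      ← map_mul, ← map_mul, ← map_pow, hι.eq_iff, ZMod.pow_card] at this
    exact mul_right_cancel₀ (mul_ne_zero h864 hb) (by simpa using this)

end TraceCongruence

end

noncomputable section

open UpperHalfPlane ModularForm MatrixGroups IsLocalRing

open scoped Manifold

section ComplexMultiplication

/-- The lattice `ℤτ + ℤ` has an endomorphism of degree `p` and trace `t`. -/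
def IsCM (p : ℕ) (t : ℤ) (τ : ℍ) : Prop :=
  ∃ A B C D : ℤ, A * D - B * C = p ∧ A + D = t ∧ (A : ℂ) * τ + B = (C * τ + D) * τ

variable {p : ℕ} {t : ℤ} {τ : ℍ}

theorem IsCM.sq_lt (h : IsCM p t τ) (hp : p.Prime) : t ^ 2 < 4 * p := by
  obtain ⟨A, B, C, D, h1, rfl, h2⟩ := h
  have h1' : (A : ℂ) * D - B * C = p := by exact_mod_cast h1
  have hτ := τ.im_pos
  have hC : C ≠ 0 := by
    rintro rfl
    have h3 := UpperHalfPlane.int_mul_add_eq_zero' (τ := τ) (m := A - D) (n := B) (by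
      push_cast
      push_cast at h2
      linear_combination h2)
    obtain ⟨h4, h5⟩ := h3
    obtain rfl : A = D := by omega
    have h6 : A.natAbs * A.natAbs = p := by
      zify
      rw [abs_mul_abs_self]
      linarith
    exact hp.prime.not_isSquare ⟨_, h6.symm⟩
  have h3 : (2 * C * (τ : ℂ) + (D - A)) ^ 2 = (((A + D) ^ 2 - 4 * p : ℝ) : ℂ) := by
    push_cast
    linear_combination -4 * (C : ℂ) * h2 - 4 * h1'
  have hre := congrArg Complex.re h3
  have him := congrArg Complex.im h3
  have e1 : (2 * C * (τ : ℂ) + (D - A)).re = 2 * C * τ.re + (D - A) := by simp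
  have e2 : (2 * C * (τ : ℂ) + (D - A)).im = 2 * C * τ.im := by simp
  rw [pow_two, Complex.mul_im, e1, e2, Complex.ofReal_im] at him
  rw [pow_two, Complex.mul_re, e1, e2, Complex.ofReal_re] at hre
  have hy : (2 * C * τ.im : ℝ) ≠ 0 := by
    have : (C : ℝ) ≠ 0 := by exact_mod_cast hC
    positivity
  have hx : (2 * C * τ.re + (D - A) : ℝ) = 0 := by
    have : (2 * C * τ.re + (D - A) : ℝ) * (2 * C * τ.im) = 0 := by linarith
    exact (mul_eq_zero.1 this).resolve_right hy
  rw [hx] at hre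
  have h5 : ((A + D) ^ 2 - 4 * p : ℝ) < 0 := by
    have := mul_self_pos.2 hy
    linarith
  have h6 : (((A + D) ^ 2 : ℤ) : ℝ) < ((4 * p : ℤ) : ℝ) := by
    push_cast
    linarith
  exact_mod_cast h6

variable [Fact p.Prime] {O : ValuationSubring ℂ}

/-- The conclusions of `exists_modularPolynomial`. -/
def IsModularPolynomial (p : ℕ) [Fact p.Prime] {O : ValuationSubring ℂ} (W : Polynomial O) : Prop :=
  W.natDegree ≤ 2 * p ∧ W.coeff (2 * p) = -1 ∧
    (∀ τ, ∏ x, (kleinJ τ - heckeFun p 0 kleinJ x τ) = W.eval₂ O.subtype (kleinJ τ)) ∧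
    W.map (residue O) = -(Polynomial.X ^ p - Polynomial.X) ^ 2

theorem exists_heckeFun_eq {A B C D : ℤ} (h : A * D - B * C = p)
    (hfix : (A : ℂ) * τ + B = (C * τ + D) * τ) {x : Option (ZMod p)} (hx : Kills p x A B C D) :
    heckeFun p 0 kleinJ x τ = kleinJ τ := by
  have hmul : ((C : ℂ) * τ + D) * (A - C * τ) = p := by
    have h' : (A : ℂ) * D - B * C = p := by exact_mod_cast h
    linear_combination h' + (C : ℂ) * hfix
  simpa using heckeFun_of_fixed hasWeight_kleinJ h hx hfix rfl hmul

theorem exists_isCM_of_heckeFun_eq {x : Option (ZMod p)} (hx : heckeFun p 0 kleinJ x τ = kleinJ τ) :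
    ∃ t, IsCM p t τ := by
  have hp := (Fact.out : p.Prime).ne_zero
  have hp0 : (p : ℂ) ≠ 0 := by exact_mod_cast hp
  have key : ∀ {τ' : ℍ}, kleinJ τ' = kleinJ τ → ∃ a b c d : ℤ, a * d - b * c = 1 ∧
      (a : ℂ) * τ' + b = (c * τ' + d) * τ := by
    intro τ' h
    obtain ⟨γ, hγ⟩ := kleinJ_eq_iff.1 h.symm
    refine ⟨γ 0 0, γ 0 1, γ 1 0, γ 1 1, ?_, ?_⟩
    · have := γ.2
      rw [Matrix.det_fin_two] at this
      exact this
    · rw [← hγ, coe_SL_smul, mul_div_cancel₀ _ (denom_SL_ne_zero γ τ')]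
  rcases x with _ | b
  · rw [heckeFun, pow_zero, one_mul] at hx
    obtain ⟨a, b, c, d, h1, h2⟩ := key hx
    rw [ofComplex_apply_of_im_pos (im_natCast_mul_pos hp τ)] at h2
    refine ⟨_, a * p, b, c * p, d, by linear_combination (p : ℤ) * h1, rfl, ?_⟩
    push_cast
    linear_combination h2
  · rw [heckeFun] at hx
    obtain ⟨a, e, c, d, h1, h2⟩ := key hx
    rw [ofComplex_apply_of_im_pos (im_add_div_pos hp b.val τ)] at h2
    refine ⟨_, a, a * b.val + e * p, c, c * b.val + d * p, by linear_combination (p : ℤ) * h1,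
      rfl, ?_⟩
    change (a : ℂ) * ((τ + b.val) / p) + e = (c * ((τ + b.val) / p) + d) * τ at h2
    field_simp at h2
    push_cast
    linear_combination h2

theorem IsModularPolynomial.eval_eq_zero {W : Polynomial O} (hW : IsModularPolynomial p W)
    (h : IsCM p t τ) : W.eval₂ O.subtype (kleinJ τ) = 0 := by
  obtain ⟨A, B, C, D, h1, -, h2⟩ := h
  obtain ⟨x, hx⟩ := exists_kills h1
  rw [← hW.2.2.1, Finset.prod_eq_zero (Finset.mem_univ x)]
  rw [exists_heckeFun_eq h1 h2 hx, sub_self]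

theorem IsModularPolynomial.exists_isCM {W : Polynomial O} (hW : IsModularPolynomial p W)
    (h : W.eval₂ O.subtype (kleinJ τ) = 0) : ∃ t, IsCM p t τ := by
  rw [← hW.2.2.1, Finset.prod_eq_zero_iff] at h
  obtain ⟨x, -, hx⟩ := h
  exact exists_isCM_of_heckeFun_eq (sub_eq_zero.1 hx).symm

theorem IsModularPolynomial.monic {W : Polynomial O} (hW : IsModularPolynomial p W) :
    (-W).Monic := by
  apply Polynomial.monic_of_natDegree_le_of_coeff_eq_one (2 * p)
  · rw [Polynomial.natDegree_neg]
    exact hW.1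
  · rw [Polynomial.coeff_neg, hW.2.1, neg_neg]

theorem IsModularPolynomial.mem {W : Polynomial O} (hW : IsModularPolynomial p W) {z : ℂ}
    (h : W.eval₂ O.subtype z = 0) : z ∈ O :=
  mem_of_aeval_monic hW.monic (by rw [Polynomial.eval₂_neg, h, neg_zero])

theorem IsModularPolynomial.eval_residue {W : Polynomial O} (hW : IsModularPolynomial p W) {r : O}
    (h : W.eval₂ O.subtype r = 0) : residue O r ^ p = residue O r := by
  have h1 : W.eval r = 0 := by
    apply O.subtype_injective
    rw [map_zero, ← h]
    exact (Polynomial.eval₂_at_apply O.subtype r).symm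
  have h2 : (W.map (residue O)).eval (residue O r) = 0 := by
    rw [Polynomial.eval_map, Polynomial.eval₂_at_apply, h1, map_zero]
  rw [hW.2.2.2] at h2
  simpa [sub_eq_zero] using h2

/-- Every residue fixed by Frobenius lifts to a root of the modular polynomial. -/
theorem IsModularPolynomial.exists_root {W : Polynomial O} (hW : IsModularPolynomial p W)
    {z : ResidueField O} (hz : z ^ p = z) :
    ∃ r : O, W.eval₂ O.subtype r = 0 ∧ residue O r = z := by
  have hs := (IsAlgClosed.splits ((-W).map O.subtype)).eq_prod_roots_of_monic
    (hW.monic.map O.subtype)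
  have hmem : ∀ r ∈ ((-W).map O.subtype).roots, r ∈ O := by
    intro r hr
    have := (Polynomial.mem_roots'.1 hr).2
    rw [Polynomial.IsRoot, Polynomial.eval_map] at this
    exact mem_of_aeval_monic hW.monic this
  have hroot : ∀ r ∈ ((-W).map O.subtype).roots, W.eval₂ O.subtype r = 0 := by
    intro r hr
    have := (Polynomial.mem_roots'.1 hr).2
    rwa [Polynomial.IsRoot, Polynomial.eval_map, Polynomial.eval₂_neg, neg_eq_zero] at this
  obtain ⟨S, hS⟩ : ∃ S : Multiset O, S.map O.subtype = ((-W).map O.subtype).roots :=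
    ⟨((-W).map O.subtype).roots.pmap Subtype.mk hmem, by
      rw [Multiset.map_pmap]
      exact Multiset.pmap_eq_map _ _ _ _ |>.trans (Multiset.map_id _)⟩
  have hV : -W = (S.map fun r => Polynomial.X - Polynomial.C r).prod := by
    apply Polynomial.map_injective _ O.subtype_injective
    rw [hs, ← hS, Polynomial.map_multiset_prod, Multiset.map_map, Multiset.map_map]
    simp
  have h1 := congrArg (fun P => (P.map (residue O)).eval z) hV
  simp only [Polynomial.map_neg, hW.2.2.2, Polynomial.map_multiset_prod, Multiset.map_map,
    Polynomial.eval_multiset_prod] at h1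
  rw [neg_neg, Polynomial.eval_pow, Polynomial.eval_sub, Polynomial.eval_pow, Polynomial.eval_X, hz,
    sub_self, zero_pow two_ne_zero, eq_comm, Multiset.prod_eq_zero_iff, Multiset.mem_map] at h1
  obtain ⟨r, hr, hr'⟩ := h1
  refine ⟨r, hroot r (hS ▸ Multiset.mem_map_of_mem _ hr), ?_⟩
  simp [sub_eq_zero] at hr'
  exact hr'.symm

/-- A CM point with two different primes above `p` gives a double root of the modular
polynomial. -/
theorem IsModularPolynomial.derivative_eval {W : Polynomial O} (hW : IsModularPolynomial p W)
    (h : IsCM p t τ) (ht : ¬ (p : ℤ) ∣ t) (h0 : kleinJ τ ≠ 0) (h1728 : kleinJ τ ≠ 1728) :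
    W.derivative.eval₂ O.subtype (kleinJ τ) = 0 := by
  obtain ⟨A, B, C, D, h1, rfl, h2⟩ := h
  obtain ⟨x, hx⟩ := exists_kills h1
  have h1' : D * A - -B * -C = p := by linear_combination h1
  have h2' : (D : ℂ) * τ + (-B : ℤ) = ((-C : ℤ) * τ + A) * τ := by
    push_cast
    linear_combination -h2
  obtain ⟨y, hy⟩ := exists_kills h1'
  have hxy : x ≠ y := by
    rintro rfl
    apply ht
    rw [← ZMod.intCast_zmod_eq_zero_iff_dvd]
    rcases x with _ | b
    · simp only [Kills] at hx hy
      push_cast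
      rw [hx.1, hy.1, add_zero]
    · simp only [Kills] at hx hy
      push_cast at hy ⊢
      rw [hy.2, hx.2]
      ring
  have e1 := exists_heckeFun_eq h1 h2 hx
  have e2 := exists_heckeFun_eq h1' h2' hy
  have hτ : (τ : ℂ) ∈ {z : ℂ | 0 < z.im} := τ.im_pos
  have hopen : IsOpen {z : ℂ | 0 < z.im} := isOpen_lt continuous_const Complex.continuous_im
  have hd : ∀ x, DifferentiableAt ℂ ((fun τ => kleinJ τ - heckeFun p 0 kleinJ x τ) ∘ ofComplex) τ :=
    fun x => (UpperHalfPlane.mdifferentiable_iff.1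
      (mdifferentiable_kleinJ.sub (mdifferentiable_heckeFun mdifferentiable_kleinJ x))
      (τ : ℂ) hτ).differentiableAt (hopen.mem_nhds hτ)
  have hj : DifferentiableAt ℂ (kleinJ ∘ ofComplex) τ :=
    (UpperHalfPlane.mdifferentiable_iff.1 mdifferentiable_kleinJ
      (τ : ℂ) hτ).differentiableAt (hopen.mem_nhds hτ)
  have hfun : (fun z : ℂ => (W.map O.subtype).eval ((kleinJ ∘ ofComplex) z)) =
      fun z => ((fun τ => kleinJ τ - heckeFun p 0 kleinJ x τ) ∘ ofComplex) z *
        (((fun τ => kleinJ τ - heckeFun p 0 kleinJ y τ) ∘ ofComplex) z *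
        ∏ w ∈ (Finset.univ.erase x).erase y,
          ((fun τ => kleinJ τ - heckeFun p 0 kleinJ w τ) ∘ ofComplex) z) := by
    funext z
    rw [Polynomial.eval_map]
    simp only [Function.comp_apply]
    rw [← hW.2.2.1, Finset.mul_prod_erase (Finset.univ.erase x)
      (fun w => kleinJ (ofComplex z) - heckeFun p 0 kleinJ w (ofComplex z))
      (Finset.mem_erase.2 ⟨hxy.symm, Finset.mem_univ y⟩),
      Finset.mul_prod_erase Finset.univ
      (fun w => kleinJ (ofComplex z) - heckeFun p 0 kleinJ w (ofComplex z)) (Finset.mem_univ x)]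
  have hD1 : HasDerivAt (fun z : ℂ => (W.map O.subtype).eval ((kleinJ ∘ ofComplex) z))
      ((W.map O.subtype).derivative.eval (kleinJ τ) * deriv (kleinJ ∘ ofComplex) τ) τ := by
    have := ((W.map O.subtype).hasDerivAt ((kleinJ ∘ ofComplex) (τ : ℂ))).comp (τ : ℂ) hj.hasDerivAt
    rwa [Function.comp_apply, ofComplex_apply] at this
  have hD2 : HasDerivAt (fun z : ℂ => (W.map O.subtype).eval ((kleinJ ∘ ofComplex) z)) 0 τ := by
    rw [hfun]
    have hG : DifferentiableAt ℂ (fun z : ℂ => ∏ w ∈ (Finset.univ.erase x).erase y,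
          ((fun τ => kleinJ τ - heckeFun p 0 kleinJ w τ) ∘ ofComplex) z) τ :=
      DifferentiableAt.fun_finsetProd fun w _ => hd w
    have := (hd x).hasDerivAt.fun_mul ((hd y).hasDerivAt.fun_mul hG.hasDerivAt)
    refine this.congr_deriv ?_
    simp [ofComplex_apply, e1, e2]
  have h3 := hD1.unique hD2
  have hE4 : E₄ τ ≠ 0 := by
    intro h
    apply h0
    rw [kleinJ, h]
    simp
  have hE6 : E₆ τ ≠ 0 := by
    intro h
    apply h1728
    rw [← sub_eq_zero, kleinJ_sub, h]
    simp
  have h4 := (mul_eq_zero.1 h3).resolve_right (deriv_kleinJ_ne_zero hE4 hE6)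
  rwa [Polynomial.derivative_map, Polynomial.eval_map] at h4

/-- The reduction of a double root of the modular polynomial is not the reduction of another
root. -/
theorem IsModularPolynomial.eq_of_residue_eq (hO : (p : ℂ) ∈ O.nonunits) {W : Polynomial O}
    (hW : IsModularPolynomial p W) {r s : O} (hr : W.eval₂ O.subtype r = 0)
    (hr' : W.derivative.eval₂ O.subtype r = 0) (hs : W.eval₂ O.subtype s = 0)
    (h : residue O r = residue O s) : r = s := by
  have hchar := charP_residueField (Fact.out : p.Prime) hO
  by_contra hne
  have key : ∀ (V : Polynomial O) (x : O), V.eval₂ O.subtype x = 0 → V.eval x = 0 := by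
    intro V x hx
    apply O.subtype_injective
    rw [map_zero, ← hx]
    exact (Polynomial.eval₂_at_apply O.subtype x).symm
  obtain ⟨W₁, rfl⟩ := Polynomial.dvd_iff_isRoot.2 (key _ _ hr)
  have h1 : W₁.eval r = 0 := by simpa using key _ _ hr'
  obtain ⟨W₂, rfl⟩ := Polynomial.dvd_iff_isRoot.2 h1
  have h2 : W₂.eval s = 0 := by
    have := key _ _ hs
    simp only [Polynomial.eval_mul, Polynomial.eval_sub, Polynomial.eval_X, Polynomial.eval_C,
      mul_eq_zero, sub_eq_zero] at this
    tauto
  obtain ⟨W₃, rfl⟩ := Polynomial.dvd_iff_isRoot.2 h2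
  have h3 := hW.2.2.2
  set z := residue O s with hz
  simp only [Polynomial.map_mul, Polynomial.map_sub, Polynomial.map_X, Polynomial.map_C, h,
    ← hz] at h3
  set f : Polynomial (ResidueField O) := Polynomial.X ^ p - Polynomial.X with hf
  have hfz : f.eval z = 0 := by
    have := congrArg (Polynomial.eval z) h3
    simpa using this.symm
  obtain ⟨g, hg⟩ := Polynomial.dvd_iff_isRoot.2 hfz
  have hgz : g.eval z = -1 := by
    have := congrArg (fun P => (Polynomial.derivative P).eval z) hg
    simpa [hf, CharP.cast_eq_zero, Polynomial.derivative_X_pow] using this.symm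
  have hX := Polynomial.X_sub_C_ne_zero z
  rw [hg] at h3
  have h4 : (Polynomial.X - Polynomial.C z) * W₃.map (residue O) = -g ^ 2 := by
    apply mul_left_cancel₀ hX
    apply mul_left_cancel₀ hX
    linear_combination h3
  have := congrArg (Polynomial.eval z) h4
  simp [hgz] at this

end ComplexMultiplication

end

noncomputable section

open UpperHalfPlane ModularForm MatrixGroups

section ClassGroup

/-- The values of `j` at the points with complex multiplication of norm `p` and trace `t`. -/
def cmSet (p : ℕ) (t : ℤ) : Set ℂ := {z | ∃ τ, IsCM p t τ ∧ kleinJ τ = z}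

theorem IsCM.neg {p : ℕ} {t : ℤ} {τ : ℍ} (h : IsCM p t τ) : IsCM p (-t) τ := by
  obtain ⟨A, B, C, D, h1, rfl, h2⟩ := h
  refine ⟨-A, -B, -C, -D, by linarith, by ring, ?_⟩
  push_cast
  linear_combination -h2

theorem IsCM.coeff_ne_zero {p : ℕ} (hp : p.Prime) {τ : ℍ} {A B C D : ℤ} (h1 : A * D - B * C = p)
    (h2 : (A : ℂ) * τ + B = (C * τ + D) * τ) : C ≠ 0 := by
  rintro rfl
  obtain ⟨h4, -⟩ := UpperHalfPlane.int_mul_add_eq_zero' (τ := τ) (m := A - D) (n := B) (by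
    push_cast
    push_cast at h2
    linear_combination h2)
  obtain rfl : A = D := by omega
  refine hp.prime.not_isSquare ⟨A.natAbs, ?_⟩
  zify
  rw [abs_mul_abs_self]
  linarith

variable {R : Type*} [CommRing R]

/-- The ideal `I` is, up to a scalar, the lattice `ℤτ + ℤ`. -/
def IsPeriod (s : R →+* ℂ) (I : Ideal R) (τ : ℍ) : Prop :=
  ∃ x y : R, y ≠ 0 ∧ (∀ w, w ∈ I ↔ ∃ m n : ℤ, w = m * x + n * y) ∧ s x = τ * s y

variable {s : R →+* ℂ} {ω : R} {p : ℕ} {t : ℤ}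

theorem exists_isPeriod [IsDomain R] (hs : Function.Injective s) (him : 0 < (s ω).im)
    (hspan : ∀ w : R, ∃ m n : ℤ, w = m + n * ω) {I : Ideal R} (hI : I ≠ ⊥) :
    ∃ τ, IsPeriod s I τ := by
  have hli : LinearIndependent ℤ ![(1 : R), ω] := by
    rw [LinearIndependent.pair_iff]
    intro m n h
    have h1 := congrArg s h
    have h2 := congrArg Complex.im h1
    simp only [zsmul_eq_mul, mul_one, map_add, map_mul, map_intCast, map_zero, Complex.add_im,
      Complex.intCast_im, Complex.mul_im, Complex.intCast_re, zero_mul, zero_add, add_zero,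
      Complex.zero_im, mul_eq_zero, Int.cast_eq_zero, him.ne', or_false] at h2
    subst h2
    simp only [zsmul_eq_mul, mul_one, map_intCast, Int.cast_zero, zero_mul, add_zero,
      map_zero, Int.cast_eq_zero] at h1
    exact ⟨h1, rfl⟩
  have hsp : ⊤ ≤ Submodule.span ℤ (Set.range ![(1 : R), ω]) := by
    intro w _
    obtain ⟨m, n, rfl⟩ := hspan w
    simp only [Matrix.range_cons, Matrix.range_empty, Set.union_empty, Set.singleton_union]
    rw [Submodule.mem_span_pair]
    exact ⟨m, n, by simp⟩
  let b := Ideal.selfBasis (Module.Basis.mk hli hsp) I hI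
  obtain ⟨x, hx⟩ : ∃ x : R, (b 0 : R) = x := ⟨_, rfl⟩
  obtain ⟨y, hy⟩ : ∃ y : R, (b 1 : R) = y := ⟨_, rfl⟩
  have hmem : ∀ w, w ∈ I ↔ ∃ m n : ℤ, w = m * x + n * y := by
    intro w
    constructor
    · intro hw
      have h := congrArg (Subtype.val) (b.sum_repr ⟨w, hw⟩)
      rw [Fin.sum_univ_two] at h
      exact ⟨_, _, by simpa [hx, hy] using h.symm⟩
    · rintro ⟨m, n, rfl⟩
      exact I.add_mem (I.mul_mem_left _ (hx ▸ (b 0).2)) (I.mul_mem_left _ (hy ▸ (b 1).2))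
  have hy0 : y ≠ 0 := by
    rw [← hy]
    have := b.ne_zero 1
    simpa using this
  have hsy : s y ≠ 0 := by
    rwa [map_ne_zero_iff s hs]
  have hyI : y ∈ I := (hmem y).2 ⟨0, 1, by simp⟩
  obtain ⟨m, n, hmn⟩ := (hmem (ω * y)).1 (I.mul_mem_left _ hyI)
  have h3 : s ω = m * (s x / s y) + n := by
    have := congrArg s hmn
    simp only [map_mul, map_add, map_intCast] at this
    field_simp
    linear_combination this
  have h4 : (s x / s y).im ≠ 0 := by
    intro h
    have := congrArg Complex.im h3
    simp [h] at this
    exact him.ne' this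
  rcases lt_or_gt_of_ne h4 with h | h
  · refine ⟨⟨-(s x / s y), by simpa using h⟩, -x, y, hy0, fun w => ?_, ?_⟩
    · rw [hmem]
      constructor
      · rintro ⟨m, n, rfl⟩
        exact ⟨-m, n, by push_cast; ring⟩
      · rintro ⟨m, n, rfl⟩
        exact ⟨-m, n, by push_cast; ring⟩
    · rw [map_neg]
      change -s x = -(s x / s y) * s y
      field_simp
  · refine ⟨⟨s x / s y, h⟩, x, y, hy0, hmem, ?_⟩
    change s x = (s x / s y) * s y
    field_simp

theorem IsPeriod.isCM (hs : Function.Injective s) (him : 0 < (s ω).im)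
    (hω : ω ^ 2 = t * ω - p) {I : Ideal R} {τ : ℍ} (h : IsPeriod s I τ) : IsCM p t τ := by
  obtain ⟨x, y, hy, hmem, hxy⟩ := h
  have hsy : s y ≠ 0 := by rwa [map_ne_zero_iff s hs]
  obtain ⟨A, B, h1⟩ := (hmem (ω * x)).1 (I.mul_mem_left _ ((hmem x).2 ⟨1, 0, by simp⟩))
  obtain ⟨C, D, h2⟩ := (hmem (ω * y)).1 (I.mul_mem_left _ ((hmem y).2 ⟨0, 1, by simp⟩))
  replace h1 := congrArg s h1
  replace h2 := congrArg s h2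
  replace hω := congrArg s hω
  simp only [map_mul, map_add, map_intCast, map_sub, map_pow, map_natCast] at h1 h2 hω
  rw [hxy] at h1 h2
  replace h1 : s ω * τ = A * τ + B := mul_right_cancel₀ hsy (by linear_combination h1)
  replace h2 : s ω = C * τ + D := mul_right_cancel₀ hsy (by linear_combination h2)
  have h3 : ((t - (A + D) : ℝ) : ℂ) * s ω = ((p - (A * D - B * C) : ℝ) : ℂ) := by
    push_cast
    linear_combination -hω + C * h1 + (s ω - A) * h2
  have h4 := congrArg Complex.im h3
  rw [Complex.im_ofReal_mul, Complex.ofReal_im] at h4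
  have h5 := (mul_eq_zero.1 h4).resolve_right him.ne'
  rw [h5] at h3
  rw [Complex.ofReal_zero, zero_mul] at h3
  have h6 : (p - (A * D - B * C) : ℝ) = 0 := by exact_mod_cast h3.symm
  refine ⟨A, B, C, D, ?_, ?_, ?_⟩
  · have : ((A * D - B * C : ℤ) : ℝ) = ((p : ℤ) : ℝ) := by
      push_cast
      linarith
    exact_mod_cast this
  · have : ((A + D : ℤ) : ℝ) = (t : ℝ) := by
      push_cast
      linarith
    exact_mod_cast this
  · rw [← h2, h1]

theorem IsCM.exists_isPeriod [IsDomain R] (hp : p.Prime)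
    (him : 0 < (s ω).im) (hω : ω ^ 2 = t * ω - p) (hspan : ∀ w : R, ∃ m n : ℤ, w = m + n * ω)
    {τ : ℍ} (h : IsCM p t τ) : ∃ I : Ideal R, I ≠ ⊥ ∧ IsPeriod s I τ := by
  have h0 : ∃ A B C D : ℤ, A * D - B * C = p ∧ A + D = t ∧
      (A : ℂ) * τ + B = (C * τ + D) * τ ∧ 0 < C := by
    obtain ⟨A, B, C, D, h1, h2, h3⟩ := h
    rcases lt_or_gt_of_ne (IsCM.coeff_ne_zero hp h1 h3) with h4 | h4
    · refine ⟨D, -B, -C, A, by linarith, by linarith, ?_, by linarith⟩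
      push_cast
      linear_combination -h3
    · exact ⟨A, B, C, D, h1, h2, h3, h4⟩
  obtain ⟨A, B, C, D, h1, h2, h3, hC⟩ := h0
  have hωR : ω ^ 2 = t * ω - p := hω
  have h1' : (A : ℂ) * D - B * C = p := by exact_mod_cast h1
  have h2' : (A : ℂ) + D = t := by exact_mod_cast h2
  replace hω := congrArg s hω
  simp only [map_mul, map_intCast, map_sub, map_pow, map_natCast] at hω
  have h4 : (C * (τ : ℂ) + D - s ω) * (C * (τ : ℂ) + D - (t - s ω)) = 0 := by
    rw [← h2'] at hω ⊢
    linear_combination -hω - C * h3 - h1'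
  have h5 : C * (τ : ℂ) + D = s ω := by
    rcases mul_eq_zero.1 h4 with h | h
    · exact sub_eq_zero.1 h
    · have h6 := congrArg Complex.im h
      simp at h6
      have h7 : (0 : ℝ) < C * τ.im := mul_pos (by exact_mod_cast hC) τ.im_pos
      linarith
  have h1R : (A : R) * D - B * C = p := by exact_mod_cast congrArg (Int.cast : ℤ → R) h1
  have h2R : (A : R) + D = t := by exact_mod_cast congrArg (Int.cast : ℤ → R) h2
  have hCs : (C : R) ≠ 0 := by
    intro h
    have := congrArg s h
    rw [map_intCast, map_zero] at this
    exact hC.ne' (by exact_mod_cast this)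
  let I : Ideal R :=
    { carrier := {w | ∃ m n : ℤ, w = m * (ω - D) + n * C}
      zero_mem' := ⟨0, 0, by simp⟩
      add_mem' := by
        rintro _ _ ⟨m, n, rfl⟩ ⟨m', n', rfl⟩
        exact ⟨m + m', n + n', by push_cast; ring⟩
      smul_mem' := by
        rintro c _ ⟨m, n, rfl⟩
        obtain ⟨k, l, rfl⟩ := hspan c
        refine ⟨k * m + l * (m * A + n * C), k * n + l * (m * B + n * D), ?_⟩
        rw [smul_eq_mul]
        push_cast
        linear_combination (l * m : R) * hωR - (l * m : R) * ω * h2R + (l * m : R) * h1R }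
  have hmem : ∀ w, w ∈ I ↔ ∃ m n : ℤ, w = m * (ω - D) + n * C := fun w => Iff.rfl
  refine ⟨I, ?_, ω - D, C, hCs, hmem, ?_⟩
  · intro h
    have : (C : R) ∈ I := (hmem _).2 ⟨0, 1, by simp⟩
    rw [h, Ideal.mem_bot] at this
    exact hCs this
  · rw [map_sub, map_intCast, map_intCast, ← h5]
    ring

theorem IsPeriod.mk0_eq_mk0_iff [IsDedekindDomain R] (hs : Function.Injective s)
    {I J : nonZeroDivisors (Ideal R)} {τ τ' : ℍ} (hI : IsPeriod s I τ) (hJ : IsPeriod s J τ') :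
    ClassGroup.mk0 I = ClassGroup.mk0 J ↔ kleinJ τ = kleinJ τ' := by
  obtain ⟨x, y, hy, hI, hxy⟩ := hI
  obtain ⟨x', y', hy', hJ, hxy'⟩ := hJ
  have hsy : s y ≠ 0 := by rwa [map_ne_zero_iff s hs]
  have hsy' : s y' ≠ 0 := by rwa [map_ne_zero_iff s hs]
  rw [ClassGroup.mk0_eq_mk0_iff, kleinJ_eq_iff]
  constructor
  · rintro ⟨g, h, hg, hh, hgh⟩
    have hsg : s g ≠ 0 := by rwa [map_ne_zero_iff s hs]
    have hsh : s h ≠ 0 := by rwa [map_ne_zero_iff s hs]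
    have key : ∀ z ∈ (I : Ideal R), ∃ a b : ℤ, h * (a * x' + b * y') = g * z := by
      intro z hz
      have h1 : g * z ∈ Ideal.span {g} * (I : Ideal R) :=
        Ideal.mem_span_singleton_mul.2 ⟨z, hz, rfl⟩
      rw [hgh, Ideal.mem_span_singleton_mul] at h1
      obtain ⟨w, hw, h1⟩ := h1
      obtain ⟨a, b, rfl⟩ := (hJ w).1 hw
      exact ⟨a, b, h1⟩
    have key' : ∀ z ∈ (J : Ideal R), ∃ a b : ℤ, g * (a * x + b * y) = h * z := by
      intro z hz
      have h1 : h * z ∈ Ideal.span {h} * (J : Ideal R) :=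
        Ideal.mem_span_singleton_mul.2 ⟨z, hz, rfl⟩
      rw [← hgh, Ideal.mem_span_singleton_mul] at h1
      obtain ⟨w, hw, h1⟩ := h1
      obtain ⟨a, b, rfl⟩ := (hI w).1 hw
      exact ⟨a, b, h1⟩
    obtain ⟨a, b, e1⟩ := key x ((hI x).2 ⟨1, 0, by simp⟩)
    obtain ⟨c, d, e2⟩ := key y ((hI y).2 ⟨0, 1, by simp⟩)
    obtain ⟨a', b', e3⟩ := key' x' ((hJ x').2 ⟨1, 0, by simp⟩)
    obtain ⟨c', d', e4⟩ := key' y' ((hJ y').2 ⟨0, 1, by simp⟩)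
    replace e1 := congrArg s e1
    replace e2 := congrArg s e2
    replace e3 := congrArg s e3
    replace e4 := congrArg s e4
    simp only [map_mul, map_add, map_intCast, hxy, hxy'] at e1 e2 e3 e4
    refine exists_SL_smul_eq (l := s g * s y / (s h * s y')) (a := a) (b := b) (c := c) (d := d)
      (a' := a') (b' := b') (c' := c') (d' := d') ?_ ?_ ?_ ?_
    · field_simp
      linear_combination -e1
    · field_simp
      linear_combination -e2
    · field_simp
      linear_combination -e3
    · field_simp
      linear_combination -e4
  · rintro ⟨γ, hγ⟩
    obtain ⟨a, ha⟩ : ∃ a, γ 0 0 = a := ⟨_, rfl⟩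
    obtain ⟨b, hb⟩ : ∃ b, γ 0 1 = b := ⟨_, rfl⟩
    obtain ⟨c, hc⟩ : ∃ c, γ 1 0 = c := ⟨_, rfl⟩
    obtain ⟨d, hd⟩ : ∃ d, γ 1 1 = d := ⟨_, rfl⟩
    have hdet : a * d - b * c = 1 := by
      rw [← ha, ← hb, ← hc, ← hd, ← Matrix.det_fin_two]
      exact γ.2
    have h1 := coe_SL_smul γ τ'
    rw [hγ, ha, hb, hc, hd] at h1
    have hne : (c : ℂ) * τ' + d ≠ 0 := by
      intro h
      obtain ⟨rfl, rfl⟩ := UpperHalfPlane.int_mul_add_eq_zero' h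
      simp at hdet
    rw [eq_div_iff hne] at h1
    have hdetR : (a : R) * d - b * c = 1 := by exact_mod_cast congrArg (Int.cast : ℤ → R) hdet
    have e1 : (c * x' + d * y') * x = y * (a * x' + b * y') := by
      apply hs
      simp only [map_mul, map_add, map_intCast, hxy, hxy']
      linear_combination s y * s y' * h1
    refine ⟨c * x' + d * y', y, ?_, hy, le_antisymm ?_ ?_⟩
    · intro h
      have h2 := congrArg s h
      simp only [map_mul, map_add, map_intCast, hxy', map_zero] at h2
      have h3 : ((c : ℂ) * τ' + d) * s y' = 0 := by linear_combination h2
      exact (mul_ne_zero hne hsy') h3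
    · intro w hw
      obtain ⟨z, hz, rfl⟩ := Ideal.mem_span_singleton_mul.1 hw
      obtain ⟨m, n, rfl⟩ := (hI z).1 hz
      refine Ideal.mem_span_singleton_mul.2 ⟨_, (hJ _).2 ⟨m * a + n * c, m * b + n * d, rfl⟩, ?_⟩
      push_cast
      linear_combination -(m : R) * e1
    · intro w hw
      obtain ⟨z, hz, rfl⟩ := Ideal.mem_span_singleton_mul.1 hw
      obtain ⟨m, n, rfl⟩ := (hJ z).1 hz
      refine Ideal.mem_span_singleton_mul.2
        ⟨_, (hI _).2 ⟨m * d - n * c, -m * b + n * a, rfl⟩, ?_⟩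
      push_cast
      linear_combination (m * d - n * c : R) * e1 + (m * x' + n * y') * y * hdetR

theorem card_classGroup_eq_ncard_cmSet [IsDedekindDomain R] (hp : p.Prime)
    (hs : Function.Injective s) (him : 0 < (s ω).im) (hω : ω ^ 2 = t * ω - p)
    (hspan : ∀ w : R, ∃ m n : ℤ, w = m + n * ω) :
    Nat.card (ClassGroup R) = (cmSet p t).ncard := by
  have h1 : ∀ c : ClassGroup R, ∃ I : nonZeroDivisors (Ideal R), ∃ τ,
      ClassGroup.mk0 I = c ∧ IsPeriod s I τ := by
    intro c
    obtain ⟨I, rfl⟩ := ClassGroup.mk0_surjective c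
    obtain ⟨τ, hτ⟩ := _root_.exists_isPeriod hs him hspan (nonZeroDivisors.ne_zero I.2)
    exact ⟨I, τ, rfl, hτ⟩
  choose I τ hI hτ using h1
  have hinj : Function.Injective fun c => kleinJ (τ c) := by
    intro c c' h
    rw [← hI c, ← hI c', (hτ c).mk0_eq_mk0_iff hs (hτ c')]
    exact h
  have hrange : Set.range (fun c => kleinJ (τ c)) = cmSet p t := by
    ext z
    constructor
    · rintro ⟨c, rfl⟩
      exact ⟨τ c, (hτ c).isCM hs him hω, rfl⟩
    · rintro ⟨σ, hσ, rfl⟩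
      obtain ⟨J, hJ, hJσ⟩ := hσ.exists_isPeriod hp him hω hspan
      refine ⟨ClassGroup.mk0 ⟨J, mem_nonZeroDivisors_of_ne_zero hJ⟩, ?_⟩
      exact ((hτ _).mk0_eq_mk0_iff hs (J := ⟨J, mem_nonZeroDivisors_of_ne_zero hJ⟩) hJσ).1 (hI _)
  rw [← hrange, Set.ncard_range_of_injective hinj]

end ClassGroup

end

noncomputable section

section QuadraticField

open NumberField

theorem odd_of_squarefree {p : ℕ} {t : ℤ} (hsf : Squarefree (t ^ 2 - 4 * p)) : Odd t := by
  rw [← Int.not_even_iff_odd]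
  rintro ⟨k, rfl⟩
  have h : (2 : ℤ) * 2 ∣ (k + k) ^ 2 - 4 * p := ⟨k ^ 2 - p, by ring⟩
  have := Int.isUnit_iff.1 (hsf 2 h)
  omega

theorem exists_int_eq_of_mul_sq {D : ℤ} (hD : Squarefree D) {r : ℚ} {k : ℤ}
    (h : D * r ^ 2 = k) : ∃ m : ℤ, r = m := by
  have h1 : D * r.num ^ 2 = k * (r.den : ℤ) ^ 2 := by
    have h2 : (D * r.num ^ 2 : ℚ) = k * (r.den : ℚ) ^ 2 := by
      rw [← h]
      nth_rewrite 2 [← Rat.num_div_den r]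
      have : (r.den : ℚ) ≠ 0 := by exact_mod_cast r.den_nz
      field_simp
    exact_mod_cast h2
  have h2 : IsCoprime ((r.den : ℤ) ^ 2) (r.num ^ 2) :=
    (Int.isCoprime_iff_gcd_eq_one.2 (by
      rw [Int.gcd_comm]
      exact r.reduced)).pow
  have h3 : (r.den : ℤ) * r.den ∣ D := by
    rw [← pow_two]
    exact h2.dvd_of_dvd_mul_right ⟨k, by linarith⟩
  have h4 := Int.isUnit_iff.1 (hD _ h3)
  have h5 : r.den = 1 := by omega
  exact ⟨r.num, (Rat.coe_int_num_of_den_eq_one h5).symm⟩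

theorem exists_int_eq_of_isIntegral_ratCast {q : ℚ} (h : IsIntegral ℤ (q : ℂ)) :
    ∃ m : ℤ, q = m := by
  have h1 : IsIntegral ℤ q := by
    rw [← isIntegral_algebraMap_iff (B := ℂ) (algebraMap ℚ ℂ).injective]
    simpa using h
  obtain ⟨m, hm⟩ := IsIntegrallyClosed.isIntegral_iff.1 h1
  exact ⟨m, by simpa using hm.symm⟩

theorem exists_quadratic_embedding {p : ℕ} {t : ℤ} (ht : t ^ 2 < 4 * (p : ℤ))
    (hsf : Squarefree (t ^ 2 - 4 * (p : ℤ))) {K : Type*} [Field K] [NumberField K]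
    (hdeg : Module.finrank ℚ K = 2)
    (hsqrt : ∃ α : K, α ^ 2 = ((t ^ 2 - 4 * (p : ℤ) : ℤ) : K)) :
    ∃ (s : 𝓞 K →+* ℂ) (ω : 𝓞 K), Function.Injective s ∧ 0 < (s ω).im ∧
      ω ^ 2 = t * ω - p ∧ ∀ w : 𝓞 K, ∃ m n : ℤ, w = m + n * ω := by
  have hodd := odd_of_squarefree hsf
  obtain ⟨σ⟩ : Nonempty (K →+* ℂ) := inferInstance
  obtain ⟨D, hD⟩ : ∃ D : ℤ, t ^ 2 - 4 * (p : ℤ) = D := ⟨_, rfl⟩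
  rw [hD] at hsqrt hsf
  have hD0 : (D : ℝ) < 0 := by
    have : D < 0 := by linarith
    exact_mod_cast this
  have hDK : (t : K) ^ 2 - 4 * p = D := by exact_mod_cast congrArg (Int.cast : ℤ → K) hD
  have him : ∀ α : K, α ^ 2 = (D : K) → (σ α).re = 0 ∧ (σ α).im ≠ 0 := by
    intro α hα
    have h1 := congrArg σ hα
    rw [map_pow, map_intCast] at h1
    have h2 := congrArg Complex.re h1
    have h3 := congrArg Complex.im h1
    rw [pow_two, Complex.mul_re, Complex.intCast_re] at h2
    rw [pow_two, Complex.mul_im, Complex.intCast_im] at h3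
    have h4 : (σ α).im ≠ 0 := by
      intro h
      rw [h] at h2
      nlinarith [mul_self_nonneg (σ α).re]
    refine ⟨?_, h4⟩
    have : (σ α).re * (σ α).im = 0 := by linarith
    exact (mul_eq_zero.1 this).resolve_right h4
  obtain ⟨α, hα, hre, hpos⟩ : ∃ α : K, α ^ 2 = (D : K) ∧ (σ α).re = 0 ∧ 0 < (σ α).im := by
    obtain ⟨α, hα⟩ := hsqrt
    obtain ⟨h1, h2⟩ := him α hα
    rcases lt_or_gt_of_ne h2 with h3 | h3
    · exact ⟨-α, by rw [neg_sq, hα], by simpa using h1, by simpa using h3⟩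
    · exact ⟨α, hα, h1, h3⟩
  have hω2 : ((t + α) / 2 : K) ^ 2 = t * ((t + α) / 2) - p := by
    linear_combination (1 / 4 : K) * hα - (1 / 4 : K) * hDK
  have hωint : IsIntegral ℤ ((t + α) / 2 : K) := by
    refine ⟨Polynomial.X ^ 2 - Polynomial.C t * Polynomial.X + Polynomial.C (p : ℤ), ?_, ?_⟩
    · monicity!
    · rw [Polynomial.eval₂_add, Polynomial.eval₂_sub, Polynomial.eval₂_mul, Polynomial.eval₂_pow,
        Polynomial.eval₂_X, Polynomial.eval₂_C, Polynomial.eval₂_C, eq_intCast, eq_intCast,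
        Int.cast_natCast]
      rw [hω2]
      ring
  have hli : LinearIndependent ℚ ![(1 : K), α] := by
    rw [LinearIndependent.pair_iff]
    intro a b h
    rw [Algebra.smul_def, Algebra.smul_def, eq_ratCast, eq_ratCast] at h
    have h1 := congrArg σ h
    rw [map_add, map_mul, map_mul, map_ratCast, map_ratCast, map_one, map_zero] at h1
    have h2 := congrArg Complex.im h1
    simp only [mul_one, Complex.add_im, Complex.ratCast_im, Complex.mul_im, Complex.ratCast_re,
      zero_mul, zero_add, add_zero, Complex.zero_im, mul_eq_zero, Rat.cast_eq_zero, hpos.ne',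
      or_false] at h2
    subst h2
    simp only [Rat.cast_zero, zero_mul, mul_one, add_zero, Rat.cast_eq_zero] at h1
    exact ⟨h1, rfl⟩
  have hspan := hli.span_eq_top_of_card_eq_finrank (by simp [hdeg])
  obtain ⟨ω, hωK⟩ : ∃ ω : 𝓞 K, (ω : K) = (t + α) / 2 := ⟨⟨_, hωint⟩, rfl⟩
  rw [← hωK] at hω2
  refine ⟨σ.comp (algebraMap (𝓞 K) K), ω,
    σ.injective.comp RingOfIntegers.coe_injective, ?_, ?_, ?_⟩
  · change 0 < (σ ω).im
    rw [hωK, map_div₀, map_add, map_intCast, map_ofNat]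
    simpa using hpos
  · apply RingOfIntegers.coe_injective
    rw [map_pow, map_sub, map_mul, map_intCast, map_natCast]
    exact hω2
  · intro w
    have hw : (w : K) ∈ Submodule.span ℚ (Set.range ![(1 : K), α]) := by
      rw [hspan]
      trivial
    simp only [Matrix.range_cons, Matrix.range_empty, Set.union_empty, Set.singleton_union] at hw
    rw [Submodule.mem_span_pair] at hw
    obtain ⟨u, v, huv⟩ := hw
    rw [Algebra.smul_def, Algebra.smul_def, eq_ratCast, eq_ratCast, mul_one] at huv
    have hσw : IsIntegral ℤ (σ w) := w.isIntegral_coe.map (σ.toIntAlgHom)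
    have hconj : IsIntegral ℤ (starRingEnd ℂ (σ w)) := hσw.map (starRingEnd ℂ).toIntAlgHom
    have hσα : starRingEnd ℂ (σ α) = -σ α := by
      apply Complex.ext
      · simp [hre]
      · simp
    have hσα2 : (σ α) ^ 2 = D := by rw [← map_pow, hα, map_intCast]
    have e1 : σ w = u + v * σ α := by
      rw [← huv, map_add, map_mul, map_ratCast, map_ratCast]
    have e2 : starRingEnd ℂ (σ w) = u - v * σ α := by
      rw [e1, map_add, map_mul, hσα, map_ratCast, map_ratCast]
      ring
    obtain ⟨m, hm⟩ := exists_int_eq_of_isIntegral_ratCast (q := 2 * u) (by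
      have := hσw.add hconj
      rw [e2, e1] at this
      rw [show ((2 * u : ℚ) : ℂ) = u + v * σ α + (u - v * σ α) by push_cast; ring]
      exact this)
    obtain ⟨n, hn⟩ := exists_int_eq_of_isIntegral_ratCast (q := u ^ 2 - D * v ^ 2) (by
      have := hσw.mul hconj
      rw [e2, e1] at this
      rw [show ((u ^ 2 - D * v ^ 2 : ℚ) : ℂ) = (u + v * σ α) * (u - v * σ α) by
        push_cast
        linear_combination (v : ℂ) ^ 2 * hσα2]
      exact this)
    obtain ⟨r, hr⟩ := exists_int_eq_of_mul_sq hsf (r := 2 * v) (k := m ^ 2 - 4 * n) (by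
      push_cast
      rw [← hm, ← hn]
      ring)
    have hmr : m ^ 2 - D * r ^ 2 = 4 * n := by
      have : (m ^ 2 - D * r ^ 2 : ℚ) = 4 * n := by
        rw [← hm, ← hn, ← hr]
        ring
      exact_mod_cast this
    obtain ⟨k, hk⟩ : Even (m - r * t) := by
      have h1 : Even (m ^ 2 - D * r ^ 2) := by
        rw [hmr]
        exact ⟨2 * n, by ring⟩
      have h2 : Odd D := by
        rw [← hD]
        exact hodd.pow.sub_even ⟨2 * p, by ring⟩
      rw [Int.even_sub, Int.even_mul]
      rw [Int.even_sub, Int.even_mul, Int.even_pow' two_ne_zero, Int.even_pow' two_ne_zero] at h1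
      rw [← Int.not_even_iff_odd] at h2 hodd
      tauto
    refine ⟨k, r, RingOfIntegers.coe_injective ?_⟩
    rw [map_add, map_mul, map_intCast, map_intCast]
    have e3 : (w : K) = k + r * ω := by
      rw [← huv, hωK]
      have hm' : (2 * u : K) = m := by exact_mod_cast congrArg (Rat.cast : ℚ → K) hm
      have hr' : (2 * v : K) = r := by exact_mod_cast congrArg (Rat.cast : ℚ → K) hr
      have hk' : (m - r * t : K) = k + k := by exact_mod_cast congrArg (Int.cast : ℤ → K) hk
      linear_combination (1 / 2 : K) * hm' + (1 / 2 : K) * α * hr' + (1 / 2 : K) * hk'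
    exact e3

section Torsion

variable {p : ℕ} {t : ℤ} {K : Type*} [Field K] {s : 𝓞 K →+* ℂ} {ω : 𝓞 K}

theorem norm_eq_one_of_mem_torsion (him : 0 < (s ω).im) (hω : ω ^ 2 = t * ω - p)
    {u : (𝓞 K)ˣ} (hu : u ∈ Units.torsion K) {m n : ℤ} (h : (u : 𝓞 K) = m + n * ω) :
    (2 * m + t * n) ^ 2 - (t ^ 2 - 4 * p) * n ^ 2 = 4 := by
  obtain ⟨k, hk, hk1⟩ := isOfFinOrder_iff_pow_eq_one.1 ((CommGroup.mem_torsion _).1 hu)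
  have h1 : (s u) ^ k = 1 := by
    rw [← map_pow, ← Units.val_pow_eq_pow_val, hk1, Units.val_one, map_one]
  have h2 : ‖s u‖ = 1 := (pow_eq_one_iff_of_nonneg (norm_nonneg _) hk.ne').1 (by
    rw [← norm_pow, h1, norm_one])
  have h3 : Complex.normSq (s u) = 1 := by rw [Complex.normSq_eq_norm_sq, h2, one_pow]
  have h4 := congrArg s hω
  rw [map_pow, map_sub, map_mul, map_intCast, map_natCast] at h4
  have hre := congrArg Complex.re h4
  have him' := congrArg Complex.im h4
  rw [pow_two, Complex.mul_re] at hre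
  rw [pow_two, Complex.mul_im] at him'
  simp only [Complex.sub_re, Complex.sub_im, Complex.mul_re, Complex.mul_im, Complex.intCast_re,
    Complex.intCast_im, Complex.natCast_re, Complex.natCast_im, zero_mul, sub_zero,
    add_zero] at hre him'
  have e1 : 2 * (s ω).re = t := by
    have : (2 * (s ω).re - t) * (s ω).im = 0 := by linarith
    linarith [(mul_eq_zero.1 this).resolve_right him.ne']
  rw [h, map_add, map_mul, map_intCast, map_intCast, Complex.normSq_apply] at h3
  simp only [Complex.add_re, Complex.add_im, Complex.mul_re, Complex.mul_im, Complex.intCast_re,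
    Complex.intCast_im, zero_mul, sub_zero, add_zero, zero_add] at h3
  have h5 : (((2 * m + t * n) ^ 2 - (t ^ 2 - 4 * p) * n ^ 2 : ℤ) : ℝ) = (4 : ℤ) := by
    push_cast
    rw [← e1] at hre ⊢
    linear_combination 4 * h3 + 4 * (n : ℝ) ^ 2 * hre
  exact_mod_cast h5

variable [NumberField K]

theorem card_torsion_eq_two (him : 0 < (s ω).im) (hω : ω ^ 2 = t * ω - p)
    (hspan : ∀ w : 𝓞 K, ∃ m n : ℤ, w = m + n * ω) (hD : t ^ 2 - 4 * p < -4) :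
    Nat.card (Units.torsion K) = 2 := by
  have h1 : ∀ u ∈ Units.torsion K, u = 1 ∨ u = -1 := by
    intro u hu
    obtain ⟨m, n, h⟩ := hspan u
    have h2 := norm_eq_one_of_mem_torsion him hω hu h
    have hn : n = 0 := by
      by_contra hn
      have : 0 < n ^ 2 := by positivity
      nlinarith [sq_nonneg (2 * m + t * n)]
    subst hn
    have hm : (m - 1) * (m + 1) = 0 := by linarith
    rcases mul_eq_zero.1 hm with hm | hm
    · left
      obtain rfl : m = 1 := by omega
      apply Units.ext
      simpa using h
    · right
      obtain rfl : m = -1 := by omega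
      apply Units.ext
      simpa using h
  have h2 : (Units.torsion K : Set (𝓞 K)ˣ) = {1, -1} := by
    ext u
    refine ⟨h1 u, ?_⟩
    rintro (rfl | rfl)
    · exact one_mem _
    · refine (CommGroup.mem_torsion _).2 (isOfFinOrder_iff_pow_eq_one.2 ⟨2, two_pos, by simp⟩)
  change (Units.torsion K : Set (𝓞 K)ˣ).ncard = 2
  rw [h2]
  refine Set.ncard_pair fun h => ?_
  have h3 := congrArg (Units.val) h
  rw [Units.val_neg, Units.val_one, eq_neg_iff_add_eq_zero] at h3
  norm_num at h3

theorem card_torsion_eq_six (him : 0 < (s ω).im) (hω : ω ^ 2 = t * ω - p)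
    (hspan : ∀ w : 𝓞 K, ∃ m n : ℤ, w = m + n * ω) (hD : t ^ 2 - 4 * p = -3) :
    Nat.card (Units.torsion K) = 6 := by
  obtain ⟨k, rfl⟩ : Odd t := by
    rw [← Int.not_even_iff_odd]
    rintro ⟨k, rfl⟩
    have : (k + k) ^ 2 = 4 * k ^ 2 := by ring
    omega
  apply le_antisymm
  · choose f g hfg using hspan
    let T : Finset (ℤ × ℤ) := {(2, 0), (-2, 0), (1, 1), (1, -1), (-1, 1), (-1, -1)}
    have hT : (T : Set (ℤ × ℤ)).ncard = 6 := by
      rw [Set.ncard_coe_finset]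
      rfl
    change (Units.torsion K : Set (𝓞 K)ˣ).ncard ≤ 6
    rw [← hT]
    refine Set.ncard_le_ncard_of_injOn
      (fun u => (2 * f u + (2 * k + 1) * g u, g u)) ?_ ?_ T.finite_toSet
    · intro u hu
      have h2 := norm_eq_one_of_mem_torsion him hω hu (hfg u)
      rw [hD] at h2
      generalize 2 * f u + (2 * k + 1) * g u = x at h2 ⊢
      generalize g (u : 𝓞 K) = y at h2 ⊢
      have hy1 : y ≤ 1 := by nlinarith
      have hy2 : -1 ≤ y := by nlinarith
      have hx1 : x ≤ 2 := by nlinarith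
      have hx2 : -2 ≤ x := by nlinarith
      interval_cases y <;> interval_cases x <;>
        first | (exfalso; revert h2; decide) | simp [T]
    · intro u _ v _ h
      obtain ⟨h1, h2⟩ := Prod.mk.injEq _ _ _ _ ▸ h
      rw [h2] at h1
      have h3 : f (u : 𝓞 K) = f v := by linarith
      apply Units.ext
      rw [hfg u, hfg v, h2, h3]
  · have hD' : (4 * (k ^ 2 + k + 1) : ℤ) = 4 * p := by linarith
    have hk : (k ^ 2 + k + 1 : 𝓞 K) = p := by
      have : k ^ 2 + k + 1 = (p : ℤ) := by linarith
      exact_mod_cast congrArg (Int.cast : ℤ → 𝓞 K) this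
    push_cast at hω
    have h1 : (ω - k) * (1 - (ω - k)) = 1 := by linear_combination -hω - hk
    let ζ : (𝓞 K)ˣ := Units.mkOfMulEqOne _ _ h1
    have hζ : (ζ : 𝓞 K) = ω - k := rfl
    have hζ6 : ζ ^ 6 = 1 := by
      apply Units.ext
      rw [Units.val_pow_eq_pow_val, hζ, Units.val_one]
      generalize ω - (k : 𝓞 K) = z at h1
      linear_combination (-z ^ 4 - z ^ 3 + z + 1) * h1
    have hmem : ζ ∈ Units.torsion K :=
      (CommGroup.mem_torsion _).2 (isOfFinOrder_iff_pow_eq_one.2 ⟨6, by norm_num, hζ6⟩)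
    have hord : orderOf (⟨ζ, hmem⟩ : Units.torsion K) = 6 := by
      rw [← Subgroup.orderOf_coe]
      refine orderOf_eq_of_pow_and_pow_div_prime (by norm_num) hζ6 ?_
      intro q hq hq6
      have : q = 2 ∨ q = 3 := by
        have := Nat.le_of_dvd (by norm_num) hq6
        interval_cases q <;> revert hq hq6 <;> decide
      rcases this with rfl | rfl
      · intro h
        have h2 := congrArg Units.val h
        rw [Units.val_pow_eq_pow_val, hζ, Units.val_one] at h2
        generalize ω - (k : 𝓞 K) = z at h1 h2
        norm_num at h2
        have h3 : (2 : 𝓞 K) = 0 := by linear_combination -h2 - (z + 1) * h1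
        norm_num at h3
      · intro h
        have h2 := congrArg Units.val h
        rw [Units.val_pow_eq_pow_val, hζ, Units.val_one] at h2
        generalize ω - (k : 𝓞 K) = z at h1 h2
        change z ^ 2 = 1 at h2
        have h3 : (3 : 𝓞 K) = 0 := by linear_combination h2 - (z + 2) * (h1 + h2)
        norm_num at h3
    rw [← hord]
    exact Nat.le_of_dvd Nat.card_pos (orderOf_dvd_natCard _)

end Torsion

end QuadraticField

end

noncomputable section

open UpperHalfPlane ModularForm MatrixGroups

section SpecialPoints

variable {p : ℕ} {t : ℤ} {τ : ℍ}

theorem IsCM.smul (h : IsCM p t τ) (γ : SL(2, ℤ)) : IsCM p t (γ • τ) := by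
  obtain ⟨A, B, C, D, h1, h2, h3⟩ := h
  obtain ⟨a, ha⟩ : ∃ a, γ 0 0 = a := ⟨_, rfl⟩
  obtain ⟨b, hb⟩ : ∃ b, γ 0 1 = b := ⟨_, rfl⟩
  obtain ⟨c, hc⟩ : ∃ c, γ 1 0 = c := ⟨_, rfl⟩
  obtain ⟨d, hd⟩ : ∃ d, γ 1 1 = d := ⟨_, rfl⟩
  have hdet : a * d - b * c = 1 := by
    rw [← ha, ← hb, ← hc, ← hd, ← Matrix.det_fin_two]
    exact γ.2
  have h4 := coe_SL_smul γ τ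
  rw [ha, hb, hc, hd] at h4
  have hne : (c : ℂ) * τ + d ≠ 0 := by
    intro h
    obtain ⟨rfl, rfl⟩ := UpperHalfPlane.int_mul_add_eq_zero' h
    simp at hdet
  have hdetC : (a : ℂ) * d - b * c = 1 := by exact_mod_cast hdet
  refine ⟨(a * A + b * C) * d - (a * B + b * D) * c, (a * B + b * D) * a - (a * A + b * C) * b,
    (c * A + d * C) * d - (c * B + d * D) * c, (c * B + d * D) * a - (c * A + d * C) * b,
    ?_, ?_, ?_⟩
  · rw [← h1]
    linear_combination (A * D - B * C) * (a * d - b * c + 1) * hdet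
  · rw [← h2]
    linear_combination (A + D) * hdet
  · rw [h4]
    push_cast
    field_simp
    linear_combination ((a : ℂ) * d - b * c) ^ 2 * h3

theorem exists_SL_of_fixed {A B C D : ℤ} (h1 : A * D - B * C = 1)
    (h3 : (A : ℂ) * τ + B = (C * τ + D) * τ) :
    ∃ (γ : SL(2, ℤ)) (l : ℂ), γ • τ = τ ∧ (γ 1 0 : ℂ) * τ + (γ 1 1 : ℂ) = l ∧
      l ^ 2 = (A + D) * l - 1 := by
  obtain ⟨γ, ha, hb, hc, hd⟩ := exists_SL_of_det h1
  have h1' : (A : ℂ) * D - B * C = 1 := by exact_mod_cast h1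
  have hne : (C : ℂ) * τ + D ≠ 0 := by
    intro h
    obtain ⟨rfl, rfl⟩ := UpperHalfPlane.int_mul_add_eq_zero' h
    simp at h1
  refine ⟨γ, C * τ + D, ?_, by rw [hc, hd], ?_⟩
  · apply UpperHalfPlane.ext
    rw [coe_SL_smul, ha, hb, hc, hd, h3]
    field_simp
  · linear_combination -(C : ℂ) * h3 - h1'

theorem kleinJ_eq_zero_of_fixed {A B C D : ℤ} (h1 : A * D - B * C = 1) (h2 : A + D = 1)
    (h3 : (A : ℂ) * τ + B = (C * τ + D) * τ) : kleinJ τ = 0 := by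
  obtain ⟨γ, l, hγ, hl, hl2⟩ := exists_SL_of_fixed h1 h3
  have h2' : (A : ℂ) + D = 1 := by exact_mod_cast h2
  rw [h2', one_mul] at hl2
  have h4 := E₄_SL γ τ
  rw [hγ, hl] at h4
  have h5 : (1 + l) * E₄ τ = 0 := by linear_combination h4 + (l ^ 2 + l) * E₄ τ * hl2
  have h6 : 1 + l ≠ 0 := by
    intro h
    have : (3 : ℂ) = 0 := by linear_combination hl2 - (l - 2) * h
    norm_num at this
  rw [kleinJ, (mul_eq_zero.1 h5).resolve_left h6]
  simp

theorem kleinJ_eq_of_fixed {A B C D : ℤ} (h1 : A * D - B * C = 1) (h2 : A + D = 0)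
    (h3 : (A : ℂ) * τ + B = (C * τ + D) * τ) : kleinJ τ = 1728 := by
  obtain ⟨γ, l, hγ, hl, hl2⟩ := exists_SL_of_fixed h1 h3
  have h2' : (A : ℂ) + D = 0 := by exact_mod_cast h2
  rw [h2', zero_mul, zero_sub] at hl2
  have h4 := E₆_SL γ τ
  rw [hγ, hl, show l ^ 6 = (l ^ 2) ^ 3 by ring, hl2] at h4
  have h5 : E₆ τ = 0 := by linear_combination (1 / 2 : ℂ) * h4
  rw [← sub_eq_zero, kleinJ_sub, h5]
  simp

theorem exists_zeta_six : ∃ ζ : ℍ, (ζ : ℂ) ^ 2 = ζ - 1 := by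
  refine ⟨⟨1 / 2 + (√3 / 2 : ℝ) * Complex.I, by simp⟩, ?_⟩
  change (1 / 2 + (√3 / 2 : ℝ) * Complex.I) ^ 2 = 1 / 2 + (√3 / 2 : ℝ) * Complex.I - 1
  have h4 : ((√3 : ℝ) : ℂ) ^ 2 = 3 := by
    rw [← Complex.ofReal_pow, Real.sq_sqrt (by norm_num)]
    norm_num
  push_cast
  linear_combination (1 / 4 : ℂ) * (√3 : ℝ) ^ 2 * Complex.I_sq - (1 / 4 : ℂ) * h4

theorem kleinJ_zeta_six {ζ : ℍ} (hζ : (ζ : ℂ) ^ 2 = ζ - 1) : kleinJ ζ = 0 :=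
  kleinJ_eq_zero_of_fixed (A := 1) (B := -1) (C := 1) (D := 0) (by norm_num) (by norm_num) (by
    push_cast
    linear_combination -hζ)

theorem kleinJ_I : kleinJ UpperHalfPlane.I = 1728 :=
  kleinJ_eq_of_fixed (A := 0) (B := -1) (C := 1) (D := 0) (by norm_num) (by norm_num) (by
    rw [UpperHalfPlane.coe_I]
    push_cast
    linear_combination -Complex.I_sq)

theorem isCM_zeta_six {ζ : ℍ} (hζ : (ζ : ℂ) ^ 2 = ζ - 1) {x y : ℤ}
    (h : x ^ 2 + x * y + y ^ 2 = p) : IsCM p (2 * x + y) ζ := by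
  refine ⟨x + y, -y, y, x, by linarith, by ring, ?_⟩
  push_cast
  linear_combination -(y : ℂ) * hζ

theorem isCM_I {x y : ℤ} (h : x ^ 2 + y ^ 2 = p) : IsCM p (2 * x) UpperHalfPlane.I := by
  refine ⟨x, -y, y, x, by linarith, by ring, ?_⟩
  rw [UpperHalfPlane.coe_I]
  push_cast
  linear_combination -(y : ℂ) * Complex.I_sq

theorem IsCM.of_kleinJ_eq {τ' : ℍ} (h : IsCM p t τ) (hj : kleinJ τ = kleinJ τ') :
    IsCM p t τ' := by
  obtain ⟨γ, hγ⟩ := kleinJ_eq_iff.1 hj.symm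
  rw [← hγ]
  exact h.smul γ

theorem IsCM.exists_of_kleinJ_eq_zero (h : IsCM p t τ) (hj : kleinJ τ = 0) :
    ∃ c : ℤ, t ^ 2 - 4 * p = -3 * c ^ 2 := by
  obtain ⟨ζ, hζ⟩ := exists_zeta_six
  obtain ⟨A, B, C, D, h1, rfl, h2⟩ := h.of_kleinJ_eq (hj.trans (kleinJ_zeta_six hζ).symm)
  obtain ⟨h3, h4⟩ := UpperHalfPlane.int_mul_add_eq_zero' (τ := ζ) (m := C + D - A)
    (n := -B - C) (by
      push_cast
      linear_combination -h2 - (C : ℂ) * hζ)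
  obtain rfl : A = C + D := by linarith
  obtain rfl : B = -C := by linarith
  exact ⟨C, by rw [← h1]; ring⟩

theorem IsCM.even_of_kleinJ_eq (h : IsCM p t τ) (hj : kleinJ τ = 1728) : Even t := by
  obtain ⟨A, B, C, D, h1, rfl, h2⟩ := h.of_kleinJ_eq (hj.trans kleinJ_I.symm)
  obtain ⟨h3, h4⟩ := UpperHalfPlane.int_mul_add_eq_zero' (τ := UpperHalfPlane.I) (m := D - A)
    (n := -B - C) (by
      rw [UpperHalfPlane.coe_I] at h2 ⊢
      push_cast
      linear_combination -h2 - (C : ℂ) * Complex.I_sq)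
  exact ⟨A, by linarith⟩

/-- A prime congruent to `1` modulo `3` is a norm from the Eisenstein integers. -/
theorem exists_sq_add_mul_add_sq_eq (hp : p.Prime) (h3 : p % 3 = 1) :
    ∃ x y : ℤ, x ^ 2 + x * y + y ^ 2 = p := by
  have : Fact p.Prime := ⟨hp⟩
  obtain ⟨r, hr⟩ : ∃ r : ZMod p, r ^ 2 + r + 1 = 0 := by
    have h := exists_prime_orderOf_dvd_card (G := (ZMod p)ˣ) 3 (by
      rw [ZMod.card_units]
      omega)
    obtain ⟨g, hg⟩ := h
    have h1 : (g : ZMod p) ^ 3 = 1 := by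
      rw [← Units.val_pow_eq_pow_val, ← hg, pow_orderOf_eq_one, Units.val_one]
    have h2 : (g : ZMod p) - 1 ≠ 0 := by
      intro h
      have : g = 1 := Units.ext (by rw [Units.val_one, sub_eq_zero.1 h])
      rw [this, orderOf_one] at hg
      norm_num at hg
    refine ⟨g, (mul_eq_zero.1 (?_ : ((g : ZMod p) - 1) * _ = 0)).resolve_left h2⟩
    linear_combination h1
  let k := p.sqrt
  have hk : p < (k + 1) * (k + 1) := Nat.lt_succ_sqrt p
  have hk' : k * k < p := by
    refine lt_of_le_of_ne (Nat.sqrt_le p) fun h => hp.prime.not_isSquare ⟨k, h.symm⟩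
  obtain ⟨u, -, v, -, huv, he⟩ := Finset.exists_ne_map_eq_of_card_lt_of_maps_to
    (s := (Finset.univ : Finset (Fin (k + 1) × Fin (k + 1)))) (t := (Finset.univ : Finset (ZMod p)))
    (f := fun u => ((u.1 : ℕ) : ZMod p) - r * ((u.2 : ℕ) : ZMod p))
    (by simpa [ZMod.card] using hk) (fun _ _ => Finset.mem_coe.2 (Finset.mem_univ _))
  obtain ⟨x, hx⟩ : ∃ x : ℤ, ((u.1 : ℕ) : ℤ) - ((v.1 : ℕ) : ℤ) = x := ⟨_, rfl⟩
  obtain ⟨y, hy⟩ : ∃ y : ℤ, ((u.2 : ℕ) : ℤ) - ((v.2 : ℕ) : ℤ) = y := ⟨_, rfl⟩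
  have hx2 : x ^ 2 ≤ k * k := by
    have h1 := u.1.2
    have h2 := v.1.2
    rw [← pow_two]
    exact sq_le_sq' (by omega) (by omega)
  have hy2 : y ^ 2 ≤ k * k := by
    have h1 := u.2.2
    have h2 := v.2.2
    rw [← pow_two]
    exact sq_le_sq' (by omega) (by omega)
  have hk2 : (k : ℤ) * k < p := by exact_mod_cast hk'
  have hxy0 : x ≠ 0 ∨ y ≠ 0 := by
    by_contra! h
    apply huv
    ext <;> omega
  have hdvd : (p : ℤ) ∣ x ^ 2 + x * y + y ^ 2 := by
    rw [← ZMod.intCast_zmod_eq_zero_iff_dvd]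
    have hxr : (x : ZMod p) = r * y := by
      rw [← hx, ← hy]
      push_cast
      linear_combination he
    push_cast
    rw [hxr]
    linear_combination (y : ZMod p) ^ 2 * hr
  obtain ⟨c, hc⟩ := hdvd
  have hp0 : (0 : ℤ) < p := by exact_mod_cast hp.pos
  have hpos : 0 < x ^ 2 + x * y + y ^ 2 := by
    rcases hxy0 with h | h
    · have := pow_pos (abs_pos.2 h) 2
      rw [sq_abs] at this
      nlinarith [sq_nonneg (x + 2 * y)]
    · have := pow_pos (abs_pos.2 h) 2
      rw [sq_abs] at this
      nlinarith [sq_nonneg (2 * x + y)]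
  have hlt : x ^ 2 + x * y + y ^ 2 < 3 * p := by nlinarith [sq_nonneg (x - y)]
  have hc1 : 0 < c := by
    rw [hc] at hpos
    exact (mul_pos_iff_of_pos_left hp0).1 hpos
  have hc3 : c < 3 := by
    rw [hc] at hlt
    nlinarith
  obtain rfl | rfl : c = 1 ∨ c = 2 := by omega
  · exact ⟨x, y, by rw [hc, mul_one]⟩
  · exfalso
    have hev : Even (x ^ 2 + x * y + y ^ 2) := ⟨p, by rw [hc]; ring⟩
    have hxe : Even x ∧ Even y := by
      simp only [Int.even_add, Int.even_mul, Int.even_pow' two_ne_zero] at hev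
      tauto
    obtain ⟨⟨m, rfl⟩, ⟨n, rfl⟩⟩ := hxe
    have h2 : (p : ℤ) = 2 * (m ^ 2 + m * n + n ^ 2) := by linarith
    have h3' : 2 ∣ p := by
      have : (2 : ℤ) ∣ p := ⟨_, h2⟩
      exact_mod_cast this
    have := (Nat.prime_dvd_prime_iff_eq Nat.prime_two hp).1 h3'
    omega

end SpecialPoints

end

noncomputable section

open UpperHalfPlane ModularForm MatrixGroups IsLocalRing

section Reduction

/-- The square of `t` is determined by its class modulo `p` among squares of possible traces. -/
def TraceSeparated (p : ℕ) (t : ℤ) : Prop :=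
  ∀ a : ℤ, 2 * |a| ≤ p + 3 → (p : ℤ) ∣ a ^ 2 - t ^ 2 → a ^ 2 = t ^ 2

theorem two_mul_abs_le_of_sq_lt {p : ℕ} (hp3 : 3 < p) {t : ℤ} (h : t ^ 2 < 4 * p) :
    2 * |t| ≤ p + 3 := by
  rw [← sq_abs] at h
  generalize |t| = u at h
  by_contra! h1
  have hp : (3 : ℤ) < p := by exact_mod_cast hp3
  generalize (p : ℤ) = q at *
  rcases lt_or_ge q 9 with h9 | h9
  · interval_cases q <;> nlinarith
  · nlinarith

theorem not_dvd_of_odd {p : ℕ} (hp3 : 3 < p) {t : ℤ} (h : t ^ 2 < 4 * p) (hodd : Odd t) :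
    ¬ (p : ℤ) ∣ t := by
  rintro ⟨k, rfl⟩
  have hk : k ≠ 0 := by
    rintro rfl
    simp at hodd
  have h1 : 1 ≤ k ^ 2 := by
    have := pow_pos (abs_pos.2 hk) 2
    rwa [sq_abs] at this
  have hp : (4 : ℤ) ≤ p := by exact_mod_cast hp3
  nlinarith [mul_le_mul_of_nonneg_left h1 (sq_nonneg (p : ℤ))]

theorem ne_neg_three_mul_sq {D : ℤ} (hD : Squarefree D) (h3 : D ≠ -3) (c : ℤ) :
    D ≠ -3 * c ^ 2 := by
  rintro rfl
  rcases Int.isUnit_iff.1 (hD c ⟨-3, by ring⟩) with rfl | rfl <;> simp at h3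

variable {p : ℕ} [Fact p.Prime] {t : ℤ}

theorem sq_eq_of_cast_pow_eq {x : ZMod p} (ht0 : (t : ZMod p) ≠ 0)
    (h4 : x ^ 4 = (t : ZMod p) ^ 4) (h6 : x ^ 6 = (t : ZMod p) ^ 6) : x ^ 2 = (t : ZMod p) ^ 2 := by
  have h : (t : ZMod p) ^ 4 * x ^ 2 = (t : ZMod p) ^ 4 * (t : ZMod p) ^ 2 := by
    nth_rewrite 1 [← h4]
    linear_combination h6
  exact mul_left_cancel₀ (pow_ne_zero 4 ht0) h

theorem apE_sq_eq_iff (hp3 : 3 < p) (hsep : TraceSeparated p t) {a b : ZMod p} :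
    apE p a b ^ 2 = t ^ 2 ↔ hasseCoeff p a b ^ 2 = (t : ZMod p) ^ 2 := by
  rw [← apE_cast p hp3]
  constructor
  · intro h
    exact_mod_cast congrArg (Int.cast : ℤ → ZMod p) h
  · intro h
    refine hsep _ (abs_apE_le p hp3 a b) ?_
    rw [← ZMod.intCast_zmod_eq_zero_iff_dvd]
    push_cast
    rw [h, sub_self]

variable {O : ValuationSubring ℂ} {ι : ZMod p →+* ResidueField O} {W : Polynomial O}

theorem IsCM.hasseCoeff_pow_eq (hp3 : 3 < p) (hO : (p : ℂ) ∈ O.nonunits) {τ : ℍ}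
    (h : IsCM p t τ) {r : O} (hr : (r : ℂ) = kleinJ τ) {a b : ZMod p}
    (hab : 4 * a ^ 3 + 27 * b ^ 2 ≠ 0) (hj : residue O r = ι (jInv a b)) :
    (a ≠ 0 → hasseCoeff p a b ^ 4 = (t : ZMod p) ^ 4) ∧
      (b ≠ 0 → hasseCoeff p a b ^ 6 = (t : ZMod p) ^ 6) := by
  obtain ⟨A, B, C, D, h1, rfl, h2⟩ := h
  exact _root_.hasseCoeff_pow_eq hp3 hO ι h1 h2 hr hab hj

theorem natCast_zmod_ne_zero (hp3 : 3 < p) (k l : ℕ) : ((2 ^ k * 3 ^ l : ℕ) : ZMod p) ≠ 0 := by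
  intro h0
  have h1 := (ZMod.natCast_eq_zero_iff _ p).1 h0
  have h2 := coprime_of_three_lt (p := p) hp3 (a := k) (b := l)
  exact (Fact.out : p.Prime).one_lt.ne' (Nat.dvd_one.1 (h2 ▸ Nat.dvd_gcd h1 dvd_rfl))

theorem jInv_zero_left (b : ZMod p) : jInv 0 b = 0 := by simp [jInv]

theorem jInv_zero_right (hp3 : 3 < p) {a : ZMod p} (ha : a ≠ 0) : jInv a 0 = 1728 := by
  have h4 : (4 : ZMod p) ≠ 0 := by simpa using natCast_zmod_ne_zero (p := p) hp3 2 0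
  unfold jInv
  field_simp
  ring

theorem hasseCoeff_zero_left_pow_eq (hp3 : 3 < p) (hO : (p : ℂ) ∈ O.nonunits)
    (ι : ZMod p →+* ResidueField O) {x y : ℤ} (h : x ^ 2 + x * y + y ^ 2 = p) {b : ZMod p}
    (hb : b ≠ 0) : hasseCoeff p 0 b ^ 6 = ((2 * x + y : ℤ) : ZMod p) ^ 6 := by
  obtain ⟨ζ, hζ⟩ := exists_zeta_six
  have h27 : (27 : ZMod p) ≠ 0 := by simpa using natCast_zmod_ne_zero (p := p) hp3 0 3
  refine ((isCM_zeta_six hζ h).hasseCoeff_pow_eq (ι := ι) (r := 0) hp3 hO ?_ ?_ ?_).2 hb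
  · rw [kleinJ_zeta_six hζ]
    rfl
  · rw [zero_pow three_ne_zero, mul_zero, zero_add]
    exact mul_ne_zero h27 (pow_ne_zero 2 hb)
  · rw [jInv_zero_left, map_zero, map_zero]

theorem apE_zero_left_sq_ne (hp3 : 3 < p) (hO : (p : ℂ) ∈ O.nonunits)
    (ι : ZMod p →+* ResidueField O) (ht0 : (t : ZMod p) ≠ 0) (hsep : TraceSeparated p t)
    (hD : ∀ c : ℤ, t ^ 2 - 4 * p ≠ -3 * c ^ 2) {b : ZMod p} (hb : b ≠ 0) :
    apE p 0 b ^ 2 ≠ t ^ 2 := by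
  rw [Ne, apE_sq_eq_iff hp3 hsep]
  intro hsq
  have hp := (Fact.out : p.Prime)
  have hmod : p % 3 = 1 ∨ p % 3 = 2 := by
    have : p % 3 ≠ 0 := fun h =>
      hp3.ne ((Nat.prime_dvd_prime_iff_eq Nat.prime_three hp).1 (Nat.dvd_of_mod_eq_zero h))
    omega
  rcases hmod with hmod | hmod
  · obtain ⟨x, y, hxy⟩ := exists_sq_add_mul_add_sq_eq hp hmod
    have h6 := hasseCoeff_zero_left_pow_eq hp3 hO ι hxy hb
    have key : ((((2 * x + y) ^ 2 - t ^ 2) * (((x - y) ^ 2 - t ^ 2) *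
        ((x + 2 * y) ^ 2 - t ^ 2)) : ℤ) : ZMod p) = 0 := by
      have hxy' : (x : ZMod p) ^ 2 + x * y + y ^ 2 = 0 := by
        have := congrArg (Int.cast : ℤ → ZMod p) hxy
        push_cast at this
        rw [this, CharP.cast_eq_zero]
      have h6' : (t : ZMod p) ^ 6 = ((2 * x + y : ℤ) : ZMod p) ^ 6 := by
        rw [← h6]
        linear_combination -(hasseCoeff p 0 b ^ 4 + hasseCoeff p 0 b ^ 2 * (t : ZMod p) ^ 2 +
          (t : ZMod p) ^ 4) * hsq
      push_cast at h6' ⊢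
      obtain ⟨T, hT⟩ : ∃ T : ZMod p, (t : ZMod p) ^ 2 = T := ⟨_, rfl⟩
      rw [show (t : ZMod p) ^ 6 = T ^ 3 by rw [← hT]; ring] at h6'
      rw [hT]
      obtain ⟨S, hS⟩ : ∃ S : ZMod p, (2 * x + y : ZMod p) ^ 2 = S := ⟨_, rfl⟩
      rw [show (2 * x + y : ZMod p) ^ 6 = S ^ 3 by rw [← hS]; ring] at h6'
      have e2 : ((x - y : ZMod p) ^ 2 - T) * ((x + 2 * y) ^ 2 - T) = T ^ 2 + S * T + S ^ 2 := by
        rw [← hS]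
        linear_combination
          (-6 * T - 15 * (x ^ 2 + x * y + y ^ 2) + 18 * (y : ZMod p) ^ 2) * hxy'
      rw [hS, e2]
      linear_combination -h6'
    have hsmall : ∀ u v : ℤ, u ^ 2 + 3 * v ^ 2 = 4 * p → (p : ℤ) ∣ u ^ 2 - t ^ 2 → False := by
      intro u v huv hdvd
      have hv : v ≠ 0 := by
        rintro rfl
        have h1 : (2 : ℤ) ∣ u := by
          refine Int.prime_two.dvd_of_dvd_pow (n := 2) ⟨2 * p, by linarith⟩
        obtain ⟨w, rfl⟩ := h1
        refine hp.prime.not_isSquare ⟨w.natAbs, ?_⟩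
        zify
        rw [abs_mul_abs_self]
        linarith
      have hv2 : 0 < v ^ 2 := by positivity
      have h1 := hsep u (two_mul_abs_le_of_sq_lt hp3 (by linarith)) hdvd
      exact hD v (by linarith)
    rw [ZMod.intCast_zmod_eq_zero_iff_dvd] at key
    have hpZ := Nat.prime_iff_prime_int.1 hp
    rcases hpZ.dvd_or_dvd key with h | h
    · exact hsmall _ y (by linarith) h
    · rcases hpZ.dvd_or_dvd h with h | h
      · exact hsmall _ (x + y) (by linarith) h
      · exact hsmall _ x (by linarith) h
  · rw [hasseCoeff_zero_left_of_mod p b hmod, zero_pow two_ne_zero] at hsq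
    exact pow_ne_zero 2 ht0 hsq.symm

theorem residue_ofNat_ne_zero (hp3 : 3 < p) (hO : (p : ℂ) ∈ O.nonunits) :
    residue O (1728 : O) ≠ 0 := by
  have h := natCast_residue_ne_zero hO (coprime_of_three_lt (p := p) hp3 (a := 6) (b := 3))
  rw [← map_natCast (residue O)] at h
  norm_num at h ⊢
  exact h

theorem IsCM.residue_ne_zero (hp3 : 3 < p) (hO : (p : ℂ) ∈ O.nonunits)
    (ι : ZMod p →+* ResidueField O) (hW : IsModularPolynomial p W) (ht : ¬ (p : ℤ) ∣ t)
    (hD : ∀ c : ℤ, t ^ 2 - 4 * p ≠ -3 * c ^ 2) {τ : ℍ} (h : IsCM p t τ) {r : O}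
    (hr : (r : ℂ) = kleinJ τ) : residue O r ≠ 0 := by
  intro hr0
  have hp := (Fact.out : p.Prime)
  have hmod : p % 3 = 1 ∨ p % 3 = 2 := by
    have : p % 3 ≠ 0 := fun h =>
      hp3.ne ((Nat.prime_dvd_prime_iff_eq Nat.prime_three hp).1 (Nat.dvd_of_mod_eq_zero h))
    omega
  rcases hmod with hmod | hmod
  · obtain ⟨x, y, hxy⟩ := exists_sq_add_mul_add_sq_eq hp hmod
    obtain ⟨ζ, hζ⟩ := exists_zeta_six
    have h0 := hW.eval_eq_zero (isCM_zeta_six hζ hxy)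
    rw [kleinJ_zeta_six hζ] at h0
    have hj0 : kleinJ τ ≠ 0 := fun h' => by
      obtain ⟨c, hc⟩ := h.exists_of_kleinJ_eq_zero h'
      exact hD c hc
    have hj1 : kleinJ τ ≠ 1728 := fun h' => by
      apply residue_ofNat_ne_zero hp3 hO
      rw [← hr0]
      congr 1
      apply Subtype.ext
      rw [hr, h']
      rfl
    have h1 := hW.eval_eq_zero h
    have h2 := hW.derivative_eval h ht hj0 hj1
    rw [← hr] at h1 h2
    have h3 := hW.eq_of_residue_eq hO h1 h2 (s := 0) (by simpa using h0) (by rw [hr0, map_zero])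
    rw [h3] at hr
    exact hj0 hr.symm
  · have h27 : (27 : ZMod p) ≠ 0 := by simpa using natCast_zmod_ne_zero (p := p) hp3 0 3
    have h6 := (h.hasseCoeff_pow_eq (ι := ι) hp3 hO hr (a := 0) (b := 1) (by simpa using h27)
      (by rw [jInv_zero_left, map_zero, hr0])).2 one_ne_zero
    rw [hasseCoeff_zero_left_of_mod p _ hmod, zero_pow (by norm_num)] at h6
    exact ht ((ZMod.intCast_zmod_eq_zero_iff_dvd _ _).1
      (pow_eq_zero_iff (n := 6) (by norm_num) |>.1 h6.symm))

theorem IsCM.residue_ne (hp3 : 3 < p) (hO : (p : ℂ) ∈ O.nonunits)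
    (ι : ZMod p →+* ResidueField O) (hW : IsModularPolynomial p W) (ht : ¬ (p : ℤ) ∣ t)
    (hodd : Odd t) {τ : ℍ} (h : IsCM p t τ) {r : O}
    (hr : (r : ℂ) = kleinJ τ) : residue O r ≠ residue O 1728 := by
  intro hr0
  have hp := (Fact.out : p.Prime)
  have hmod : p % 4 = 1 ∨ p % 4 = 3 := by
    have := hp.eq_two_or_odd
    omega
  rcases hmod with hmod | hmod
  · have h0 : W.eval₂ O.subtype ((1728 : O) : ℂ) = 0 := by
      obtain ⟨x, y, hxy⟩ := Nat.Prime.sq_add_sq (p := p) (by omega)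
      have := hW.eval_eq_zero (isCM_I (p := p) (x := x) (y := y) (by exact_mod_cast hxy))
      rw [kleinJ_I] at this
      exact this
    have hj1 : kleinJ τ ≠ 1728 := fun h' =>
      Int.not_even_iff_odd.2 hodd (h.even_of_kleinJ_eq h')
    have hj0 : kleinJ τ ≠ 0 := fun h' => by
      apply residue_ofNat_ne_zero hp3 hO
      rw [← hr0, ← map_zero (residue O)]
      congr 1
      apply Subtype.ext
      rw [hr, h']
      rfl
    have h1 := hW.eval_eq_zero h
    have h2 := hW.derivative_eval h ht hj0 hj1
    rw [← hr] at h1 h2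
    have h3 := hW.eq_of_residue_eq hO h1 h2 h0 hr0
    rw [h3] at hr
    exact hj1 hr.symm
  · have h4 : (4 : ZMod p) ≠ 0 := by simpa using natCast_zmod_ne_zero (p := p) hp3 2 0
    have h6 := (h.hasseCoeff_pow_eq (ι := ι) hp3 hO hr (a := 1) (b := 0) (by simpa using h4)
      (by rw [jInv_zero_right hp3 one_ne_zero, hr0, map_ofNat ι 1728,
        map_ofNat (residue O) 1728])).1 one_ne_zero
    rw [hasseCoeff_zero_right_of_mod p _ hmod, zero_pow (by norm_num)] at h6
    exact ht ((ZMod.intCast_zmod_eq_zero_iff_dvd _ _).1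
      (pow_eq_zero_iff (n := 4) (by norm_num) |>.1 h6.symm))

theorem exists_isCM_of_apE_sq_eq (hp3 : 3 < p) (hO : (p : ℂ) ∈ O.nonunits)
    (ι : ZMod p →+* ResidueField O) (hW : IsModularPolynomial p W) (ht0 : (t : ZMod p) ≠ 0)
    (hsep : TraceSeparated p t) {a b : ZMod p} (ha : a ≠ 0) (hb : b ≠ 0)
    (hab : 4 * a ^ 3 + 27 * b ^ 2 ≠ 0) (h : apE p a b ^ 2 = t ^ 2) :
    ∃ (τ : ℍ) (r : O), IsCM p t τ ∧ (r : ℂ) = kleinJ τ ∧ residue O r = ι (jInv a b) := by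
  obtain ⟨r, hr, hrz⟩ := hW.exists_root (z := ι (jInv a b)) (by
    rw [← map_pow, ZMod.pow_card])
  obtain ⟨τ, hτ⟩ := kleinJ_surjective (r : ℂ)
  rw [← hτ] at hr
  obtain ⟨t', ht'⟩ := hW.exists_isCM hr
  have h1 := ht'.hasseCoeff_pow_eq hp3 hO hτ.symm hab hrz
  rw [apE_sq_eq_iff hp3 hsep] at h
  have h4 := h1.1 ha
  have h6 := h1.2 hb
  have hx : hasseCoeff p a b ≠ 0 := by
    intro h'
    rw [h', zero_pow two_ne_zero] at h
    exact pow_ne_zero 2 ht0 h.symm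
  have ht'0 : (t' : ZMod p) ≠ 0 := by
    intro h'
    rw [h', zero_pow four_ne_zero] at h4
    exact pow_ne_zero 4 hx h4
  have h2 := sq_eq_of_cast_pow_eq ht'0 h4 h6
  have h3 : t' ^ 2 = t ^ 2 := by
    refine hsep t' (two_mul_abs_le_of_sq_lt hp3 (ht'.sq_lt Fact.out)) ?_
    rw [← ZMod.intCast_zmod_eq_zero_iff_dvd]
    push_cast
    rw [← h2, h, sub_self]
  refine ⟨τ, r, ?_, hτ.symm, hrz⟩
  rcases sq_eq_sq_iff_eq_or_eq_neg.1 h3 with rfl | rfl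
  · exact ht'
  · simpa using ht'.neg

theorem apE_sq_eq_of_isCM (hp3 : 3 < p) (hO : (p : ℂ) ∈ O.nonunits) (ht0 : (t : ZMod p) ≠ 0)
    (hsep : TraceSeparated p t) {a b : ZMod p} (ha : a ≠ 0) (hb : b ≠ 0)
    (hab : 4 * a ^ 3 + 27 * b ^ 2 ≠ 0) {τ : ℍ} {r : O} (h : IsCM p t τ)
    (hr : (r : ℂ) = kleinJ τ) (hj : residue O r = ι (jInv a b)) : apE p a b ^ 2 = t ^ 2 := by
  have h1 := h.hasseCoeff_pow_eq hp3 hO hr hab hj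
  exact (apE_sq_eq_iff hp3 hsep).2 (sq_eq_of_cast_pow_eq ht0 (h1.1 ha) (h1.2 hb))

theorem exists_map_eq_of_pow_eq (hO : (p : ℂ) ∈ O.nonunits) (ι : ZMod p →+* ResidueField O)
    {x : ResidueField O} (hx : x ^ p = x) : ∃ z, ι z = x := by
  have := charP_residueField (Fact.out : p.Prime) hO
  obtain ⟨n, hn⟩ := (mem_bot_iff_intCast p _).1
    ((Subfield.mem_bot_iff_pow_eq_self _ p).2 hx)
  exact ⟨n, by rw [map_intCast, hn]⟩

end Reduction

end

noncomputable section

open UpperHalfPlane ModularForm MatrixGroups IsLocalRing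

section Count

variable {p : ℕ} [Fact p.Prime] {t : ℤ}

theorem jInv_ne_zero (hp3 : 3 < p) {a b : ZMod p} (ha : a ≠ 0)
    (hab : 4 * a ^ 3 + 27 * b ^ 2 ≠ 0) : jInv a b ≠ 0 := by
  have h4 : (4 : ZMod p) ≠ 0 := by simpa using natCast_zmod_ne_zero (p := p) hp3 2 0
  have h1728 : (1728 : ZMod p) ≠ 0 := by simpa using natCast_zmod_ne_zero (p := p) hp3 6 3
  exact div_ne_zero (mul_ne_zero h1728 (mul_ne_zero h4 (pow_ne_zero 3 ha))) hab

theorem sub_jInv (a b : ZMod p) (hab : 4 * a ^ 3 + 27 * b ^ 2 ≠ 0) :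
    1728 - jInv a b = 1728 * 27 * b ^ 2 / (4 * a ^ 3 + 27 * b ^ 2) := by
  unfold jInv
  rw [eq_div_iff hab, sub_mul, div_mul_cancel₀ _ hab]
  ring

theorem jInv_twist_eq (hp3 : 3 < p) {d z : ZMod p} (hd : d ≠ 0) (hz0 : z ≠ 0) (hz : z ≠ 1728) :
    27 * z / (4 * (1728 - z)) ≠ 0 ∧
      4 * (d ^ 2 * (27 * z / (4 * (1728 - z)))) ^ 3 +
        27 * (d ^ 3 * (27 * z / (4 * (1728 - z)))) ^ 2 ≠ 0 ∧
      jInv (d ^ 2 * (27 * z / (4 * (1728 - z)))) (d ^ 3 * (27 * z / (4 * (1728 - z)))) = z := by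
  have h27 : (27 : ZMod p) ≠ 0 := by simpa using natCast_zmod_ne_zero (p := p) hp3 0 3
  have h4 : (4 : ZMod p) ≠ 0 := by simpa using natCast_zmod_ne_zero (p := p) hp3 2 0
  have h1728 : (1728 : ZMod p) ≠ 0 := by simpa using natCast_zmod_ne_zero (p := p) hp3 6 3
  have hz1 : 1728 - z ≠ 0 := fun h => hz (sub_eq_zero.1 h).symm
  obtain ⟨s, hs⟩ : ∃ s, s = 27 * z / (4 * (1728 - z)) := ⟨_, rfl⟩
  rw [← hs]
  have hs0 : s ≠ 0 := by
    rw [hs]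
    exact div_ne_zero (mul_ne_zero h27 hz0) (mul_ne_zero h4 hz1)
  have hs1 : s * (4 * (1728 - z)) = 27 * z := by
    rw [hs, div_mul_cancel₀ _ (mul_ne_zero h4 hz1)]
  have hs2 : (4 * s + 27) * (1728 - z) = 27 * 1728 := by linear_combination hs1
  have hs3 : 4 * s + 27 ≠ 0 := by
    intro h
    rw [h, zero_mul] at hs2
    exact mul_ne_zero h27 h1728 hs2.symm
  have hdisc : 4 * (d ^ 2 * s) ^ 3 + 27 * (d ^ 3 * s) ^ 2 = d ^ 6 * s ^ 2 * (4 * s + 27) := by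
    ring
  have hdisc0 : d ^ 6 * s ^ 2 * (4 * s + 27) ≠ 0 :=
    mul_ne_zero (mul_ne_zero (pow_ne_zero 6 hd) (pow_ne_zero 2 hs0)) hs3
  refine ⟨hs0, hdisc ▸ hdisc0, ?_⟩
  rw [jInv, hdisc, div_eq_iff hdisc0]
  linear_combination d ^ 6 * s ^ 2 * hs1

/-- Curves with invariant in `T` are parametrised by `b / a` and their invariant. -/
def jInvEquiv (hp3 : 3 < p) (T : Set (ZMod p)) (h0 : 0 ∉ T) (h1728 : 1728 ∉ T) :
    {ab : ZMod p × ZMod p // ab.1 ≠ 0 ∧ ab.2 ≠ 0 ∧ 4 * ab.1 ^ 3 + 27 * ab.2 ^ 2 ≠ 0 ∧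
      jInv ab.1 ab.2 ∈ T} ≃ (ZMod p)ˣ × T where
  toFun x := (Units.mk0 (x.1.2 / x.1.1) (div_ne_zero x.2.2.1 x.2.1), ⟨_, x.2.2.2.2⟩)
  invFun y := ⟨(y.1 ^ 2 * (27 * y.2 / (4 * (1728 - y.2))),
      y.1 ^ 3 * (27 * y.2 / (4 * (1728 - y.2)))), by
    obtain ⟨d, z, hz⟩ := y
    have h := jInv_twist_eq hp3 d.ne_zero (fun h => h0 (h ▸ hz)) (fun h => h1728 (h ▸ hz))
    exact ⟨mul_ne_zero (pow_ne_zero 2 d.ne_zero) h.1, mul_ne_zero (pow_ne_zero 3 d.ne_zero) h.1,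
      h.2.1, by rwa [h.2.2]⟩⟩
  left_inv := by
    rintro ⟨⟨a, b⟩, ha, hb, hab, hj⟩
    dsimp only at ha hb hab hj
    have h27 : (27 : ZMod p) ≠ 0 := by simpa using natCast_zmod_ne_zero (p := p) hp3 0 3
    have h4 : (4 : ZMod p) ≠ 0 := by simpa using natCast_zmod_ne_zero (p := p) hp3 2 0
    have h1728' : (1728 : ZMod p) ≠ 0 := by simpa using natCast_zmod_ne_zero (p := p) hp3 6 3
    have hs : 27 * jInv a b / (4 * (1728 - jInv a b)) = a ^ 3 / b ^ 2 := by
      rw [sub_jInv a b hab, jInv]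
      field_simp
    apply Subtype.ext
    simp only [Units.val_mk0]
    rw [hs]
    ext
    · dsimp only
      field_simp
    · dsimp only
      field_simp
  right_inv := by
    rintro ⟨d, z, hz⟩
    have h := jInv_twist_eq hp3 d.ne_zero (fun h => h0 (h ▸ hz)) (fun h => h1728 (h ▸ hz))
    refine Prod.ext (Units.ext ?_) (Subtype.ext h.2.2)
    have hd : (d : ZMod p) ≠ 0 := d.ne_zero
    refine (div_eq_iff (mul_ne_zero (pow_ne_zero 2 hd) h.1)).2 ?_
    dsimp only
    ring

theorem card_jInv_mem (hp3 : 3 < p) (T : Set (ZMod p)) (h0 : 0 ∉ T) (h1728 : 1728 ∉ T) :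
    {ab : ZMod p × ZMod p | ab.1 ≠ 0 ∧ ab.2 ≠ 0 ∧ 4 * ab.1 ^ 3 + 27 * ab.2 ^ 2 ≠ 0 ∧
      jInv ab.1 ab.2 ∈ T}.ncard = (p - 1) * T.ncard := by
  rw [← Nat.card_coe_set_eq, ← Nat.card_coe_set_eq]
  refine (Nat.card_congr (jInvEquiv hp3 T h0 h1728)).trans ?_
  rw [Nat.card_prod, Nat.card_eq_fintype_card, ZMod.card_units]

theorem ncard_apE_neg (hp3 : 3 < p) (t : ℤ) :
    {ab : ZMod p × ZMod p | 4 * ab.1 ^ 3 + 27 * ab.2 ^ 2 ≠ 0 ∧ apE p ab.1 ab.2 = -t}.ncard =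
      {ab : ZMod p × ZMod p | 4 * ab.1 ^ 3 + 27 * ab.2 ^ 2 ≠ 0 ∧ apE p ab.1 ab.2 = t}.ncard := by
  have hle : ∀ t : ℤ,
      {ab : ZMod p × ZMod p | 4 * ab.1 ^ 3 + 27 * ab.2 ^ 2 ≠ 0 ∧ apE p ab.1 ab.2 = t}.ncard ≤
      {ab : ZMod p × ZMod p | 4 * ab.1 ^ 3 + 27 * ab.2 ^ 2 ≠ 0 ∧ apE p ab.1 ab.2 = -t}.ncard := by
    intro t
    obtain ⟨d, hd⟩ := quadraticChar_exists_neg_one (F := ZMod p) (by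
      rw [ZMod.ringChar_zmod_n]
      omega)
    have hd0 : d ≠ 0 := by
      rintro rfl
      simp at hd
    refine Set.ncard_le_ncard_of_injOn (fun ab => (d ^ 2 * ab.1, d ^ 3 * ab.2)) ?_ ?_
      (Set.toFinite _)
    · rintro ⟨a, b⟩ ⟨hab, h⟩
      refine ⟨?_, ?_⟩
      · have : 4 * (d ^ 2 * a) ^ 3 + 27 * (d ^ 3 * b) ^ 2 =
          d ^ 6 * (4 * a ^ 3 + 27 * b ^ 2) := by ring
        dsimp only
        rw [this]
        exact mul_ne_zero (pow_ne_zero 6 hd0) hab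
      · dsimp only at h ⊢
        rw [apE_twist p hp3 a b d hd0, hd, h, neg_one_mul]
    · rintro ⟨a, b⟩ - ⟨a', b'⟩ - h
      simp only [Prod.mk.injEq] at h
      exact Prod.ext (mul_left_cancel₀ (pow_ne_zero 2 hd0) h.1)
        (mul_left_cancel₀ (pow_ne_zero 3 hd0) h.2)
  refine le_antisymm ?_ (hle t)
  simpa using hle (-t)

theorem ncard_apE_sq (hp3 : 3 < p) (ht : t ≠ 0) :
    {ab : ZMod p × ZMod p | 4 * ab.1 ^ 3 + 27 * ab.2 ^ 2 ≠ 0 ∧ apE p ab.1 ab.2 ^ 2 = t ^ 2}.ncard =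
      2 * {ab : ZMod p × ZMod p |
        4 * ab.1 ^ 3 + 27 * ab.2 ^ 2 ≠ 0 ∧ apE p ab.1 ab.2 = t}.ncard := by
  rw [two_mul]
  nth_rewrite 2 [← ncard_apE_neg hp3 t]
  rw [← Set.ncard_union_eq _ (Set.toFinite _) (Set.toFinite _)]
  · congr 1
    ext ab
    simp only [Set.mem_ofPred_eq, Set.mem_union, sq_eq_sq_iff_eq_or_eq_neg]
    tauto
  · rw [Set.disjoint_left]
    rintro ab ⟨-, h⟩ ⟨-, h'⟩
    omega

variable {O : ValuationSubring ℂ} {W : Polynomial O}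

/-- The invariants over `ZMod p` that lift to an element of `cmSet p t`. -/
def reducedCMSet (p : ℕ) (t : ℤ) {O : ValuationSubring ℂ} (ι : ZMod p →+* ResidueField O) :
    Set (ZMod p) :=
  {z | ∃ (τ : ℍ) (r : O), IsCM p t τ ∧ (r : ℂ) = kleinJ τ ∧ residue O r = ι z}

theorem ncard_reducedCMSet (hp3 : 3 < p) (hO : (p : ℂ) ∈ O.nonunits)
    (ι : ZMod p →+* ResidueField O) (hW : IsModularPolynomial p W) (ht : ¬ (p : ℤ) ∣ t)
    (hodd : Odd t) (hD : ∀ c : ℤ, t ^ 2 - 4 * p ≠ -3 * c ^ 2) :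
    (reducedCMSet p t ι).ncard = (cmSet p t).ncard := by
  have key : ∀ z ∈ cmSet p t, ∃ r : O, (r : ℂ) = z ∧ ∃ x, ι x = residue O r := by
    rintro _ ⟨τ, hτ, rfl⟩
    have h1 := hW.eval_eq_zero hτ
    refine ⟨⟨_, hW.mem h1⟩, rfl, ?_⟩
    exact exists_map_eq_of_pow_eq hO ι (hW.eval_residue h1)
  choose! r hr x hx using key
  symm
  refine Set.ncard_congr (fun z _ => x z) ?_ ?_ ?_
  · intro z hz
    obtain ⟨τ, hτ, rfl⟩ := id hz
    exact ⟨τ, r _, hτ, hr _ hz, (hx _ hz).symm⟩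
  · intro z z' hz hz' h
    have hres : residue O (r z) = residue O (r z') := by rw [← hx _ hz, ← hx _ hz', h]
    obtain ⟨τ, hτ, rfl⟩ := id hz
    obtain ⟨τ', hτ', rfl⟩ := id hz'
    have h0 : kleinJ τ ≠ 0 := fun h0 => by
      refine hτ.residue_ne_zero hp3 hO ι hW ht hD (hr _ hz) ?_
      rw [show r (kleinJ τ) = 0 from Subtype.ext ((hr _ hz).trans h0), map_zero]
    have h1728 : kleinJ τ ≠ 1728 := fun h1 => by
      refine hτ.residue_ne hp3 hO ι hW ht hodd (hr _ hz) ?_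
      rw [show r (kleinJ τ) = 1728 from Subtype.ext ((hr _ hz).trans h1)]
    have := hW.eq_of_residue_eq hO (by rw [hr _ hz]; exact hW.eval_eq_zero hτ)
      (by rw [hr _ hz]; exact hW.derivative_eval hτ ht h0 h1728)
      (by rw [hr _ hz']; exact hW.eval_eq_zero hτ') hres
    rw [← hr _ hz, ← hr _ hz', this]
  · rintro y ⟨τ, s, hτ, hs, hy⟩
    have hz : kleinJ τ ∈ cmSet p t := ⟨τ, hτ, rfl⟩
    refine ⟨_, hz, ι.injective ?_⟩
    rw [hx _ hz, ← hy, show r (kleinJ τ) = s from Subtype.ext ((hr _ hz).trans hs.symm)]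

/-- Away from discriminant `-3`, twice the number of equations of trace `t` is `p - 1` times the
number of complex invariants with multiplication of trace `t`. -/
theorem two_mul_ncard_apE (hp3 : 3 < p) (hO : (p : ℂ) ∈ O.nonunits)
    (ι : ZMod p →+* ResidueField O) (hW : IsModularPolynomial p W) (ht : ¬ (p : ℤ) ∣ t)
    (hodd : Odd t) (hsep : TraceSeparated p t) (hD : ∀ c : ℤ, t ^ 2 - 4 * p ≠ -3 * c ^ 2) :
    2 * {ab : ZMod p × ZMod p |
        4 * ab.1 ^ 3 + 27 * ab.2 ^ 2 ≠ 0 ∧ apE p ab.1 ab.2 = t}.ncard =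
      (p - 1) * (cmSet p t).ncard := by
  have ht0 : (t : ZMod p) ≠ 0 := by rwa [Ne, ZMod.intCast_zmod_eq_zero_iff_dvd]
  rw [← ncard_reducedCMSet hp3 hO ι hW ht hodd hD, ← card_jInv_mem hp3, ← ncard_apE_sq hp3]
  · congr 1
    ext ⟨a, b⟩
    simp only [Set.mem_ofPred_eq]
    constructor
    · rintro ⟨hab, h⟩
      have hb : b ≠ 0 := by
        rintro rfl
        have := (apE_even_of_b_zero p hp3 a).pow_of_ne_zero two_ne_zero
        rw [h] at this
        exact Int.not_even_iff_odd.2 hodd.pow this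
      have ha : a ≠ 0 := by
        rintro rfl
        exact apE_zero_left_sq_ne hp3 hO ι ht0 hsep hD hb h
      exact ⟨ha, hb, hab, exists_isCM_of_apE_sq_eq hp3 hO ι hW ht0 hsep ha hb hab h⟩
    · rintro ⟨ha, hb, hab, τ, r, hτ, hr, hz⟩
      exact ⟨hab, apE_sq_eq_of_isCM hp3 hO ht0 hsep ha hb hab hτ hr hz⟩
  · rintro rfl
    simp at hodd
  · rintro ⟨τ, r, hτ, hr, hz⟩
    exact hτ.residue_ne_zero hp3 hO ι hW ht hD hr (by rw [hz, map_zero])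
  · rintro ⟨τ, r, hτ, hr, hz⟩
    exact hτ.residue_ne hp3 hO ι hW ht hodd hr
      (by rw [hz, map_ofNat ι 1728, map_ofNat (residue O) 1728])

end Count

end

noncomputable section

open UpperHalfPlane ModularForm MatrixGroups IsLocalRing

section CountThree

theorem kleinJ_eq_zero_of_isCM {p : ℕ} {m : ℤ} {τ : ℍ} (h : IsCM p (2 * m + 1) τ)
    (hm : m ^ 2 + m + 1 = p) : kleinJ τ = 0 := by
  obtain ⟨A, B, C, D, h1, h2, h3⟩ := h
  refine kleinJ_eq_zero_of_fixed (A := A - m) (B := B) (C := C) (D := D - m) ?_ ?_ ?_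
  · linear_combination h1 - m * h2 - hm
  · linear_combination h2
  · push_cast
    linear_combination h3

variable {p : ℕ} [Fact p.Prime] {t : ℤ}

theorem ncard_pow_eq {k l : ℕ} (hk : l * k = p - 1) {u : ZMod p} (hu : u ^ l = 1) :
    {b : ZMod p | b ^ k = u}.ncard = k := by
  have hp1 : 0 < p - 1 := by
    have := (Fact.out : p.Prime).two_le
    omega
  have hl0 : l ≠ 0 := by
    rintro rfl
    omega
  have hk0 : k ≠ 0 := by
    rintro rfl
    omega
  have := NeZero.mk hl0
  obtain ⟨g, hg⟩ := IsCyclic.exists_generator (α := (ZMod p)ˣ)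
  have hgo : orderOf g = p - 1 := by
    rw [orderOf_eq_card_of_forall_mem_zpowers hg, Nat.card_eq_fintype_card, ZMod.card_units]
  have hprim : IsPrimitiveRoot (g : ZMod p) (p - 1) := by
    rw [IsPrimitiveRoot.coe_units_iff, ← hgo]
    exact IsPrimitiveRoot.orderOf g
  have hprimk : IsPrimitiveRoot ((g : ZMod p) ^ l) k := hprim.pow hp1 hk.symm
  have hpriml : IsPrimitiveRoot ((g : ZMod p) ^ k) l := hprim.pow hp1 (by rw [← hk, mul_comm])
  obtain ⟨i, -, hi⟩ := hpriml.eq_pow_of_pow_eq_one hu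
  have hv : (g : ZMod p) ^ i ≠ 0 := pow_ne_zero i g.ne_zero
  have hset : {b : ZMod p | b ^ k = u} = (fun w => (g : ZMod p) ^ i * w) ''
      (Polynomial.nthRootsFinset k (1 : ZMod p) : Set (ZMod p)) := by
    ext b
    simp only [Set.mem_ofPred_eq, Set.mem_image, Finset.mem_coe,
      Polynomial.mem_nthRootsFinset (Nat.pos_of_ne_zero hk0)]
    rw [← hi]
    constructor
    · intro h
      refine ⟨b / g ^ i, ?_, mul_div_cancel₀ _ hv⟩
      rw [div_pow, h, ← pow_mul, ← pow_mul, mul_comm i k, div_self (pow_ne_zero _ g.ne_zero)]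
    · rintro ⟨w, hw, rfl⟩
      rw [mul_pow, hw, mul_one, ← pow_mul, ← pow_mul, mul_comm]
  rw [hset, Set.ncard_image_of_injective _ (mul_right_injective₀ hv), Set.ncard_coe_finset,
    hprimk.card_nthRootsFinset]

variable {O : ValuationSubring ℂ} {W : Polynomial O}

theorem ncard_apE_of_eq_neg_three (hp3 : 3 < p) (hO : (p : ℂ) ∈ O.nonunits)
    (ι : ZMod p →+* ResidueField O) (hW : IsModularPolynomial p W) (ht : ¬ (p : ℤ) ∣ t)
    (hodd : Odd t) (hsep : TraceSeparated p t) (hD : t ^ 2 - 4 * p = -3) :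
    6 * {ab : ZMod p × ZMod p |
        4 * ab.1 ^ 3 + 27 * ab.2 ^ 2 ≠ 0 ∧ apE p ab.1 ab.2 = t}.ncard = p - 1 := by
  have hp := (Fact.out : p.Prime)
  have ht0 : (t : ZMod p) ≠ 0 := by rwa [Ne, ZMod.intCast_zmod_eq_zero_iff_dvd]
  have h2 : (2 : ZMod p) ≠ 0 := by simpa using natCast_zmod_ne_zero (p := p) hp3 1 0
  have h27 : (27 : ZMod p) ≠ 0 := by simpa using natCast_zmod_ne_zero (p := p) hp3 0 3
  obtain ⟨m, rfl⟩ := id hodd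
  have hm : m ^ 2 + m + 1 = p := by linarith
  have hmod : p % 6 = 1 := by
    have h3 : p % 3 ≠ 0 := fun h =>
      hp3.ne ((Nat.prime_dvd_prime_iff_eq Nat.prime_three hp).1 (Nat.dvd_of_mod_eq_zero h))
    have h3' : (p : ℤ) % 3 ≠ 2 := by
      rw [← hm]
      have : m % 3 = 0 ∨ m % 3 = 1 ∨ m % 3 = 2 := by omega
      rcases this with h | h | h <;> simp [Int.add_emod, pow_two, Int.mul_emod, h]
    have := hp.eq_two_or_odd
    omega
  have hk : 6 * ((p - 1) / 6) = p - 1 := by omega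
  have hc6 := hasseCoeff_zero_left_pow_eq hp3 hO ι (x := m) (y := 1) (by linarith) one_ne_zero
  obtain ⟨c, hc⟩ : ∃ c, c = hasseCoeff p (0 : ZMod p) 1 := ⟨_, rfl⟩
  rw [← hc] at hc6
  have hc0 : c ≠ 0 := by
    rintro rfl
    rw [zero_pow (by norm_num)] at hc6
    exact pow_ne_zero 6 ht0 hc6.symm
  have key : ∀ b : ZMod p, apE p 0 b = 2 * m + 1 ↔
      b ^ ((p - 1) / 6) = ((2 * m + 1 : ℤ) : ZMod p) / c := by
    intro b
    rw [eq_div_iff hc0, mul_comm (b ^ _), hc, ← hasseCoeff_zero_left p b hmod, ← apE_cast p hp3]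
    refine ⟨fun h => by rw [h], fun h => ?_⟩
    have hsq : apE p 0 b ^ 2 = (2 * m + 1) ^ 2 := by
      rw [apE_sq_eq_iff hp3 hsep, ← apE_cast p hp3, h]
    rcases sq_eq_sq_iff_eq_or_eq_neg.1 hsq with h' | h'
    · exact h'
    · rw [h', Int.cast_neg, neg_eq_iff_add_eq_zero, ← two_mul] at h
      exact absurd h (mul_ne_zero h2 ht0)
  have hset : {ab : ZMod p × ZMod p | 4 * ab.1 ^ 3 + 27 * ab.2 ^ 2 ≠ 0 ∧
      apE p ab.1 ab.2 = 2 * m + 1} = (fun b => (0, b)) ''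
        {b : ZMod p | b ^ ((p - 1) / 6) = ((2 * m + 1 : ℤ) : ZMod p) / c} := by
    ext ⟨a, b⟩
    simp only [Set.mem_ofPred_eq, Set.mem_image, Prod.mk.injEq]
    constructor
    · rintro ⟨hab, h⟩
      have hb : b ≠ 0 := by
        rintro rfl
        have := apE_even_of_b_zero p hp3 a
        rw [h] at this
        exact Int.not_even_iff_odd.2 hodd this
      have ha : a = 0 := by
        by_contra ha
        obtain ⟨τ, r, hτ, hr, hz⟩ := exists_isCM_of_apE_sq_eq hp3 hO ι hW ht0 hsep ha hb hab
          (by rw [h])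
        rw [kleinJ_eq_zero_of_isCM hτ hm] at hr
        have hr0 : r = 0 := Subtype.ext hr
        rw [hr0, map_zero, eq_comm, map_eq_zero] at hz
        exact jInv_ne_zero hp3 ha hab hz
      subst ha
      exact ⟨b, (key b).1 h, rfl, rfl⟩
    · rintro ⟨b, hb, rfl, rfl⟩
      refine ⟨?_, (key b).2 hb⟩
      have hb0 : b ≠ 0 := by
        rintro rfl
        rw [zero_pow (by omega)] at hb
        exact div_ne_zero ht0 hc0 hb.symm
      rw [zero_pow three_ne_zero, mul_zero, zero_add]
      exact mul_ne_zero h27 (pow_ne_zero 2 hb0)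
  rw [hset, Set.ncard_image_of_injective _ (fun x y h => (Prod.ext_iff.1 h).2),
    ncard_pow_eq hk, hk]
  rw [div_pow, ← hc6, div_self (pow_ne_zero 6 hc0)]

end CountThree

end

noncomputable section

open UpperHalfPlane ModularForm MatrixGroups IsLocalRing

section ClassNumberOne

variable {p : ℕ} {t : ℤ} {τ : ℍ}

theorem quadratic_unique {c : ℂ} {σ σ' : ℍ} (h : (σ : ℂ) ^ 2 + σ + c = 0)
    (h' : (σ' : ℂ) ^ 2 + σ' + c = 0) : σ = σ' := by
  have h1 : ((σ : ℂ) - σ') * (σ + σ' + 1) = 0 := by linear_combination h - h'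
  rcases mul_eq_zero.1 h1 with h2 | h2
  · exact UpperHalfPlane.ext (sub_eq_zero.1 h2)
  · have h3 := congrArg Complex.im h2
    have e1 := σ.im_pos
    have e2 := σ'.im_pos
    simp at h3
    linarith

theorem IsCM.exists_quadratic {n : ℤ} (h : IsCM p t τ) (hn : n = 3 ∨ n = 5)
    (hD : t ^ 2 - 4 * p = 1 - 4 * n) :
    ∃ σ : ℍ, (σ : ℂ) ^ 2 + σ + n = 0 ∧ kleinJ σ = kleinJ τ := by
  obtain ⟨γ, hγ⟩ := ModularGroup.exists_smul_mem_fd τ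
  have h' := h.smul γ
  obtain ⟨ρ, hρ⟩ : ∃ ρ, ρ = γ • τ := ⟨_, rfl⟩
  rw [← hρ] at h' hγ
  have hj : kleinJ ρ = kleinJ τ := kleinJ_eq_iff.2 ⟨γ, hρ.symm⟩
  rw [← hj]
  clear hj h hρ
  obtain ⟨A, B, C, D, h1, rfl, h2⟩ := h'
  have hρ := ρ.im_pos
  have him := congrArg Complex.im h2
  have hre := congrArg Complex.re h2
  simp at him hre
  obtain ⟨hN, hR⟩ := hγ
  rw [Complex.normSq_apply] at hN
  simp only [coe_re, coe_im] at hN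
  obtain ⟨x, hx⟩ : ∃ x, x = ρ.re := ⟨_, rfl⟩
  obtain ⟨y, hy⟩ : ∃ y, y = ρ.im := ⟨_, rfl⟩
  rw [← hx, ← hy] at him hre hN
  rw [← hx] at hR
  rw [← hy] at hρ
  have e1 : 2 * C * x = A - D := by
    apply mul_right_cancel₀ hρ.ne'
    linear_combination -him
  have e2 : C * (x * x + y * y) = -B := by
    linear_combination hre + x * e1
  have hx2 : 4 * x ^ 2 ≤ 1 := by
    have := abs_le.1 hR
    nlinarith
  have i1 : (D - A) ^ 2 ≤ C ^ 2 := by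
    have : ((D : ℝ) - A) ^ 2 ≤ C ^ 2 := by
      rw [show ((D : ℝ) - A) ^ 2 = C ^ 2 * (4 * x ^ 2) by
        linear_combination -(2 * C * x + (A - D)) * e1]
      exact mul_le_of_le_one_right (sq_nonneg _) hx2
    exact_mod_cast this
  have i2 : C ^ 2 ≤ -(B * C) := by
    have : (C : ℝ) ^ 2 ≤ -(B * C) := by
      rw [show -((B : ℝ) * C) = C ^ 2 * (x * x + y * y) by linear_combination -C * e2]
      exact le_mul_of_one_le_right (sq_nonneg _) hN
    exact_mod_cast this
  have i3 : (D - A) ^ 2 + 4 * (B * C) = 1 - 4 * n := by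
    rw [← hD, ← h1]
    ring
  have hC2 : C ^ 2 ≤ 6 := by omega
  have hC : -2 ≤ C ∧ C ≤ 2 := ⟨by nlinarith, by nlinarith⟩
  obtain ⟨b, hb⟩ : ∃ b, b = D - A := ⟨_, rfl⟩
  have hq : (C : ℂ) * ρ ^ 2 + b * ρ - B = 0 := by
    rw [hb]
    push_cast
    linear_combination -h2
  rw [← hb] at i1 i3
  have hb' : -2 ≤ b ∧ b ≤ 2 := ⟨by nlinarith [hC.1, hC.2], by nlinarith [hC.1, hC.2]⟩
  have hfin : (C = 1 ∨ C = -1) ∧ B = -(C * n) ∧ (b = C ∨ b = -C) := by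
    obtain ⟨l1, l2⟩ := hC
    obtain ⟨l3, l4⟩ := hb'
    rcases hn with rfl | rfl <;> interval_cases C <;> interval_cases b <;> omega
  obtain ⟨hC1, rfl, hbC⟩ := hfin
  have hC0 : (C : ℂ) ≠ 0 := by
    rcases hC1 with rfl | rfl <;> norm_num
  rcases hbC with rfl | rfl
  · refine ⟨ρ, mul_left_cancel₀ hC0 ?_, rfl⟩
    push_cast at hq
    linear_combination hq
  · refine ⟨ModularGroup.T ^ (-1 : ℤ) • ρ, mul_left_cancel₀ hC0 ?_, kleinJ_eq_iff.2 ⟨_, rfl⟩⟩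
    rw [ModularGroup.coe_T_zpow_smul_eq]
    push_cast at hq ⊢
    linear_combination hq

theorem ncard_cmSet_le_one {n : ℤ} (hn : n = 3 ∨ n = 5) (hD : t ^ 2 - 4 * p = 1 - 4 * n) :
    (cmSet p t).ncard ≤ 1 := by
  have h : (cmSet p t).Subsingleton := by
    rintro _ ⟨τ, hτ, rfl⟩ _ ⟨τ', hτ', rfl⟩
    obtain ⟨σ, h1, h2⟩ := hτ.exists_quadratic hn hD
    obtain ⟨σ', h1', h2'⟩ := hτ'.exists_quadratic hn hD
    rw [← h2, ← h2', quadratic_unique h1 h1']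
  exact (Set.ncard_le_one h.finite).2 fun a ha b hb => h ha hb

theorem ncard_cmSet_le_one_of_eq_neg_three (hodd : Odd t) (hD : t ^ 2 - 4 * p = -3) :
    (cmSet p t).ncard ≤ 1 := by
  obtain ⟨m, rfl⟩ := hodd
  have h : ∀ z ∈ cmSet p (2 * m + 1), z = 0 := by
    rintro _ ⟨τ, hτ, rfl⟩
    exact kleinJ_eq_zero_of_isCM hτ (by linarith)
  have hs : cmSet p (2 * m + 1) ⊆ {0} := h
  exact (Set.ncard_le_ncard hs).trans (Set.ncard_singleton _).le

end ClassNumberOne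

end

noncomputable section

section SmallPrimes

variable {p : ℕ} [Fact p.Prime] {t : ℤ}

/-- The number of affine points of `y ^ 2 = x ^ 3 + a * x + b` modulo `p`, by Euler's criterion. -/
def eulerCount (p a b : ℕ) : ℕ :=
  ∑ x ∈ Finset.range p, ((x ^ 3 + a * x + b) ^ (p / 2) % p + 1) % p

theorem natCast_euler (hp3 : 3 < p) (n : ℕ) :
    (((n ^ (p / 2) % p + 1) % p : ℕ) : ℤ) = quadraticChar (ZMod p) n + 1 := by
  have hp := (Fact.out : p.Prime)
  have hlt : n ^ (p / 2) % p < p := Nat.mod_lt _ hp.pos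
  have hcast : ((n ^ (p / 2) % p : ℕ) : ZMod p) = (n : ZMod p) ^ (p / 2) := by
    rw [ZMod.natCast_mod, Nat.cast_pow]
  have hchar : ringChar (ZMod p) ≠ 2 := by
    rw [ZMod.ringChar_zmod_n]
    omega
  have hpow := quadraticChar_eq_pow_of_char_ne_two' hchar (n : ZMod p)
  rw [ZMod.card, ← hcast] at hpow
  generalize n ^ (p / 2) % p = r at hlt hpow
  have hval : ∀ m : ℕ, m < p → ((r : ℕ) : ZMod p) = m → r = m := fun m hm h => by
    have := congrArg ZMod.val h
    rwa [ZMod.val_natCast_of_lt hlt, ZMod.val_natCast_of_lt hm] at this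
  by_cases h0 : (n : ZMod p) = 0
  · rw [h0, quadraticChar_zero] at hpow ⊢
    rw [hval 0 hp.pos (by rw [← hpow]; simp), zero_add, Nat.mod_eq_of_lt hp.one_lt]
    rfl
  · rcases quadraticChar_dichotomy h0 with h | h
    · rw [h] at hpow ⊢
      rw [hval 1 hp.one_lt (by rw [← hpow]; simp), Nat.mod_eq_of_lt (by omega)]
      rfl
    · rw [h] at hpow ⊢
      rw [hval (p - 1) (by omega) (by
        rw [← hpow, Nat.cast_sub hp.one_lt.le, CharP.cast_eq_zero]
        simp), Nat.sub_add_cancel hp.one_lt.le, Nat.mod_self]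
      rfl

theorem bijOn_natCast : Set.BijOn (fun n : ℕ => (n : ZMod p)) (Finset.range p) Set.univ := by
  have hp := (Fact.out : p.Prime)
  refine ⟨fun _ _ => trivial, ?_, fun x _ => ⟨x.val, ?_, ZMod.natCast_zmod_val x⟩⟩
  · intro m hm n hn h
    simp only [Finset.coe_range, Set.mem_Iio] at hm hn
    have := congrArg ZMod.val h
    rwa [ZMod.val_natCast_of_lt hm, ZMod.val_natCast_of_lt hn] at this
  · simpa using ZMod.val_lt x

theorem apE_natCast (hp3 : 3 < p) (a b : ℕ) : apE p a b = p - eulerCount p a b := by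
  have h : ∑ x ∈ Finset.range p, quadraticChar (ZMod p) ((x ^ 3 + a * x + b : ℕ) : ZMod p) =
      ∑ x : ZMod p, quadraticChar (ZMod p) (x ^ 3 + a * x + b) := by
    refine Finset.sum_nbij (fun n : ℕ => (n : ZMod p)) (fun _ _ => Finset.mem_univ _)
      bijOn_natCast.injOn ?_ fun x _ => by push_cast; rfl
    rw [Finset.coe_univ]
    exact bijOn_natCast.surjOn
  rw [apE_eq_neg_sum p (by omega), eulerCount, ← h]
  push_cast [natCast_euler hp3, Finset.sum_add_distrib]
  simp

theorem ncard_apE_eq_card (hp3 : 3 < p) {n : ℕ} (hn : t + n = p) :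
    {ab : ZMod p × ZMod p | 4 * ab.1 ^ 3 + 27 * ab.2 ^ 2 ≠ 0 ∧ apE p ab.1 ab.2 = t}.ncard =
      ((Finset.range p ×ˢ Finset.range p).filter fun ab =>
        (4 * ab.1 ^ 3 + 27 * ab.2 ^ 2) % p ≠ 0 ∧ eulerCount p ab.1 ab.2 = n).card := by
  rw [← Set.ncard_coe_finset]
  have key : ∀ a b : ℕ, (4 * (a : ZMod p) ^ 3 + 27 * (b : ZMod p) ^ 2 ≠ 0 ∧ apE p a b = t) ↔
      ((4 * a ^ 3 + 27 * b ^ 2) % p ≠ 0 ∧ eulerCount p a b = n) := by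
    intro a b
    rw [apE_natCast hp3, Ne, Ne, ← Nat.dvd_iff_mod_eq_zero, ← ZMod.natCast_eq_zero_iff]
    push_cast
    refine and_congr Iff.rfl ?_
    omega
  symm
  refine Set.ncard_congr (fun ab _ => ((ab.1 : ZMod p), (ab.2 : ZMod p))) ?_ ?_ ?_
  · rintro ⟨a, b⟩ h
    simp only [Finset.coe_filter, Set.mem_ofPred_eq] at h
    exact (key a b).2 h.2
  · rintro ⟨a, b⟩ ⟨a', b'⟩ h h' he
    simp only [Finset.coe_filter, Set.mem_ofPred_eq, Finset.mem_product] at h h'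
    simp only [Prod.mk.injEq] at he
    exact Prod.ext (bijOn_natCast.injOn h.1.1 h'.1.1 he.1)
      (bijOn_natCast.injOn h.1.2 h'.1.2 he.2)
  · rintro ⟨x, y⟩ h
    obtain ⟨a, ha, rfl⟩ := bijOn_natCast.surjOn (Set.mem_univ x)
    obtain ⟨b, hb, rfl⟩ := bijOn_natCast.surjOn (Set.mem_univ y)
    refine ⟨(a, b), ?_, rfl⟩
    simp only [Finset.coe_filter, Set.mem_ofPred_eq, Finset.mem_product]
    exact ⟨⟨ha, hb⟩, (key a b).1 h⟩

theorem traceSeparated_or (hp3 : 3 < p) (ht : t ^ 2 < 4 * p) (hodd : Odd t)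
    (hsf : Squarefree (t ^ 2 - 4 * p)) : TraceSeparated p t ∨
      (p = 17 ∧ |t| = 7) ∨ (p = 13 ∧ |t| = 7) ∨ (p = 11 ∧ |t| = 5) ∨ (p = 7 ∧ |t| = 3) ∨
        (p = 7 ∧ |t| = 5) ∨ (p = 5 ∧ |t| = 1) ∨ (p = 5 ∧ |t| = 3) := by
  have hp := (Fact.out : p.Prime)
  refine or_iff_not_imp_left.2 fun hsep => ?_
  obtain ⟨a, ha, hdvd, hne⟩ : ∃ a : ℤ, 2 * |a| ≤ p + 3 ∧ (p : ℤ) ∣ a ^ 2 - t ^ 2 ∧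
      a ^ 2 ≠ t ^ 2 := by
    unfold TraceSeparated at hsep
    push Not at hsep
    exact hsep
  have hpos : (3 : ℤ) < p := by exact_mod_cast hp3
  have hlow : (p : ℤ) ≤ |a| + |t| := by
    rw [sq_sub_sq] at hdvd
    rcases (Nat.prime_iff_prime_int.1 hp).dvd_or_dvd hdvd with h | h
    · refine (Int.le_of_dvd (abs_pos.2 fun h0 => hne ?_) ((dvd_abs _ _).2 h)).trans
        (abs_add_le a t)
      linear_combination (a - t) * h0
    · refine (Int.le_of_dvd (abs_pos.2 fun h0 => hne ?_) ((dvd_abs _ _).2 h)).trans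
        (abs_sub a t)
      linear_combination (a + t) * h0
  have hodd' : Odd |t| := odd_abs.2 hodd
  rw [← sq_abs] at ht hsf
  generalize |t| = u at *
  have hlow2 : (p : ℤ) - 3 ≤ 2 * u := by linarith
  have hp23 : p < 22 := by
    have : (p : ℤ) < 22 := by nlinarith
    exact_mod_cast this
  have hu : u < 10 := by
    have : (p : ℤ) < 22 := by exact_mod_cast hp23
    nlinarith
  have hu0 : 0 < u := by linarith
  have h27 : ¬ Squarefree ((5 : ℤ) ^ 2 - 4 * (13 : ℕ)) := fun h =>
    absurd (Int.isUnit_iff.1 (h 3 ⟨-3, by norm_num⟩)) (by norm_num)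
  clear hne hdvd hsep ha hlow
  obtain ⟨k, rfl⟩ := hodd'
  have hk : k < 5 := by omega
  have hk0 : 0 ≤ k := by omega
  interval_cases p <;> first | (exfalso; revert hp; norm_num; done) | skip
  all_goals interval_cases k
  all_goals first | (exfalso; norm_num at ht; done) |
    (exfalso; norm_num at hlow2; done) | (exact absurd hsf h27) | norm_num

theorem ncard_apE_of_abs_eq (hp3 : 3 < p) {u : ℤ} (h : |t| = u) {n : ℕ} (hn : u + n = p) :
    {ab : ZMod p × ZMod p | 4 * ab.1 ^ 3 + 27 * ab.2 ^ 2 ≠ 0 ∧ apE p ab.1 ab.2 = t}.ncard =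
      ((Finset.range p ×ˢ Finset.range p).filter fun ab =>
        (4 * ab.1 ^ 3 + 27 * ab.2 ^ 2) % p ≠ 0 ∧ eulerCount p ab.1 ab.2 = n).card := by
  rw [← ncard_apE_eq_card hp3 hn]
  rcases (abs_eq (h ▸ abs_nonneg t)).1 h with rfl | rfl
  · rfl
  · exact ncard_apE_neg hp3 u

/-- Deuring's count for the traces that are not separated modulo `p`. -/
theorem mul_ncard_apE_of_small (hp3 : 3 < p) (hodd : Odd t) (hcm : (cmSet p t).ncard ≠ 0)
    {w : ℕ} (hw : w = 2 ∧ t ^ 2 - 4 * p < -4 ∨ w = 6 ∧ t ^ 2 - 4 * p = -3)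
    (h : (p = 17 ∧ |t| = 7) ∨ (p = 13 ∧ |t| = 7) ∨ (p = 11 ∧ |t| = 5) ∨ (p = 7 ∧ |t| = 3) ∨
        (p = 7 ∧ |t| = 5) ∨ (p = 5 ∧ |t| = 1) ∨ (p = 5 ∧ |t| = 3)) :
    w * {ab : ZMod p × ZMod p |
        4 * ab.1 ^ 3 + 27 * ab.2 ^ 2 ≠ 0 ∧ apE p ab.1 ab.2 = t}.ncard =
      (p - 1) * (cmSet p t).ncard := by
  have hcm1 : t ^ 2 - 4 * p = -3 ∨ t ^ 2 - 4 * p = 1 - 4 * 3 ∨ t ^ 2 - 4 * p = 1 - 4 * 5 →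
      (cmSet p t).ncard = 1 := fun h => le_antisymm
    (by
      rcases h with h | h | h
      · exact ncard_cmSet_le_one_of_eq_neg_three hodd h
      · exact ncard_cmSet_le_one (.inl rfl) h
      · exact ncard_cmSet_le_one (.inr rfl) h) (Nat.one_le_iff_ne_zero.2 hcm)
  rw [← sq_abs] at hw hcm1
  rcases h with ⟨rfl, h⟩ | ⟨rfl, h⟩ | ⟨rfl, h⟩ | ⟨rfl, h⟩ | ⟨rfl, h⟩ | ⟨rfl, h⟩ | ⟨rfl, h⟩
  · obtain rfl : w = 2 := by norm_num [h] at hw; exact hw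
    rw [hcm1 (by norm_num [h]), ncard_apE_of_abs_eq hp3 h (n := 10) (by norm_num)]
    decide +kernel
  · obtain rfl : w = 6 := by norm_num [h] at hw; exact hw
    rw [hcm1 (by norm_num [h]), ncard_apE_of_abs_eq hp3 h (n := 6) (by norm_num)]
    decide +kernel
  · obtain rfl : w = 2 := by norm_num [h] at hw; exact hw
    rw [hcm1 (by norm_num [h]), ncard_apE_of_abs_eq hp3 h (n := 6) (by norm_num)]
    decide +kernel
  · obtain rfl : w = 2 := by norm_num [h] at hw; exact hw
    rw [hcm1 (by norm_num [h]), ncard_apE_of_abs_eq hp3 h (n := 4) (by norm_num)]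
    decide +kernel
  · obtain rfl : w = 6 := by norm_num [h] at hw; exact hw
    rw [hcm1 (by norm_num [h]), ncard_apE_of_abs_eq hp3 h (n := 2) (by norm_num)]
    decide +kernel
  · obtain rfl : w = 2 := by norm_num [h] at hw; exact hw
    rw [hcm1 (by norm_num [h]), ncard_apE_of_abs_eq hp3 h (n := 4) (by norm_num)]
    decide +kernel
  · obtain rfl : w = 2 := by norm_num [h] at hw; exact hw
    rw [hcm1 (by norm_num [h]), ncard_apE_of_abs_eq hp3 h (n := 2) (by norm_num)]
    decide +kernel

end SmallPrimes

end

noncomputable section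

section Deuring

variable {p : ℕ} [Fact p.Prime] {t : ℤ}

theorem mul_ncard_apE (hp3 : 3 < p) (ht : t ^ 2 < 4 * p) (hsf : Squarefree (t ^ 2 - 4 * p))
    (hcm : (cmSet p t).ncard ≠ 0) {w : ℕ}
    (hw : w = 2 ∧ t ^ 2 - 4 * p < -4 ∨ w = 6 ∧ t ^ 2 - 4 * p = -3) :
    w * {ab : ZMod p × ZMod p |
        4 * ab.1 ^ 3 + 27 * ab.2 ^ 2 ≠ 0 ∧ apE p ab.1 ab.2 = t}.ncard =
      (p - 1) * (cmSet p t).ncard := by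
  have hp := (Fact.out : p.Prime)
  have hodd := odd_of_squarefree hsf
  rcases traceSeparated_or hp3 ht hodd hsf with hsep | h
  · obtain ⟨O, hO⟩ := exists_valuationSubring_natCast_mem_nonunits p hp
    have := charP_residueField hp hO
    obtain ⟨W, hW⟩ := exists_modularPolynomial hO
    let ι : ZMod p →+* IsLocalRing.ResidueField O := ZMod.castHom dvd_rfl _
    have htp := not_dvd_of_odd hp3 ht hodd
    rcases hw with ⟨rfl, hD⟩ | ⟨rfl, hD⟩
    · exact two_mul_ncard_apE hp3 hO ι hW htp hodd hsep
        (ne_neg_three_mul_sq hsf (by omega))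
    · rw [ncard_apE_of_eq_neg_three hp3 hO ι hW htp hodd hsep hD,
        le_antisymm (ncard_cmSet_le_one_of_eq_neg_three hodd hD) (Nat.one_le_iff_ne_zero.2 hcm),
        mul_one]
  · exact mul_ncard_apE_of_small hp3 hodd hcm hw h

end Deuring

end

/-- Deuring: for a prime `p > 3` and `t` with `t² < 4p` and `t² - 4p`
squarefree, the number of pairs `(a,b) ∈ 𝔽_p²` with `4a³+27b² ≠ 0` and
`a_p(E(a,b)) = t` is `(p-1)·h(t²-4p)/w(t²-4p)`, where `h` is the class number and `w`
the number of roots of unity of `K = ℚ(√(t²-4p))`, i.e. of any number field `K` of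
degree `2` containing a square root of `t² - 4p`. -/
theorem stmt4 (p : ℕ) (hp : p.Prime) (hp3 : 3 < p) (t : ℤ)
    (ht : t ^ 2 < 4 * (p : ℤ)) (hsf : Squarefree (t ^ 2 - 4 * (p : ℤ)))
    (K : Type) [Field K] [NumberField K] (hdeg : Module.finrank ℚ K = 2)
    (hsqrt : ∃ α : K, α ^ 2 = ((t ^ 2 - 4 * (p : ℤ) : ℤ) : K)) :
    (Nat.card {ab : ZMod p × ZMod p // 4 * ab.1 ^ 3 + 27 * ab.2 ^ 2 ≠ 0 ∧
        apE p ab.1 ab.2 = t} : ℚ) =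
      ((p : ℚ) - 1) * (NumberField.classNumber K : ℚ) /
        (Nat.card ↥(NumberField.Units.torsion K) : ℚ) := by
  have : Fact p.Prime := ⟨hp⟩
  obtain ⟨s, ω, hs, him, hω, hspan⟩ := exists_quadratic_embedding ht hsf hdeg hsqrt
  have hcl : NumberField.classNumber K = (cmSet p t).ncard := by
    rw [← card_classGroup_eq_ncard_cmSet hp hs him hω hspan, Nat.card_eq_fintype_card]
    rfl
  have hcm : (cmSet p t).ncard ≠ 0 := hcl ▸ NumberField.classNumber_ne_zero K
  have hD : t ^ 2 - 4 * p < -4 ∨ t ^ 2 - 4 * p = -3 := by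
    obtain ⟨m, rfl⟩ := odd_of_squarefree hsf
    ring_nf at ht ⊢
    omega
  have hw : Nat.card (NumberField.Units.torsion K) = 2 ∧ t ^ 2 - 4 * p < -4 ∨
      Nat.card (NumberField.Units.torsion K) = 6 ∧ t ^ 2 - 4 * p = -3 :=
    hD.imp (fun h => ⟨card_torsion_eq_two him hω hspan h, h⟩)
      (fun h => ⟨card_torsion_eq_six him hω hspan h, h⟩)
  have key := mul_ncard_apE hp3 ht hsf hcm hw
  have hw0 : (Nat.card (NumberField.Units.torsion K) : ℚ) ≠ 0 := by
    rcases hw with ⟨h, -⟩ | ⟨h, -⟩ <;> rw [h] <;> norm_num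
  rw [eq_div_iff hw0, hcl, mul_comm]
  have hp1 : ((p : ℚ) - 1) = ((p - 1 : ℕ) : ℚ) := by
    rw [Nat.cast_sub hp.one_lt.le, Nat.cast_one]
  rw [hp1]
  exact_mod_cast key
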